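/- arXiv:1808.04120 — 9 statements merged into one kernel-verified Lean document; each statement's English description precedes it below -/
import Mathlib

section
/- Let n ≥ 2 and let Γ ⊊ ℝⁿ be an open convex cone with vertex at the origin, invariant under permutations of the coordinates, and containing the positive orthant Γₙ. Then every x = (x₁,…,xₙ) ∈ Γ satisfies x₁ + ⋯ + xₙ > 0. -/
/-- A permutation-invariant convex set contains, with each vector, the constant vector of its
mean. -/
theorem const_mean_mem {n : ℕ} [NeZero n] {Γ : Set (Fin n → ℝ)} (hconv : Convex ℝ Γ)
    (hperm : ∀ π : Equiv.Perm (Fin n), ∀ x ∈ Γ, (x ∘ π) ∈ Γ) {x : Fin n → ℝ} (hx : x ∈ Γ) :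
    (fun _ => (n : ℝ)⁻¹ * ∑ i, x i) ∈ Γ := by
  have hn : (n : ℝ) ≠ 0 := Nat.cast_ne_zero.mpr (NeZero.ne n)
  have h : ∑ k : Fin n, (n : ℝ)⁻¹ • (x ∘ Equiv.addRight k) ∈ Γ :=
    hconv.sum_mem (fun _ _ => by positivity) (by simp [hn]) fun k _ => hperm _ x hx
  convert h using 1
  funext i
  simp only [Finset.sum_apply, Pi.smul_apply, smul_eq_mul, ← Finset.mul_sum, Function.comp_apply,
    Equiv.coe_addRight]
  rw [← Equiv.sum_comp (Equiv.addLeft i) x]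
  rfl

/-- A convex cone containing the positive orthant and a negative constant vector is the whole
space. -/
theorem eq_univ_of_const_neg_mem {n : ℕ} {Γ : Set (Fin n → ℝ)} (hconv : Convex ℝ Γ)
    (hcone : ∀ x ∈ Γ, ∀ t : ℝ, 0 < t → t • x ∈ Γ)
    (hpos : {x : Fin n → ℝ | ∀ i, 0 < x i} ⊆ Γ) {s : ℝ} (hs : s < 0)
    (hmem : (fun _ => s) ∈ Γ) : Γ = Set.univ := by
  refine Set.eq_univ_of_forall fun z => ?_
  have hp : (fun i => 2 * (z i + (‖z‖ + 1))) ∈ Γ := hpos fun i => by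
    have := (abs_le.mp (norm_le_pi_norm z i)).1
    linarith
  have hq := hcone _ hmem (2 * (‖z‖ + 1) / -s)
    (div_pos (by positivity) (neg_pos.mpr hs))
  convert hconv hp hq (a := 1 / 2) (b := 1 / 2) (by norm_num) (by norm_num) (by norm_num) using 1
  funext i
  simp only [Pi.add_apply, Pi.smul_apply, smul_eq_mul]
  field_simp [hs.ne]
  ring

/-- Let `n ≥ 2` and let `Γ ⊊ ℝⁿ` be an open convex cone with vertex at the
origin, invariant under permutations of the coordinates, and containing the positive orthant
`Γₙ`. Then every `x ∈ Γ` satisfies `x₁ + ⋯ + xₙ > 0`. -/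
theorem stmt_0 (n : ℕ) (hn : 2 ≤ n) (Γ : Set (Fin n → ℝ))
    (hopen : IsOpen Γ) (hconv : Convex ℝ Γ)
    (hcone : ∀ x ∈ Γ, ∀ t : ℝ, 0 < t → t • x ∈ Γ)
    (hperm : ∀ π : Equiv.Perm (Fin n), ∀ x ∈ Γ, (x ∘ π) ∈ Γ)
    (hpos : {x : Fin n → ℝ | ∀ i, 0 < x i} ⊆ Γ)
    (hproper : Γ ≠ Set.univ) :
    ∀ x ∈ Γ, 0 < ∑ i, x i := by
  intro x hx
  by_contra! hsum
  have : NeZero n := ⟨by omega⟩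
  have hmean := const_mean_mem hconv hperm hx
  have hcont : Continuous fun (s : ℝ) (_ : Fin n) => s := by fun_prop
  have hnear := mem_nhdsWithin_of_mem_nhds (t := Set.Iio ((n : ℝ)⁻¹ * ∑ i, x i))
    ((hopen.preimage hcont).mem_nhds hmean)
  obtain ⟨s, hsΓ, hs⟩ := Filter.nonempty_of_mem (Filter.inter_mem hnear self_mem_nhdsWithin)
  have hle : (n : ℝ)⁻¹ * ∑ i, x i ≤ 0 := mul_nonpos_of_nonneg_of_nonpos (by positivity) hsum
  exact hproper (eq_univ_of_const_neg_mem hconv hcone hpos (lt_of_lt_of_le hs hle) hsΓ)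
end

section
/- Let Γ ⊊ ℝⁿ be an open convex cone with vertex at the origin, symmetric under permutations of coordinates, with Γₙ ⊂ Γ, and let f : Γ → ℝ be a differentiable concave function such that for every σ < sup_Γ f and every λ ∈ Γ one has lim_{t→+∞} f(tλ) > σ. Then for every λ ∈ Γ one has Σᵢ (∂f/∂λᵢ)(λ) · λᵢ ≥ 0, i.e. ⟨∇f(λ), λ⟩ ≥ 0. -/
open Filter

/-- Let `Γ ⊊ ℝⁿ` be an open convex cone with vertex at the origin, symmetric
under permutations of coordinates, with `Γₙ ⊆ Γ`, and let `f : Γ → ℝ` be a differentiable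
concave function such that for every `σ < sup_Γ f` and every `λ ∈ Γ` one has
`lim_{t→+∞} f(tλ) > σ` (a limit in `ℝ ∪ {±∞}`, encoded via `EReal`).  Then for every `λ ∈ Γ`
one has `Σᵢ (∂f/∂λᵢ)(λ) · λᵢ ≥ 0`. -/
theorem stmt_1 (n : ℕ) (Γ : Set (Fin n → ℝ))
    (hopen : IsOpen Γ) (hconv : Convex ℝ Γ)
    (hcone : ∀ x ∈ Γ, ∀ t : ℝ, 0 < t → t • x ∈ Γ)
    (hperm : ∀ π : Equiv.Perm (Fin n), ∀ x ∈ Γ, (x ∘ π) ∈ Γ)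
    (hpos : {x : Fin n → ℝ | ∀ i, 0 < x i} ⊆ Γ)
    (hproper : Γ ≠ Set.univ)
    (f : (Fin n → ℝ) → ℝ)
    (hdiff : ∀ x ∈ Γ, DifferentiableAt ℝ f x)
    (hconc : ConcaveOn ℝ Γ f)
    (hgrowth : ∀ σ : ℝ, (∃ x ∈ Γ, σ < f x) → ∀ lam ∈ Γ,
      ∃ L : EReal, Tendsto (fun t : ℝ => (f (t • lam) : EReal)) atTop (nhds L) ∧
        (σ : EReal) < L) :
    ∀ lam ∈ Γ, 0 ≤ ∑ i, fderiv ℝ f lam (Pi.single i 1) * lam i := by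
  intro lam hlam
  have hsum : ∑ i, fderiv ℝ f lam (Pi.single i 1) * lam i = fderiv ℝ f lam lam := by
    generalize fderiv ℝ f lam = f'
    conv_rhs => rw [pi_eq_sum_univ' lam]
    simp [mul_comm]
  rw [hsum]
  by_contra! hneg
  set D := fderiv ℝ f lam lam
  let ℓ : ℝ →ₗ[ℝ] (Fin n → ℝ) := LinearMap.toSpanSingleton ℝ _ lam
  have hconc_ray : ConcaveOn ℝ (ℓ ⁻¹' Γ) (f ∘ ℓ) := hconc.comp_linearMap ℓ
  have hderiv : HasDerivAt (f ∘ ℓ) D 1 := by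
    have hℓ : HasDerivAt (fun t : ℝ => t • lam) lam 1 := by
      simpa using (hasDerivAt_id (1 : ℝ)).smul_const lam
    have hf : HasFDerivAt f (fderiv ℝ f lam) ((1 : ℝ) • lam) := by
      simpa using (hdiff lam hlam).hasFDerivAt
    exact hf.comp_hasDerivAt 1 hℓ
  have htangent : ∀ t : ℝ, 1 < t → f (t • lam) ≤ f lam + D * (t - 1) := by
    intro t ht
    have hslope := hconc_ray.slope_le_of_hasDerivAt (x := 1) (y := t)
      (by simpa [ℓ] using hlam) (hcone lam hlam t (by linarith)) ht hderiv
    rw [slope_def_field, div_le_iff₀ (by linarith)] at hslope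
    simp only [Function.comp_apply, ℓ, LinearMap.toSpanSingleton_apply, one_smul] at hslope
    linarith
  obtain ⟨L, hL, hσ⟩ := hgrowth (f lam - 1) ⟨lam, hlam, by linarith⟩ lam hlam
  obtain ⟨t, ht, ht1, ht2⟩ := ((hL.eventually (lt_mem_nhds hσ)).and
    ((eventually_gt_atTop 1).and (eventually_ge_atTop (1 + 1 / (-D))))).exists
  have hlower : f lam - 1 < f (t • lam) := EReal.coe_lt_coe_iff.mp ht
  have hbound : 1 / (-D) ≤ t - 1 := by linarith
  rw [div_le_iff₀ (by linarith)] at hbound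
  linarith [htangent t ht1]
end

section
/- Let Γ ⊊ ℝⁿ be an open convex cone with vertex at the origin, symmetric under permutations of coordinates, with Γₙ ⊂ Γ, and let f : Γ → ℝ be a smooth symmetric concave function with ∂f/∂λᵢ > 0 on Γ for every i, satisfying: for every σ' < sup_Γ f and every λ ∈ Γ, lim_{t→+∞} f(tλ) > σ'. Then for every σ with sup_{∂Γ} f < σ < sup_Γ f there exists N > 0, depending only on σ (and f, Γ), such that λ + N𝟙 ∈ Γ^σ for every λ ∈ Γ, i.e. f(λ + N𝟙) > σ. -/
open Filter

/-- A concave function on a cone that is bounded below along the ray through `y` does not decrease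
under translation by `y`, at points where it is continuous. -/
lemma ConcaveOn.le_add_of_eventually_lt_smul {E : Type*} [AddCommGroup E] [Module ℝ E]
    [TopologicalSpace E] [ContinuousAdd E] [ContinuousSMul ℝ E] {s : Set E} {f : E → ℝ}
    (hf : ConcaveOn ℝ s f) {x y : E} (hx : x ∈ s) (hy : ∀ t : ℝ, 0 < t → t • y ∈ s)
    (hcont : ContinuousAt f (x + y)) {c : ℝ} (hc : ∀ᶠ t : ℝ in atTop, c < f (t • y)) :
    f x ≤ f (x + y) := by
  have hinv : Tendsto (fun t : ℝ => t⁻¹) atTop (nhds 0) := tendsto_inv_atTop_zero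
  have hone : Tendsto (fun t : ℝ => 1 - t⁻¹) atTop (nhds 1) := by
    simpa using hinv.const_sub 1
  have hleft : Tendsto (fun t : ℝ => (1 - t⁻¹) * f x + t⁻¹ * c) atTop (nhds (f x)) := by
    simpa using (hone.mul_const (f x)).add (hinv.mul_const c)
  have hright : Tendsto (fun t : ℝ => f ((1 - t⁻¹) • x + y)) atTop (nhds (f (x + y))) := by
    refine hcont.tendsto.comp ?_
    simpa using (hone.smul_const x).add_const y
  refine le_of_tendsto_of_tendsto hleft hright ?_
  filter_upwards [hc, eventually_ge_atTop 1] with t ht ht1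
  have ht0 : 0 < t := by linarith
  have hinv1 : t⁻¹ ≤ 1 := inv_le_one_of_one_le₀ ht1
  have h := hf.2 hx (hy t ht0) (sub_nonneg.2 hinv1) (inv_nonneg.2 ht0.le) (by ring)
  rw [inv_smul_smul₀ ht0.ne', smul_eq_mul, smul_eq_mul] at h
  have := mul_le_mul_of_nonneg_left ht.le (inv_nonneg.2 ht0.le)
  linarith

/-- part (1) of Lemma 9 of Székelyhidi. Under the standing hypotheses on the
cone `Γ` and the smooth symmetric concave function `f` with positive partial derivatives and
the growth condition, for every `σ` with `sup_{∂Γ} f < σ < sup_Γ f` there exists `N > 0`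
such that `λ + N𝟙 ∈ Γ^σ` for every `λ ∈ Γ`, i.e. `λ + N𝟙 ∈ Γ` and `f(λ + N𝟙) > σ`. -/
theorem stmt_2 (n : ℕ) (Γ : Set (Fin n → ℝ))
    (hopen : IsOpen Γ) (hconv : Convex ℝ Γ)
    (hcone : ∀ x ∈ Γ, ∀ t : ℝ, 0 < t → t • x ∈ Γ)
    (hperm : ∀ π : Equiv.Perm (Fin n), ∀ x ∈ Γ, (x ∘ π) ∈ Γ)
    (hpos : {x : Fin n → ℝ | ∀ i, 0 < x i} ⊆ Γ)
    (hproper : Γ ≠ Set.univ)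
    (f : (Fin n → ℝ) → ℝ)
    (hf : ContDiffOn ℝ (⊤ : ℕ∞) f Γ)
    (hfsymm : ∀ π : Equiv.Perm (Fin n), ∀ x ∈ Γ, f (x ∘ π) = f x)
    (hconc : ConcaveOn ℝ Γ f)
    (hderivpos : ∀ x ∈ Γ, ∀ i, 0 < fderiv ℝ f x (Pi.single i 1))
    (hgrowth : ∀ σ' : ℝ, (∃ x ∈ Γ, σ' < f x) → ∀ lam ∈ Γ,
      ∃ L : EReal, Tendsto (fun t : ℝ => (f (t • lam) : EReal)) atTop (nhds L) ∧
        (σ' : EReal) < L)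
    (σ : ℝ)
    -- `sup_{∂Γ} f < σ` : the limsup of `f` at every boundary point of `Γ` is at most some
    -- `σ₀ < σ`
    (hσbd : ∃ σ₀ : ℝ, σ₀ < σ ∧ ∀ y ∈ frontier Γ,
      Filter.limsup (fun x => (f x : EReal)) (nhdsWithin y Γ) ≤ (σ₀ : EReal))
    -- `σ < sup_Γ f`
    (hσsup : ∃ x ∈ Γ, σ < f x) :
    ∃ N : ℝ, 0 < N ∧ ∀ lam ∈ Γ,
      (lam + (fun _ => N)) ∈ Γ ∧ σ < f (lam + (fun _ => N)) := by
  have hray : ∀ y ∈ Γ, ∀ᶠ t : ℝ in atTop, σ < f (t • y) := by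
    intro y hy
    obtain ⟨L, hL, hσL⟩ := hgrowth σ hσsup y hy
    filter_upwards [hL.eventually_const_lt hσL] with t ht
    exact_mod_cast ht
  have hmem : (fun _ => 1 : Fin n → ℝ) ∈ Γ := hpos fun _ => one_pos
  obtain ⟨N, hN, hN0⟩ := ((hray _ hmem).and (eventually_gt_atTop 0)).exists
  have hNone : N • (fun _ => 1 : Fin n → ℝ) = fun _ => N := by
    ext; simp
  rw [hNone] at hN
  have hNmem : (fun _ => N : Fin n → ℝ) ∈ Γ := hpos fun _ => hN0
  refine ⟨N, hN0, fun lam hlam => ?_⟩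
  have hsum : (fun _ => N) + lam ∈ Γ := by
    have h := hcone _ (hconv hNmem hlam (a := 1 / 2) (b := 1 / 2) (by norm_num) (by norm_num)
      (by norm_num)) 2 two_pos
    rwa [← smul_add, smul_smul, mul_one_div_cancel two_ne_zero, one_smul] at h
  have hcont : ContinuousAt f ((fun _ => N) + lam) :=
    hf.continuousOn.continuousAt (hopen.mem_nhds hsum)
  rw [add_comm]
  exact ⟨hsum, hN.trans_le
    (hconc.le_add_of_eventually_lt_smul hNmem (hcone lam hlam) hcont (hray lam hlam))⟩
end

section
/- Let Γ ⊊ ℝⁿ be an open convex cone with vertex at the origin, symmetric under permutations of coordinates, with Γₙ ⊂ Γ, and let f : Γ → ℝ be a smooth symmetric concave function with ∂f/∂λᵢ > 0 on Γ for every i, satisfying: for every σ' < sup_Γ f and every λ ∈ Γ, lim_{t→+∞} f(tλ) > σ'. Then for every σ with sup_{∂Γ} f < σ < sup_Γ f there exists τ > 0, depending only on σ (and f, Γ), such that 𝓕(λ) := Σᵢ (∂f/∂λᵢ)(λ) > τ for every λ ∈ Γ with f(λ) = σ. -/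
open Filter

/-- The gradient inequality: a concave function lies below its tangent planes. -/
theorem ConcaveOn.sub_le_fderiv_apply {E : Type*} [NormedAddCommGroup E] [NormedSpace ℝ E]
    {s : Set E} {f : E → ℝ} (hf : ConcaveOn ℝ s f) {x v : E} (hx : x ∈ s) (hxv : x + v ∈ s)
    (hd : DifferentiableAt ℝ f x) : f (x + v) - f x ≤ fderiv ℝ f x v := by
  have hline : HasDerivAt (fun t : ℝ => f (x + t • v)) (fderiv ℝ f x v) 0 :=
    hd.hasFDerivAt.hasLineDerivAt v
  refine ge_of_tendsto hline.tendsto_slope_zero_right ?_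
  filter_upwards [Ioo_mem_nhdsGT (zero_lt_one' ℝ)] with t ht
  have hcomb := hf.2 hx hxv (sub_nonneg.2 ht.2.le) ht.1.le (by ring)
  have hpt : (1 - t) • x + t • (x + v) = x + t • v := by module
  rw [hpt] at hcomb
  simp only [smul_eq_mul, zero_add, zero_smul, add_zero] at hcomb ⊢
  rw [inv_mul_eq_div, le_div_iff₀ ht.1]
  linarith

/-- A concave function on a cone which eventually exceeds `c` along every ray exceeds `c` on a
translate of the whole cone. -/
theorem ConcaveOn.exists_forall_lt_add_smul {E : Type*} [AddCommGroup E] [Module ℝ E]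
    {s : Set E} {f : E → ℝ} {c : ℝ} (hf : ConcaveOn ℝ s f)
    (hcone : ∀ x ∈ s, ∀ t : ℝ, 0 < t → t • x ∈ s)
    (hray : ∀ x ∈ s, ∀ᶠ t : ℝ in atTop, c < f (t • x)) {e : E} (he : e ∈ s) :
    ∃ N : ℝ, 0 < N ∧ ∀ x ∈ s, x + N • e ∈ s ∧ c < f (x + N • e) := by
  obtain ⟨M, hM⟩ := eventually_atTop.1 (hray e he)
  refine ⟨max M 1, by positivity, fun x hx => ?_⟩
  set N := max M 1
  have hN : 0 < N := by positivity
  obtain ⟨T, hTf, hT⟩ := ((hray x hx).and (eventually_gt_atTop 1)).exists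
  have hT₀ : 0 < T := by linarith
  have hT₁ : 0 < T - 1 := by linarith
  set R := N * T / (T - 1) with hR
  have hNR : N ≤ R := by
    rw [hR, le_div_iff₀ hT₁]
    nlinarith
  have hRf : c < f (R • e) := hM R ((le_max_left M 1).trans hNR)
  have hRs : R • e ∈ s := hcone e he R (hN.trans_le hNR)
  have hTs : T • x ∈ s := hcone x hx T hT₀
  have ha : 0 ≤ T⁻¹ := by positivity
  have hb : 0 ≤ 1 - T⁻¹ := sub_nonneg.2 (inv_le_one_of_one_le₀ hT.le)
  have hpt : T⁻¹ • T • x + (1 - T⁻¹) • R • e = x + N • e := by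
    rw [smul_smul, smul_smul, inv_mul_cancel₀ hT₀.ne', one_smul]
    congr 2
    rw [hR]
    field_simp
  have hmem := hf.convex_gt c ⟨hTs, hTf⟩ ⟨hRs, hRf⟩ ha hb (by ring)
  rwa [hpt] at hmem

/-- part (2) of Lemma 9 of Székelyhidi. Under the standing hypotheses on the
cone `Γ` and the smooth symmetric concave function `f` with positive partial derivatives and
the growth condition, for every `σ` with `sup_{∂Γ} f < σ < sup_Γ f` there exists `τ > 0`
such that `𝓕(λ) = Σᵢ (∂f/∂λᵢ)(λ) > τ` for every `λ ∈ ∂Γ^σ = {λ ∈ Γ : f(λ) = σ}`. -/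
theorem stmt_3 (n : ℕ) (Γ : Set (Fin n → ℝ))
    (hopen : IsOpen Γ) (hconv : Convex ℝ Γ)
    (hcone : ∀ x ∈ Γ, ∀ t : ℝ, 0 < t → t • x ∈ Γ)
    (hperm : ∀ π : Equiv.Perm (Fin n), ∀ x ∈ Γ, (x ∘ π) ∈ Γ)
    (hpos : {x : Fin n → ℝ | ∀ i, 0 < x i} ⊆ Γ)
    (hproper : Γ ≠ Set.univ)
    (f : (Fin n → ℝ) → ℝ)
    (hf : ContDiffOn ℝ (⊤ : ℕ∞) f Γ)
    (hfsymm : ∀ π : Equiv.Perm (Fin n), ∀ x ∈ Γ, f (x ∘ π) = f x)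
    (hconc : ConcaveOn ℝ Γ f)
    (hderivpos : ∀ x ∈ Γ, ∀ i, 0 < fderiv ℝ f x (Pi.single i 1))
    (hgrowth : ∀ σ' : ℝ, (∃ x ∈ Γ, σ' < f x) → ∀ lam ∈ Γ,
      ∃ L : EReal, Tendsto (fun t : ℝ => (f (t • lam) : EReal)) atTop (nhds L) ∧
        (σ' : EReal) < L)
    (σ : ℝ)
    -- `sup_{∂Γ} f < σ`
    (hσbd : ∃ σ₀ : ℝ, σ₀ < σ ∧ ∀ y ∈ frontier Γ,
      Filter.limsup (fun x => (f x : EReal)) (nhdsWithin y Γ) ≤ (σ₀ : EReal))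
    -- `σ < sup_Γ f`
    (hσsup : ∃ x ∈ Γ, σ < f x) :
    ∃ τ : ℝ, 0 < τ ∧ ∀ lam ∈ Γ, f lam = σ →
      τ < ∑ i, fderiv ℝ f lam (Pi.single i 1) := by
  obtain ⟨x₀, hx₀, hσx₀⟩ := hσsup
  obtain ⟨σ', hσσ', hσ'x₀⟩ := exists_between hσx₀
  have hray : ∀ x ∈ Γ, ∀ᶠ t : ℝ in atTop, σ' < f (t • x) := fun x hx => by
    obtain ⟨L, hL, hσ'L⟩ := hgrowth σ' ⟨x₀, hx₀, hσ'x₀⟩ x hx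
    filter_upwards [hL.eventually_const_lt hσ'L] with t ht
    exact_mod_cast ht
  obtain ⟨N, hN, hshift⟩ := hconc.exists_forall_lt_add_smul hcone hray
    (hpos (show (1 : Fin n → ℝ) ∈ _ from fun _ => zero_lt_one))
  refine ⟨(σ' - σ) / N, div_pos (sub_pos.2 hσσ') hN, fun x hx hfx => ?_⟩
  obtain ⟨hmem, hlt⟩ := hshift x hx
  have hd : DifferentiableAt ℝ f x :=
    (hf.contDiffAt (hopen.mem_nhds hx)).differentiableAt (by simp)
  have hgrad := hconc.sub_le_fderiv_apply hx hmem hd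
  have hone : (1 : Fin n → ℝ) = ∑ i, Pi.single i 1 := (Finset.univ_sum_single 1).symm
  rw [map_smul, smul_eq_mul, hone, map_sum, ← hone] at hgrad
  rw [div_lt_iff₀ hN]
  linarith
end

section
/- Let Γ ⊊ ℝⁿ be an open convex cone with vertex at the origin, symmetric under permutations of coordinates, with Γₙ ⊂ Γ, let f : Γ → ℝ be a smooth symmetric concave function with ∂f/∂λᵢ > 0 on Γ for every i, and let σ with sup_{∂Γ} f < σ < sup_Γ f. Suppose δ, R > 0 and μ ∈ ℝⁿ satisfy (μ − 2δ𝟙 + Γₙ) ∩ {λ ∈ Γ : f(λ) = σ} ⊂ B_R(0). Then the set A_δ := {v ∈ Γ : f(v) ≤ σ and v ∈ μ − δ𝟙 + Γ̄ₙ} is bounded. -/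
open Filter

/-- In an open convex cone containing the positive orthant, adding a nonnegative vector
stays in the cone. -/
theorem add_mem_of_cone {n : ℕ} {Γ : Set (Fin n → ℝ)} (hopen : IsOpen Γ) (hconv : Convex ℝ Γ)
    (hcone : ∀ x ∈ Γ, ∀ t : ℝ, 0 < t → t • x ∈ Γ)
    (hpos : {x : Fin n → ℝ | ∀ i, 0 < x i} ⊆ Γ)
    {x u : Fin n → ℝ} (hx : x ∈ Γ) (hu : ∀ i, 0 ≤ u i) : x + u ∈ Γ := by
  have hc : Continuous fun t : ℝ => x - t • (1 : Fin n → ℝ) := by fun_prop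
  have hnhds : ∀ᶠ t in nhdsWithin (0 : ℝ) (Set.Ioi 0), x - t • (1 : Fin n → ℝ) ∈ Γ :=
    (hc.tendsto' 0 x (by simp)).eventually (hopen.mem_nhds hx) |>.filter_mono nhdsWithin_le_nhds
  obtain ⟨t, htΓ, ht⟩ := (hnhds.and self_mem_nhdsWithin).exists
  have ht : 0 < t := ht
  have hw : u + t • (1 : Fin n → ℝ) ∈ Γ := hpos fun i => by
    simpa using add_pos_of_nonneg_of_pos (hu i) ht
  have h := hcone _ (hconv htΓ hw (a := 1 / 2) (b := 1 / 2) (by norm_num) (by norm_num)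
    (by norm_num)) 2 (by norm_num)
  convert h using 1
  ext i
  simp
  ring

/-- A function on a convex set with nonnegative partial derivatives is monotone
for the coordinatewise order. -/
theorem le_of_partial_deriv_nonneg {n : ℕ} {Γ : Set (Fin n → ℝ)} (hconv : Convex ℝ Γ)
    {f : (Fin n → ℝ) → ℝ} (hf : ∀ x ∈ Γ, DifferentiableAt ℝ f x)
    (hderiv : ∀ x ∈ Γ, ∀ i, 0 ≤ fderiv ℝ f x (Pi.single i 1))
    {x y : Fin n → ℝ} (hx : x ∈ Γ) (hy : y ∈ Γ) (hxy : ∀ i, x i ≤ y i) : f x ≤ f y := by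
  obtain ⟨z, hz, h⟩ := domain_mvt
    (fun w hw => (hf w hw).hasFDerivAt.hasFDerivWithinAt) hconv hx hy
  have hzΓ := hconv.segment_subset hx hy hz
  have hsum : 0 ≤ fderiv ℝ f z (y - x) := by
    rw [pi_eq_sum_univ' (y - x), map_sum]
    refine Finset.sum_nonneg fun i _ => ?_
    rw [map_smul, smul_eq_mul]
    exact mul_nonneg (sub_nonneg.2 (hxy i)) (hderiv z hzΓ i)
  linarith

/-- Under the standing hypotheses on the cone `Γ` and the smooth symmetric
concave function `f` with positive partial derivatives, let `σ` satisfy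
`sup_{∂Γ} f < σ < sup_Γ f`.  Suppose `δ, R > 0` and `μ ∈ ℝⁿ` satisfy
`(μ − 2δ𝟙 + Γₙ) ∩ {λ ∈ Γ : f(λ) = σ} ⊆ B_R(0)` (Euclidean ball).  Then the set
`A_δ = {v ∈ Γ : f(v) ≤ σ and v ∈ μ − δ𝟙 + Γ̄ₙ}` is bounded. -/
theorem stmt_5 (n : ℕ) (Γ : Set (Fin n → ℝ))
    (hopen : IsOpen Γ) (hconv : Convex ℝ Γ)
    (hcone : ∀ x ∈ Γ, ∀ t : ℝ, 0 < t → t • x ∈ Γ)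
    (hperm : ∀ π : Equiv.Perm (Fin n), ∀ x ∈ Γ, (x ∘ π) ∈ Γ)
    (hpos : {x : Fin n → ℝ | ∀ i, 0 < x i} ⊆ Γ)
    (hproper : Γ ≠ Set.univ)
    (f : (Fin n → ℝ) → ℝ)
    (hf : ContDiffOn ℝ (⊤ : ℕ∞) f Γ)
    (hfsymm : ∀ π : Equiv.Perm (Fin n), ∀ x ∈ Γ, f (x ∘ π) = f x)
    (hconc : ConcaveOn ℝ Γ f)
    (hderivpos : ∀ x ∈ Γ, ∀ i, 0 < fderiv ℝ f x (Pi.single i 1))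
    (σ : ℝ)
    (hσbd : ∃ σ₀ : ℝ, σ₀ < σ ∧ ∀ y ∈ frontier Γ,
      Filter.limsup (fun x => (f x : EReal)) (nhdsWithin y Γ) ≤ (σ₀ : EReal))
    (hσsup : ∃ x ∈ Γ, σ < f x)
    (δ R : ℝ) (hδ : 0 < δ) (hR : 0 < R) (μ : Fin n → ℝ)
    (hμ : ∀ x : Fin n → ℝ,
      (∃ γ : Fin n → ℝ, (∀ i, 0 < γ i) ∧ x = (μ - (fun _ => 2 * δ)) + γ) →
      x ∈ Γ → f x = σ → Real.sqrt (∑ i, x i ^ 2) < R) :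
    Bornology.IsBounded {v : Fin n → ℝ | v ∈ Γ ∧ f v ≤ σ ∧
      ∃ γ ∈ closure {x : Fin n → ℝ | ∀ i, 0 < x i}, v = (μ - (fun _ => δ)) + γ} := by
  obtain ⟨x, hx, hσx⟩ := hσsup
  have hdiff : ∀ y ∈ Γ, DifferentiableAt ℝ f y := fun y hy =>
    (hf.differentiableOn (by simp)).differentiableAt (hopen.mem_nhds hy)
  refine (Metric.isBounded_Icc (fun i => μ i - δ) (fun _ => R)).subset ?_
  rintro v ⟨hv, hfv, γ, hγ, hvγ⟩
  have hγ0 : ∀ i, 0 ≤ γ i := by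
    have hclosed : IsClosed {x : Fin n → ℝ | ∀ i, 0 ≤ x i} := by
      simp only [Set.ofPred_forall]
      exact isClosed_iInter fun i => isClosed_le continuous_const (continuous_apply i)
    have hsub : {x : Fin n → ℝ | ∀ i, 0 < x i} ⊆ {x | ∀ i, 0 ≤ x i} := fun y hy i => (hy i).le
    exact closure_minimal hsub hclosed hγ
  have hvi : ∀ i, v i = μ i - δ + γ i := fun i => congrFun hvγ i
  have hline : ∀ t : ℝ, 0 ≤ t → v + t • (1 : Fin n → ℝ) ∈ Γ := fun t ht =>
    add_mem_of_cone hopen hconv hcone hpos hv fun i => by simpa using ht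
  have hcont : ContinuousOn (fun t : ℝ => f (v + t • (1 : Fin n → ℝ))) (Set.Icc 0 ‖x - v‖) :=
    hf.continuousOn.comp (by fun_prop) fun t ht => hline t ht.1
  have hend : f x ≤ f (v + ‖x - v‖ • (1 : Fin n → ℝ)) := by
    refine le_of_partial_deriv_nonneg hconv hdiff (fun y hy i => (hderivpos y hy i).le) hx
      (hline _ (norm_nonneg _)) fun i => ?_
    have h := (le_abs_self _).trans (norm_le_pi_norm (x - v) i)
    simp only [Pi.sub_apply, Pi.add_apply, Pi.smul_apply, Pi.one_apply, smul_eq_mul,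
      mul_one] at h ⊢
    linarith
  obtain ⟨t, ht, hft⟩ := intermediate_value_Icc (norm_nonneg (x - v)) hcont
    (show σ ∈ Set.Icc _ _ from ⟨by simpa using hfv, hσx.le.trans hend⟩)
  have hlt := hμ (v + t • (1 : Fin n → ℝ)) ⟨fun i => γ i + δ + t, fun i => by
    linarith [hγ0 i, ht.1], by
      ext i
      simp [hvi i]
      ring⟩ (hline t ht.1) hft
  refine ⟨fun i => by linarith [hvi i, hγ0 i], fun i => ?_⟩
  have hle : (v + t • (1 : Fin n → ℝ)) i ≤ √(∑ j, (v + t • (1 : Fin n → ℝ)) j ^ 2) :=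
    Real.le_sqrt_of_sq_le (Finset.single_le_sum
      (f := fun j => (v + t • (1 : Fin n → ℝ)) j ^ 2) (fun j _ => sq_nonneg _)
      (Finset.mem_univ i))
  have hi : (v + t • (1 : Fin n → ℝ)) i = v i + t := by simp
  linarith [ht.1]
end

section
/- Let Γ ⊊ ℝⁿ be an open convex cone with vertex at the origin, symmetric under permutations of coordinates, with Γₙ ⊂ Γ, and let f : Γ → ℝ be a smooth symmetric concave function with ∂f/∂λᵢ > 0 on Γ for every i. Set Γ_∞ := {λ' ∈ ℝⁿ⁻¹ : (λ', s) ∈ Γ for some s ∈ ℝ}. Then the increasing limit lim_{t→+∞} f(λ'₁,…,λ'ₙ₋₁, t) is either finite for every λ' ∈ Γ_∞ or equal to +∞ for every λ' ∈ Γ_∞; that is, if the limit is finite for one λ' ∈ Γ_∞ then it is finite for all λ' ∈ Γ_∞. -/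
open Filter

theorem snoc_eq_add_single {n : ℕ} (v : Fin n → ℝ) (s t : ℝ) :
    (Fin.snoc v t : Fin (n + 1) → ℝ) =
      (Fin.snoc v s : Fin (n + 1) → ℝ) + (t - s) • Pi.single (Fin.last n) (1 : ℝ) := by
  ext i
  refine Fin.lastCases ?_ (fun j => ?_) i <;> simp

theorem smul_snoc_add_smul_snoc {n : ℕ} (v w : Fin n → ℝ) (a b s t : ℝ) :
    a • (Fin.snoc v s : Fin (n + 1) → ℝ) + b • (Fin.snoc w t : Fin (n + 1) → ℝ) =
      (Fin.snoc (a • v + b • w) (a * s + b * t) : Fin (n + 1) → ℝ) := by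
  ext i
  refine Fin.lastCases ?_ (fun j => ?_) i <;> simp

/-- An open convex cone containing the positive orthant is stable under adding nonnegative
vectors. -/
theorem add_mem_of_nonneg {ι : Type*} [Fintype ι] {Γ : Set (ι → ℝ)}
    (hopen : IsOpen Γ) (hconv : Convex ℝ Γ)
    (hcone : ∀ x ∈ Γ, ∀ t : ℝ, 0 < t → t • x ∈ Γ)
    (hpos : {x : ι → ℝ | ∀ i, 0 < x i} ⊆ Γ)
    {x v : ι → ℝ} (hx : x ∈ Γ) (hv : 0 ≤ v) : x + v ∈ Γ := by
  have hcont : Continuous fun δ : ℝ => x - δ • (1 : ι → ℝ) := by fun_prop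
  have hev : ∀ᶠ δ in nhds (0 : ℝ), x - δ • (1 : ι → ℝ) ∈ Γ :=
    hcont.continuousAt.eventually_mem (hopen.mem_nhds (by simpa using hx))
  obtain ⟨δ, hδ, hδpos⟩ :=
    ((hev.filter_mono nhdsWithin_le_nhds).and
      (self_mem_nhdsWithin : Set.Ioi (0 : ℝ) ∈ nhdsWithin 0 (Set.Ioi 0))).exists
  have hw : v + δ • (1 : ι → ℝ) ∈ Γ := hpos fun i => by
    have := hv i
    simp only [Pi.zero_apply] at this
    simpa using add_pos_of_nonneg_of_pos this hδpos
  have hmid := hcone _ (hconv hδ hw (by norm_num : (0 : ℝ) ≤ 1 / 2)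
    (by norm_num : (0 : ℝ) ≤ 1 / 2) (by norm_num)) 2 (by norm_num)
  convert hmid using 1
  module

/-- A function whose directional derivative along `v` is positive on an open set is monotone
along any ray in direction `v` contained in that set. -/
theorem monotoneOn_add_smul {E : Type*} [NormedAddCommGroup E] [NormedSpace ℝ E]
    {Γ : Set E} (hopen : IsOpen Γ) {f : E → ℝ} (hf : DifferentiableOn ℝ f Γ) {x v : E}
    (hv : ∀ y ∈ Γ, 0 < fderiv ℝ f y v) (hx : ∀ t : ℝ, 0 ≤ t → x + t • v ∈ Γ) :
    MonotoneOn (fun t : ℝ => f (x + t • v)) (Set.Ici 0) := by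
  have hderiv : ∀ t : ℝ, 0 ≤ t →
      HasDerivAt (fun t : ℝ => f (x + t • v)) (fderiv ℝ f (x + t • v) v) t := by
    intro t ht
    have hline : HasDerivAt (fun t : ℝ => x + t • v) v t := by
      simpa using ((hasDerivAt_id t).smul_const v).const_add x
    exact ((hf.differentiableAt (hopen.mem_nhds (hx t ht))).hasFDerivAt).comp_hasDerivAt t hline
  refine monotoneOn_of_deriv_nonneg (convex_Ici 0)
    (fun t ht => (hderiv t ht).continuousAt.continuousWithinAt)
    (fun t ht => ((hderiv t (interior_subset ht)).differentiableAt).differentiableWithinAt)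
    (fun t ht => ?_)
  have ht0 : 0 ≤ t := interior_subset ht
  rw [(hderiv t ht0).deriv]
  exact (hv _ (hx t ht0)).le

/-- A function on `ℝ` that is monotone on a half-line and bounded above there converges. -/
theorem exists_tendsto_of_monotoneOn_Ici {g : ℝ → ℝ} {s C : ℝ}
    (hg : MonotoneOn g (Set.Ici s)) (hC : ∀ t, s ≤ t → g t ≤ C) :
    ∃ L, Tendsto g atTop (nhds L) := by
  have hmono : Monotone fun t => g (max s t) := fun t u htu =>
    hg (le_max_left s t) (le_max_left s u) (max_le_max_left s htu)
  refine ⟨_, (tendsto_atTop_ciSup hmono ⟨C, ?_⟩).congr' ?_⟩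
  · rintro _ ⟨t, rfl⟩
    exact hC _ (le_max_left s t)
  · filter_upwards [eventually_ge_atTop s] with t ht
    simp [ht]

/-- Let `Γ ⊊ ℝⁿ` (here `n + 1` coordinates, `n ≥ 0`) be an open convex cone
with vertex at the origin, symmetric under permutations, containing the positive orthant, and
let `f : Γ → ℝ` be a smooth symmetric concave function with positive partial derivatives.
For `λ' ∈ Γ_∞ = {λ' : (λ', s) ∈ Γ for some s}`, the increasing limit
`lim_{t→+∞} f(λ', t)` is either finite for every `λ' ∈ Γ_∞` or `+∞` for every `λ' ∈ Γ_∞`: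
if it is finite (i.e. the limit exists in `ℝ`) for one `λ' ∈ Γ_∞`, it is finite for all. -/
theorem stmt_7 (n : ℕ) (Γ : Set (Fin (n + 1) → ℝ))
    (hopen : IsOpen Γ) (hconv : Convex ℝ Γ)
    (hcone : ∀ x ∈ Γ, ∀ t : ℝ, 0 < t → t • x ∈ Γ)
    (hperm : ∀ π : Equiv.Perm (Fin (n + 1)), ∀ x ∈ Γ, (x ∘ π) ∈ Γ)
    (hpos : {x : Fin (n + 1) → ℝ | ∀ i, 0 < x i} ⊆ Γ)
    (hproper : Γ ≠ Set.univ)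
    (f : (Fin (n + 1) → ℝ) → ℝ)
    (hf : ContDiffOn ℝ (⊤ : ℕ∞) f Γ)
    (hfsymm : ∀ π : Equiv.Perm (Fin (n + 1)), ∀ x ∈ Γ, f (x ∘ π) = f x)
    (hconc : ConcaveOn ℝ Γ f)
    (hderivpos : ∀ x ∈ Γ, ∀ i, 0 < fderiv ℝ f x (Pi.single i 1)) :
    (∃ lam' : Fin n → ℝ, (∃ s : ℝ, Fin.snoc lam' s ∈ Γ) ∧
      ∃ L : ℝ, Tendsto (fun t : ℝ => f (Fin.snoc lam' t)) atTop (nhds L)) →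
    ∀ lam' : Fin n → ℝ, (∃ s : ℝ, Fin.snoc lam' s ∈ Γ) →
      ∃ L : ℝ, Tendsto (fun t : ℝ => f (Fin.snoc lam' t)) atTop (nhds L) := by
  rintro ⟨a, ⟨sa, ha⟩, L, hL⟩ b ⟨sb, hb⟩
  have hmem : ∀ (c : Fin n → ℝ) (s : ℝ), (Fin.snoc c s : Fin (n + 1) → ℝ) ∈ Γ →
      ∀ t, s ≤ t → (Fin.snoc c t : Fin (n + 1) → ℝ) ∈ Γ := by
    intro c s hc t hst
    rw [snoc_eq_add_single c s t]
    exact add_mem_of_nonneg hopen hconv hcone hpos hc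
      (smul_nonneg (sub_nonneg.2 hst) (Pi.single_nonneg.2 zero_le_one))
  have hmono : ∀ (c : Fin n → ℝ) (s : ℝ), (Fin.snoc c s : Fin (n + 1) → ℝ) ∈ Γ →
      MonotoneOn (fun t : ℝ => f (Fin.snoc c t)) (Set.Ici s) := by
    intro c s hc t ht u hu htu
    have hray := monotoneOn_add_smul hopen (hf.differentiableOn (by simp))
      (fun y hy => hderivpos y hy (Fin.last n))
      (x := (Fin.snoc c s : Fin (n + 1) → ℝ)) (fun r hr =>
        add_mem_of_nonneg hopen hconv hcone hpos hc
          (smul_nonneg hr (Pi.single_nonneg.2 zero_le_one)))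
    have := hray (Set.mem_Ici.2 (sub_nonneg.2 ht)) (Set.mem_Ici.2 (sub_nonneg.2 hu))
      (sub_le_sub_right htu s)
    simpa only [← snoc_eq_add_single] using this
  have hcont : Continuous fun ε : ℝ =>
      (1 + ε) • (Fin.snoc a sa : Fin (n + 1) → ℝ) +
        (-ε) • (Fin.snoc b sb : Fin (n + 1) → ℝ) := by fun_prop
  have hev := hcont.continuousAt.eventually_mem (x := 0)
    (hopen.mem_nhds (by simpa using ha))
  obtain ⟨ε, hc, hε⟩ :=
    ((hev.filter_mono nhdsWithin_le_nhds).and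
      (self_mem_nhdsWithin : Set.Ioi (0 : ℝ) ∈ nhdsWithin 0 (Set.Ioi 0))).exists
  replace hε : 0 < ε := hε
  rw [smul_snoc_add_smul_snoc] at hc
  set c : Fin n → ℝ := (1 + ε) • a + (-ε) • b with hcdef
  set sc : ℝ := (1 + ε) * sa + -ε * sb
  have hale : ∀ t, sa ≤ t → f (Fin.snoc a t) ≤ L := fun t ht =>
    ge_of_tendsto hL <| by
      filter_upwards [eventually_ge_atTop t] with u hu
      exact hmono a sa ha ht (ht.trans hu) hu
  have hε1 : 0 < 1 + ε := by linarith
  have hbound : ∀ t, max sa (max sb sc) ≤ t →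
      f (Fin.snoc b t) ≤ ((1 + ε) * L - f (Fin.snoc c sc)) / ε := by
    intro t ht
    simp only [max_le_iff] at ht
    obtain ⟨hta, htb, htc⟩ := ht
    have hab : (1 / (1 + ε)) • (Fin.snoc c t : Fin (n + 1) → ℝ) +
        (ε / (1 + ε)) • (Fin.snoc b t : Fin (n + 1) → ℝ) = Fin.snoc a t := by
      rw [smul_snoc_add_smul_snoc]
      congr 1
      · ext i
        simp only [hcdef, Pi.add_apply, Pi.smul_apply, smul_eq_mul]
        field_simp
        ring
      · field_simp
    have hconcave := hconc.2 (hmem c sc hc t htc) (hmem b sb hb t htb)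
      (by positivity : 0 ≤ 1 / (1 + ε)) (by positivity : 0 ≤ ε / (1 + ε)) (by field_simp)
    rw [hab] at hconcave
    have hcle := hmono c sc hc (Set.self_mem_Ici) htc htc
    have hsum : (f (Fin.snoc c t) + ε * f (Fin.snoc b t)) / (1 + ε) ≤ L := by
      refine le_trans (le_of_eq ?_) (hconcave.trans (hale t hta))
      simp only [smul_eq_mul]
      ring
    rw [div_le_iff₀ hε1] at hsum
    rw [le_div_iff₀ hε]
    simp only at hcle
    linarith
  exact exists_tendsto_of_monotoneOn_Ici
    ((hmono b sb hb).mono (Set.Ici_subset_Ici.2 ((le_max_left sb sc).trans (le_max_right sa _))))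
    hbound
end

section
/- Let n ≥ 2. The map A ↦ (det A)·A⁻¹ is a bijection from the set of positive definite n×n Hermitian matrices onto itself; moreover, for every positive definite Hermitian A one has det((det A)·A⁻¹) = (det A)^{n−1}. (This is the coordinate expression of the bijection ω ↦ ω^{n−1}/(n−1)! from strictly transverse positive (1,1)-forms to strictly transverse positive (n−1,n−1)-forms.) -/
open scoped ComplexOrder

namespace Matrix

variable {m : Type*} [Fintype m] [DecidableEq m]

theorem PosDef.exists_pos_det_eq_ofReal {A : Matrix m m ℂ} (hA : A.PosDef) :
    ∃ r : ℝ, 0 < r ∧ A.det = r := by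
  obtain ⟨r, hr, h⟩ := RCLike.pos_iff_exists_ofReal.mp hA.det_pos
  exact ⟨r, hr, h.symm⟩

theorem det_smul_inv_eq_adjugate {A : Matrix m m ℂ} (hA : A.det ≠ 0) :
    A.det • A⁻¹ = A.adjugate := by
  rw [inv_def, smul_smul, Ring.inverse_eq_inv', mul_inv_cancel₀ hA, one_smul]

theorem PosDef.det_det_smul_inv {A : Matrix m m ℂ} (hA : A.PosDef) :
    (A.det • A⁻¹).det = A.det ^ (Fintype.card m - 1) := by
  rw [det_smul_inv_eq_adjugate hA.det_pos.ne', det_adjugate]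

theorem PosDef.det_smul_inv {A : Matrix m m ℂ} (hA : A.PosDef) : (A.det • A⁻¹).PosDef :=
  hA.inv.smul hA.det_pos

theorem injOn_det_smul_inv (hm : 2 ≤ Fintype.card m) :
    Set.InjOn (fun A : Matrix m m ℂ => A.det • A⁻¹) {A | A.PosDef} := by
  intro A hA B hB h
  have h_eq : A.det • A⁻¹ = B.det • B⁻¹ := h
  have h_det : A.det = B.det := by
    have h_pow := congrArg det h_eq
    rw [hA.det_det_smul_inv, hB.det_det_smul_inv] at h_pow
    obtain ⟨r, hr, h_r⟩ := hA.exists_pos_det_eq_ofReal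
    obtain ⟨s, hs, h_s⟩ := hB.exists_pos_det_eq_ofReal
    rw [h_r, h_s] at h_pow ⊢
    norm_cast at h_pow ⊢
    exact (pow_left_inj₀ hr.le hs.le (by omega)).mp h_pow
  rw [h_det] at h_eq
  exact inv_inj (smul_right_injective _ hB.det_pos.ne' h_eq) hA.det_pos.ne'.isUnit

theorem surjOn_det_smul_inv (hm : 2 ≤ Fintype.card m) :
    Set.SurjOn (fun A : Matrix m m ℂ => A.det • A⁻¹) {A | A.PosDef} {A | A.PosDef} := by
  intro B hB
  have h_pos : B.PosDef := hB
  obtain ⟨d, hd, h_d⟩ := h_pos.exists_pos_det_eq_ofReal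
  obtain ⟨c, hc, h_c⟩ : ∃ c : ℝ, 0 < c ∧ c ^ (Fintype.card m - 1) = d :=
    ⟨d ^ ((Fintype.card m - 1 : ℕ) : ℝ)⁻¹, Real.rpow_pos_of_pos hd _,
      Real.rpow_inv_natCast_pow hd.le (by omega)⟩
  have h_c_pos : (0 : ℂ) < c := by exact_mod_cast hc
  have h_det : ((c : ℂ) • B⁻¹).det = c := by
    rw [det_smul, det_nonsing_inv, Ring.inverse_eq_inv', h_d, ← h_c,
      ← Nat.sub_add_cancel (show 1 ≤ Fintype.card m by omega), pow_succ]
    push_cast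
    field_simp [h_c_pos.ne']
  refine ⟨(c : ℂ) • B⁻¹, h_pos.inv.smul h_c_pos, ?_⟩
  have h_inv : ((c : ℂ) • B⁻¹)⁻¹ = (c : ℂ)⁻¹ • B := by
    apply inv_eq_left_inv
    rw [smul_mul_smul_comm, inv_mul_cancel₀ h_c_pos.ne', one_smul,
      mul_nonsing_inv _ h_pos.det_pos.ne'.isUnit]
  change ((c : ℂ) • B⁻¹).det • ((c : ℂ) • B⁻¹)⁻¹ = B
  rw [h_det, h_inv, smul_smul, mul_inv_cancel₀ h_c_pos.ne', one_smul]

end Matrix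

/-- For `n ≥ 2`, the map `A ↦ (det A) · A⁻¹` is a bijection from the set of
positive definite `n×n` Hermitian matrices onto itself, and for every positive definite
Hermitian `A` one has `det((det A) · A⁻¹) = (det A)^(n−1)`.  (Coordinate expression of the
bijection `ω ↦ ω^{n−1}/(n−1)!` between strictly transverse positive `(1,1)`- and
`(n−1,n−1)`-forms.) -/
theorem stmt_9 (n : ℕ) (hn : 2 ≤ n) :
    Set.BijOn (fun A : Matrix (Fin n) (Fin n) ℂ => A.det • A⁻¹)
      {A : Matrix (Fin n) (Fin n) ℂ | A.PosDef}
      {A : Matrix (Fin n) (Fin n) ℂ | A.PosDef} ∧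
    ∀ A : Matrix (Fin n) (Fin n) ℂ, A.PosDef →
      (A.det • A⁻¹).det = A.det ^ (n - 1) := by
  have h_card : 2 ≤ Fintype.card (Fin n) := by rwa [Fintype.card_fin]
  refine ⟨⟨fun A hA => Matrix.PosDef.det_smul_inv hA, Matrix.injOn_det_smul_inv h_card,
    Matrix.surjOn_det_smul_inv h_card⟩, fun A hA => ?_⟩
  rw [hA.det_det_smul_inv, Fintype.card_fin]
end

section
/- Let n ≥ 2 and let Γ ⊊ ℝⁿ be an open convex cone with vertex at the origin, symmetric under permutations of coordinates, with Γₙ ⊆ Γ. Let u : ℂⁿ → ℝ be a Lipschitz Γ-solution such that |u| ≤ C on ℂⁿ and u has Lipschitz constant bounded by C, for some constant C. Then u is a constant function. -/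
open Filter

/-- The complex Hessian entry `∂²h/∂zᵢ∂z̄ⱼ(z)` of a real-valued function `h` on `ℂⁿ`,
computed from real second directional derivatives:
`∂²h/∂zᵢ∂z̄ⱼ = ¼[(h_{xᵢxⱼ} + h_{yᵢyⱼ}) + √−1 (h_{xᵢyⱼ} − h_{yᵢxⱼ})]`,
where the direction `xᵢ` is `Pi.single i 1` and `yᵢ` is `Pi.single i √−1`. -/
noncomputable def cplxHessianEntry (n : ℕ) (h : (Fin n → ℂ) → ℝ) (z : Fin n → ℂ)
    (i j : Fin n) : ℂ :=
  (1 / 4 : ℂ) *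
    (((fderiv ℝ (fun w => fderiv ℝ h w (Pi.single i 1)) z (Pi.single j 1) +
        fderiv ℝ (fun w => fderiv ℝ h w (Pi.single i Complex.I)) z
          (Pi.single j Complex.I) : ℝ) : ℂ) +
      Complex.I *
        ((fderiv ℝ (fun w => fderiv ℝ h w (Pi.single i 1)) z (Pi.single j Complex.I) -
          fderiv ℝ (fun w => fderiv ℝ h w (Pi.single i Complex.I)) z
            (Pi.single j 1) : ℝ) : ℂ))

/-- The complex Hessian matrix `(h_{i\bar j}(z))` of `h : ℂⁿ → ℝ` at `z`. -/
noncomputable def cplxHessian (n : ℕ) (h : (Fin n → ℂ) → ℝ) (z : Fin n → ℂ) :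
    Matrix (Fin n) (Fin n) ℂ :=
  Matrix.of fun i j => cplxHessianEntry n h z i j

/-- `u` is a (viscosity) `Γ`-subsolution: whenever a `C²` function `h` touches `u` from above
(i.e. `u − h` has a local maximum at `z`), the eigenvalue vector of the complex Hessian of
`h` at `z` lies in the closure of `Γ`. -/
def IsGammaSubsolution (n : ℕ) (Γ : Set (Fin n → ℝ)) (u : (Fin n → ℂ) → ℝ) : Prop :=
  ∀ h : (Fin n → ℂ) → ℝ, ContDiff ℝ 2 h → ∀ z : Fin n → ℂ,
    IsLocalMax (fun w => u w - h w) z →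
    ∀ hH : (cplxHessian n h z).IsHermitian, hH.eigenvalues ∈ closure Γ

/-- `u` is a `Γ`-solution: it is a `Γ`-subsolution, and whenever a `C²` function `h` touches
`u` from below (i.e. `u − h` has a local minimum at `z`), the eigenvalue vector of the complex
Hessian of `h` at `z` lies in `ℝⁿ ∖ Γ`. -/
def IsGammaSolution (n : ℕ) (Γ : Set (Fin n → ℝ)) (u : (Fin n → ℂ) → ℝ) : Prop :=
  IsGammaSubsolution n Γ u ∧
  ∀ h : (Fin n → ℂ) → ℝ, ContDiff ℝ 2 h → ∀ z : Fin n → ℂ,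
    IsLocalMin (fun w => u w - h w) z →
    ∀ hH : (cplxHessian n h z).IsHermitian, hH.eigenvalues ∉ Γ

open scoped Topology

/-- The average of `g` over the points `x ± s eᵢ`, `x ± s √−1 eᵢ`, with weight `fᵢ / 4` for each
of the four points of index `i`. -/
noncomputable def frameAverage {n : ℕ} (f : Fin n → ℝ) (e : Matrix (Fin n) (Fin n) ℂ) (s : ℝ)
    (g : (Fin n → ℂ) → ℝ) (x : Fin n → ℂ) : ℝ :=
  ∑ i, f i / 4 * (g (x + s • e i) + g (x - s • e i) +
    g (x + s • (Complex.I • e i)) + g (x - s • (Complex.I • e i)))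

/-- A probability vector which is nonnegative on `Γ` as a linear functional. -/
structure IsDualWeight {n : ℕ} (Γ : Set (Fin n → ℝ)) (f : Fin n → ℝ) : Prop where
  nonneg : ∀ i, 0 ≤ f i
  sum_eq_one : ∑ i, f i = 1
  dual : ∀ x ∈ Γ, 0 ≤ ∑ i, f i * x i

/-- The quantity `∑ᵢ fᵢ h_{eᵢ ēᵢ}(z)` equals `ℓ`, in terms of second differences. -/
def HasFrameLaplacian {n : ℕ} (f : Fin n → ℝ) (e : Matrix (Fin n) (Fin n) ℂ)
    (h : (Fin n → ℂ) → ℝ) (z : Fin n → ℂ) (l : ℝ) : Prop :=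
  Tendsto (fun s : ℝ => (frameAverage f e s h z - h z) / s ^ 2) (𝓝[>] 0) (𝓝 l)

section SecondDifference

variable {E : Type*} [NormedAddCommGroup E] [NormedSpace ℝ E]

theorem hasDerivAt_comp_line {h : E → ℝ} (hh : Differentiable ℝ h) (z b : E) (t : ℝ) :
    HasDerivAt (fun s : ℝ => h (z + s • b)) (fderiv ℝ h (z + t • b) b) t := by
  have h1 : HasDerivAt (fun s : ℝ => z + s • b) b t := by
    simpa using ((hasDerivAt_id t).smul_const b).const_add z
  exact (hh (z + t • b)).hasFDerivAt.comp_hasDerivAt t h1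

theorem tendsto_second_difference {h : E → ℝ} (hh : ContDiff ℝ 2 h) (z b : E) :
    Tendsto (fun s : ℝ => (h (z + s • b) + h (z - s • b) - 2 * h z) / s ^ 2) (𝓝[>] 0)
      (𝓝 (fderiv ℝ (fderiv ℝ h) z b b)) := by
  have hd : Differentiable ℝ h := hh.differentiable (by norm_num)
  have hd2 : Differentiable ℝ (fderiv ℝ h) :=
    (hh.fderiv_right (m := 1) (by norm_num)).differentiable (by norm_num)
  set ψ : ℝ → ℝ := fun s => fderiv ℝ h (z + s • b) b with hψ
  have hψ' : HasDerivAt ψ (fderiv ℝ (fderiv ℝ h) z b b) 0 := by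
    have h1 : HasDerivAt (fun s : ℝ => z + s • b) b 0 := by
      simpa using ((hasDerivAt_id (0 : ℝ)).smul_const b).const_add z
    have h2 : HasFDerivAt (fderiv ℝ h) (fderiv ℝ (fderiv ℝ h) z) (z + (0 : ℝ) • b) := by
      simpa using (hd2 z).hasFDerivAt
    have h3 := h2.comp_hasDerivAt (0 : ℝ) h1
    simpa using h3.clm_apply (hasDerivAt_const (0 : ℝ) b)
  have hψneg : HasDerivAt (fun s => ψ (-s)) (-(fderiv ℝ (fderiv ℝ h) z b b)) 0 := by
    have h1 : HasDerivAt ψ (fderiv ℝ (fderiv ℝ h) z b b) (-0) := by simpa using hψ'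
    simpa [Function.comp_def] using h1.comp (0 : ℝ) (hasDerivAt_neg (0 : ℝ))
  have hline : ∀ t : ℝ, HasDerivAt (fun s : ℝ => h (z + s • b)) (ψ t) t :=
    hasDerivAt_comp_line hd z b
  have hline' : ∀ t : ℝ, HasDerivAt (fun s : ℝ => h (z - s • b)) (-ψ (-t)) t := by
    intro t
    have := (hline (-t)).comp t (hasDerivAt_neg t)
    simpa [Function.comp_def, sub_eq_add_neg] using this
  have hp : ∀ t : ℝ, HasDerivAt (fun s : ℝ => h (z + s • b) + h (z - s • b) - 2 * h z)
      (ψ t - ψ (-t)) t := fun t => by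
    simpa [sub_eq_add_neg] using ((hline t).add (hline' t)).sub_const (2 * h z)
  refine HasDerivAt.lhopital_zero_nhdsGT (f' := fun t => ψ t - ψ (-t)) (g' := fun t => 2 * t)
    (Eventually.of_forall hp) (Eventually.of_forall fun t => by simpa using hasDerivAt_pow 2 t)
    ?_ ?_ ?_ ?_
  · filter_upwards [self_mem_nhdsWithin] with t ht
    have : (0 : ℝ) < t := ht
    positivity
  · have := (hp 0).continuousAt.tendsto
    simp only [zero_smul, add_zero, sub_zero] at this
    rw [show h z + h z - 2 * h z = 0 by ring] at this
    exact this.mono_left nhdsWithin_le_nhds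
  · have : Tendsto (fun t : ℝ => t ^ 2) (𝓝 0) (𝓝 (0 ^ 2)) := (continuous_pow 2).tendsto 0
    simpa using this.mono_left nhdsWithin_le_nhds
  · have h1 := (hψ'.sub hψneg).tendsto_slope_zero_right
    have h2 := h1.const_mul (1 / 2 : ℝ)
    have e1 : (1 / 2 : ℝ) * (fderiv ℝ (fderiv ℝ h) z b b - -(fderiv ℝ (fderiv ℝ h) z b b))
        = fderiv ℝ (fderiv ℝ h) z b b := by ring
    rw [e1] at h2
    refine h2.congr' ?_
    filter_upwards [self_mem_nhdsWithin] with t ht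
    have : t ≠ 0 := ne_of_gt ht
    simp
    field_simp

end SecondDifference

theorem hasFrameLaplacian_of_contDiff {n : ℕ} (f : Fin n → ℝ) (e : Matrix (Fin n) (Fin n) ℂ)
    {h : (Fin n → ℂ) → ℝ} (hh : ContDiff ℝ 2 h) (hf : ∑ i, f i = 1) (z : Fin n → ℂ) :
    HasFrameLaplacian f e h z (∑ i, f i / 4 * (fderiv ℝ (fderiv ℝ h) z (e i) (e i) +
      fderiv ℝ (fderiv ℝ h) z (Complex.I • e i) (Complex.I • e i))) := by
  have h1 := tendsto_finsetSum (Finset.univ : Finset (Fin n)) (fun i _ =>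
    ((tendsto_second_difference hh z (e i)).add
      (tendsto_second_difference hh z (Complex.I • e i))).const_mul (f i / 4))
  refine h1.congr fun s => ?_
  have : h z = ∑ i, f i * h z := by rw [← Finset.sum_mul, hf, one_mul]
  rw [frameAverage]
  conv_rhs => rw [this, ← Finset.sum_sub_distrib, Finset.sum_div]
  refine Finset.sum_congr rfl fun i _ => ?_
  ring

theorem isHermitian_cplxHessian {n : ℕ} {h : (Fin n → ℂ) → ℝ} (hh : ContDiff ℝ 2 h)
    (z : Fin n → ℂ) : (cplxHessian n h z).IsHermitian := by
  have hd2 : Differentiable ℝ (fderiv ℝ h) :=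
    (hh.fderiv_right (m := 1) (by norm_num)).differentiable (by norm_num)
  have hD : ∀ X Y, fderiv ℝ (fun w => fderiv ℝ h w X) z Y = fderiv ℝ (fderiv ℝ h) z Y X := by
    intro X Y
    rw [fderiv_clm_apply (hd2 z) (by fun_prop)]
    simp
  have hsymm : ∀ X Y, fderiv ℝ (fderiv ℝ h) z X Y = fderiv ℝ (fderiv ℝ h) z Y X :=
    fun X Y => (hh.contDiffAt (x := z)).isSymmSndFDerivAt (by simp) X Y
  ext i j
  simp only [cplxHessian, Matrix.conjTranspose_apply, Matrix.of_apply, cplxHessianEntry, hD]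
  rw [hsymm (Pi.single j Complex.I) (Pi.single i 1), hsymm (Pi.single j 1) (Pi.single i Complex.I),
    hsymm (Pi.single j 1) (Pi.single i 1), hsymm (Pi.single j Complex.I) (Pi.single i Complex.I)]
  simp [Complex.ext_iff]

theorem re_cplxHessian_form {n : ℕ} {h : (Fin n → ℂ) → ℝ} (hh : ContDiff ℝ 2 h)
    (z b : Fin n → ℂ) :
    (∑ i, ∑ j, cplxHessian n h z i j * b i * star (b j)).re =
      1 / 4 * (fderiv ℝ (fderiv ℝ h) z b b +
        fderiv ℝ (fderiv ℝ h) z (Complex.I • b) (Complex.I • b)) := by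
  have hd2 : Differentiable ℝ (fderiv ℝ h) :=
    (hh.fderiv_right (m := 1) (by norm_num)).differentiable (by norm_num)
  have hD : ∀ X Y, fderiv ℝ (fun w => fderiv ℝ h w X) z Y = fderiv ℝ (fderiv ℝ h) z Y X := by
    intro X Y
    rw [fderiv_clm_apply (hd2 z) (by fun_prop)]
    simp
  have hsymm : ∀ X Y, fderiv ℝ (fderiv ℝ h) z X Y = fderiv ℝ (fderiv ℝ h) z Y X :=
    fun X Y => (hh.contDiffAt (x := z)).isSymmSndFDerivAt (by simp) X Y
  set D := fderiv ℝ (fderiv ℝ h) z with hDdef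
  have hb : ∀ c : Fin n → ℂ, c = ∑ i, ((c i).re • (Pi.single i 1 : Fin n → ℂ) +
      (c i).im • (Pi.single i Complex.I : Fin n → ℂ)) := by
    intro c
    conv_lhs => rw [← Finset.univ_sum_single c]
    refine Finset.sum_congr rfl fun i _ => ?_
    ext k
    by_cases hk : k = i
    · subst hk
      simp
    · simp [hk]
  have hDc : ∀ c : Fin n → ℂ, D c c = ∑ i, ∑ j,
      ((c i).re * (c j).re * D (Pi.single i 1) (Pi.single j 1) +
        (c i).re * (c j).im * D (Pi.single i 1) (Pi.single j Complex.I) +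
        (c i).im * (c j).re * D (Pi.single i Complex.I) (Pi.single j 1) +
        (c i).im * (c j).im * D (Pi.single i Complex.I) (Pi.single j Complex.I)) := by
    intro c
    conv_lhs => rw [hb c]
    rw [map_sum, Finset.sum_comm]
    refine Finset.sum_congr rfl fun i _ => ?_
    rw [map_sum, sum_apply]
    refine Finset.sum_congr rfl fun j _ => ?_
    simp only [map_add, map_smul, add_apply, smul_apply, smul_eq_mul]
    ring
  rw [hDc b, hDc (Complex.I • b), ← Finset.sum_add_distrib, Finset.mul_sum, Complex.re_sum]
  refine Finset.sum_congr rfl fun i _ => ?_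
  rw [← Finset.sum_add_distrib, Finset.mul_sum, Complex.re_sum]
  refine Finset.sum_congr rfl fun j _ => ?_
  simp only [cplxHessian, Matrix.of_apply, cplxHessianEntry, hD]
  rw [hsymm (Pi.single j Complex.I) (Pi.single i 1), hsymm (Pi.single j 1) (Pi.single i Complex.I),
    hsymm (Pi.single j 1) (Pi.single i 1), hsymm (Pi.single j Complex.I) (Pi.single i Complex.I)]
  simp
  ring

theorem frame_form_eq {n : ℕ} {H : Matrix (Fin n) (Fin n) ℂ} (hH : H.IsHermitian)
    (e : Matrix (Fin n) (Fin n) ℂ) (i : Fin n) :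
    (∑ a, ∑ c, H a c * e i a * star (e i c)).re =
      ∑ j, Complex.normSq ((e * (hH.eigenvectorUnitary : Matrix (Fin n) (Fin n) ℂ)) i j) *
        hH.eigenvalues j := by
  set U := (hH.eigenvectorUnitary : Matrix (Fin n) (Fin n) ℂ)
  have h1 : H = U * Matrix.diagonal (fun j => (hH.eigenvalues j : ℂ)) * U.conjTranspose := by
    have := hH.spectral_theorem
    rw [Unitary.conjStarAlgAut_apply] at this
    exact this
  have h2 : ∑ a, ∑ c, H a c * e i a * star (e i c) = (e * H * e.conjTranspose) i i := by
    simp only [Matrix.mul_apply, Matrix.conjTranspose_apply, Finset.sum_mul]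
    rw [Finset.sum_comm]
    exact Finset.sum_congr rfl fun a _ => Finset.sum_congr rfl fun c _ => by ring
  have h3 : e * H * e.conjTranspose =
      (e * U) * Matrix.diagonal (fun j => (hH.eigenvalues j : ℂ)) * (e * U).conjTranspose := by
    conv_lhs => rw [h1]
    simp only [Matrix.conjTranspose_mul, Matrix.mul_assoc]
  rw [h2, h3, Matrix.mul_apply, Complex.re_sum]
  refine Finset.sum_congr rfl fun j _ => ?_
  rw [Matrix.mul_diagonal, Matrix.conjTranspose_apply]
  simp [Complex.normSq_apply]
  ring

theorem normSq_mem_doublyStochastic {n : ℕ} {W : Matrix (Fin n) (Fin n) ℂ}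
    (hW : W * W.conjTranspose = 1) :
    Matrix.of (fun i j => Complex.normSq (W i j)) ∈ doublyStochastic ℝ (Fin n) := by
  have hW' : W.conjTranspose * W = 1 := mul_eq_one_comm.mp hW
  rw [mem_doublyStochastic_iff_sum]
  refine ⟨fun i j => Complex.normSq_nonneg _, fun i => ?_, fun j => ?_⟩
  · have := congrArg Complex.re (congrFun (congrFun hW i) i)
    rw [Matrix.mul_apply, Complex.re_sum] at this
    simpa [Complex.normSq_apply] using this
  · have := congrArg Complex.re (congrFun (congrFun hW' j) j)
    rw [Matrix.mul_apply, Complex.re_sum] at this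
    simpa [Complex.normSq_apply] using this

theorem sum_mul_doublyStochastic_nonneg {n : ℕ} {f l : Fin n → ℝ}
    (hperm : ∀ π : Equiv.Perm (Fin n), 0 ≤ ∑ i, f i * l (π i))
    {S : Matrix (Fin n) (Fin n) ℝ} (hS : S ∈ doublyStochastic ℝ (Fin n)) :
    0 ≤ ∑ i, f i * ∑ j, S i j * l j := by
  obtain ⟨w, hw, -, rfl⟩ := exists_eq_sum_perm_of_mem_doublyStochastic hS
  have : ∑ i, f i * ∑ j, (∑ σ, w σ • σ.permMatrix ℝ) i j * l j =
      ∑ σ : Equiv.Perm (Fin n), w σ * ∑ i, f i * l (σ i) := by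
    simp only [Matrix.sum_apply, Matrix.smul_apply, Finset.sum_mul, Finset.mul_sum]
    rw [Finset.sum_congr rfl fun i _ => Finset.sum_comm, Finset.sum_comm]
    refine Finset.sum_congr rfl fun σ _ => Finset.sum_congr rfl fun i _ => ?_
    rw [Finset.sum_eq_single (σ i)]
    · simp [PEquiv.toMatrix_apply, Equiv.Perm.permMatrix]
      ring
    · intro j _ hj
      simp [PEquiv.toMatrix_apply, Equiv.Perm.permMatrix, Ne.symm hj]
    · simp
  rw [this]
  exact Finset.sum_nonneg fun σ _ => mul_nonneg (hw σ) (hperm σ)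

theorem frame_laplacian_eq {n : ℕ} (f : Fin n → ℝ) (e : Matrix (Fin n) (Fin n) ℂ)
    {h : (Fin n → ℂ) → ℝ} (hh : ContDiff ℝ 2 h) (hf : ∑ i, f i = 1) (z : Fin n → ℂ)
    (hH : (cplxHessian n h z).IsHermitian) :
    HasFrameLaplacian f e h z (∑ i, f i * ∑ j,
      Complex.normSq ((e * (hH.eigenvectorUnitary : Matrix (Fin n) (Fin n) ℂ)) i j) *
        hH.eigenvalues j) := by
  have h1 := hasFrameLaplacian_of_contDiff f e hh hf z
  convert h1 using 1
  refine Finset.sum_congr rfl fun i _ => ?_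
  rw [← frame_form_eq hH e i, re_cplxHessian_form hh z (e i)]
  ring

/-- At a point where a test function touches a `Γ`-subsolution from above, all the weighted frame
Laplacians of the test function are nonnegative. -/
theorem IsGammaSubsolution.frame_laplacian_nonneg {n : ℕ} {Γ : Set (Fin n → ℝ)}
    {u : (Fin n → ℂ) → ℝ} (hu : IsGammaSubsolution n Γ u)
    (hperm : ∀ π : Equiv.Perm (Fin n), ∀ x ∈ Γ, (x ∘ π) ∈ Γ)
    {f : Fin n → ℝ} (hf : IsDualWeight Γ f) {e : Matrix (Fin n) (Fin n) ℂ}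
    (he : e * e.conjTranspose = 1) {h : (Fin n → ℂ) → ℝ} (hh : ContDiff ℝ 2 h)
    {z : Fin n → ℂ} (hz : IsLocalMax (fun w => u w - h w) z) {l : ℝ}
    (hl : HasFrameLaplacian f e h z l) : 0 ≤ l := by
  have hH := isHermitian_cplxHessian hh z
  have hmem := hu h hh z hz hH
  have hdual : ∀ π : Equiv.Perm (Fin n), ∀ x ∈ closure Γ, 0 ≤ ∑ i, f i * x (π i) := by
    intro π x hx
    have hcl : IsClosed {x : Fin n → ℝ | 0 ≤ ∑ i, f i * x (π i)} :=
      isClosed_le continuous_const (by fun_prop)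
    exact closure_minimal (fun y hy => hf.dual _ (hperm π y hy)) hcl hx
  rw [tendsto_nhds_unique hl (frame_laplacian_eq f e hh hf.sum_eq_one z hH)]
  refine sum_mul_doublyStochastic_nonneg (fun π => hdual π _ hmem)
    (normSq_mem_doublyStochastic (W := e * (hH.eigenvectorUnitary : Matrix (Fin n) (Fin n) ℂ)) ?_)
  have hU : (hH.eigenvectorUnitary : Matrix (Fin n) (Fin n) ℂ) *
      (hH.eigenvectorUnitary : Matrix (Fin n) (Fin n) ℂ).conjTranspose = 1 :=
    Unitary.coe_mul_star_self _
  rw [Matrix.conjTranspose_mul, Matrix.mul_assoc, ← Matrix.mul_assoc _ _ e.conjTranspose, hU,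
    Matrix.one_mul, he]

theorem exists_isDualWeight_of_notMem {n : ℕ} {Γ : Set (Fin n → ℝ)}
    (hopen : IsOpen Γ) (hconv : Convex ℝ Γ)
    (hcone : ∀ x ∈ Γ, ∀ t : ℝ, 0 < t → t • x ∈ Γ)
    (hpos : {x : Fin n → ℝ | ∀ i, 0 < x i} ⊆ Γ) {l : Fin n → ℝ} (hl : l ∉ Γ) :
    ∃ f : Fin n → ℝ, IsDualWeight Γ f ∧ ∑ i, f i * l i ≤ 0 := by
  obtain ⟨φ, hφ⟩ := geometric_hahn_banach_point_open hconv hopen hl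
  have hone : (fun _ => 1 : Fin n → ℝ) ∈ Γ := hpos fun _ => one_pos
  have hφt : ∀ x ∈ Γ, ∀ t : ℝ, 0 < t → φ l < t * φ x := fun x hx t ht => by
    simpa using hφ _ (hcone x hx t ht)
  have hφl : φ l ≤ 0 := by
    have : Tendsto (fun t : ℝ => t * φ (fun _ => 1)) (𝓝[>] 0) (𝓝 0) := by
      have : Tendsto (fun t : ℝ => t * φ (fun _ => 1)) (𝓝 0) (𝓝 (0 * φ (fun _ => 1))) :=
        (continuous_id.mul continuous_const).tendsto 0
      simpa using this.mono_left nhdsWithin_le_nhds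
    refine ge_of_tendsto this ?_
    filter_upwards [self_mem_nhdsWithin] with t ht
    exact (hφt _ hone t ht).le
  have hφΓ : ∀ x ∈ Γ, 0 ≤ φ x := by
    intro x hx
    by_contra! hneg
    have := hφt x hx ((φ l - 1) / φ x) (div_pos_of_neg_of_neg (by linarith) hneg)
    rw [div_mul_cancel₀ _ hneg.ne] at this
    linarith
  have hφsum : ∀ x, φ x = ∑ i, φ (Pi.single i 1) * x i := by
    intro x
    conv_lhs => rw [pi_eq_sum_univ' x]
    rw [map_sum]
    refine Finset.sum_congr rfl fun i _ => ?_
    rw [map_smul, smul_eq_mul, mul_comm]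
  have hnonneg : ∀ i, 0 ≤ φ (Pi.single i 1) := by
    intro i
    have : Tendsto (fun t : ℝ => φ (Pi.single i 1 + t • fun _ => 1)) (𝓝[>] 0)
        (𝓝 (φ (Pi.single i 1))) := by
      have : Tendsto (fun t : ℝ => φ (Pi.single i 1 + t • fun _ => 1)) (𝓝 0)
          (𝓝 (φ (Pi.single i 1 + (0 : ℝ) • fun _ => 1))) :=
        (by fun_prop : Continuous fun t : ℝ => φ (Pi.single i 1 + t • fun _ => 1)).tendsto 0
      simpa using this.mono_left nhdsWithin_le_nhds
    refine ge_of_tendsto this ?_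
    filter_upwards [self_mem_nhdsWithin] with t ht
    refine hφΓ _ (hpos fun j => ?_)
    have h1 : (0 : ℝ) ≤ (Pi.single i 1 : Fin n → ℝ) j := by
      by_cases h : j = i
      · subst h; simp
      · simp [h]
    have h2 : (0 : ℝ) < t := ht
    simp only [Pi.add_apply, Pi.smul_apply, smul_eq_mul, mul_one]
    linarith
  set S := ∑ i, φ (Pi.single i 1) with hS
  have hSone : S = φ (fun _ => 1) := by rw [hφsum]; simp [hS]
  have hSpos : 0 < S := by
    rcases (Finset.sum_nonneg fun i _ => hnonneg i : (0 : ℝ) ≤ S).lt_or_eq with h | h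
    · exact h
    · exfalso
      have hz := (Finset.sum_eq_zero_iff_of_nonneg fun i _ => hnonneg i).mp h.symm
      have h0 : ∀ x, φ x = 0 := fun x => by
        rw [hφsum]
        exact Finset.sum_eq_zero fun i hi => by rw [hz i hi, zero_mul]
      have := hφ _ hone
      rw [h0, h0] at this
      exact lt_irrefl _ this
  have hdiv : ∀ x : Fin n → ℝ, ∑ i, φ (Pi.single i 1) / S * x i = φ x / S := by
    intro x
    rw [hφsum x, Finset.sum_div]
    exact Finset.sum_congr rfl fun i _ => by ring
  refine ⟨fun i => φ (Pi.single i 1) / S, ⟨fun i => div_nonneg (hnonneg i) hSpos.le, ?_, ?_⟩, ?_⟩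
  · rw [← Finset.sum_div, ← hS, div_self hSpos.ne']
  · intro x hx
    rw [hdiv]
    exact div_nonneg (hφΓ x hx) hSpos.le
  · rw [hdiv]
    exact div_nonpos_of_nonpos_of_nonneg hφl hSpos.le

/-- At a point where a test function touches a `Γ`-solution from below, some weighted frame
Laplacian of the test function is nonpositive. -/
theorem IsGammaSolution.exists_frame_laplacian_nonpos {n : ℕ} {Γ : Set (Fin n → ℝ)}
    (hopen : IsOpen Γ) (hconv : Convex ℝ Γ)
    (hcone : ∀ x ∈ Γ, ∀ t : ℝ, 0 < t → t • x ∈ Γ)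
    (hpos : {x : Fin n → ℝ | ∀ i, 0 < x i} ⊆ Γ)
    {u : (Fin n → ℂ) → ℝ} (hu : IsGammaSolution n Γ u)
    {h : (Fin n → ℂ) → ℝ} (hh : ContDiff ℝ 2 h)
    {z : Fin n → ℂ} (hz : IsLocalMin (fun w => u w - h w) z) :
    ∃ f e, IsDualWeight Γ f ∧ e * e.conjTranspose = 1 ∧
      ∀ l, HasFrameLaplacian f e h z l → l ≤ 0 := by
  have hH := isHermitian_cplxHessian hh z
  obtain ⟨f, hf, hle⟩ := exists_isDualWeight_of_notMem hopen hconv hcone hpos (hu.2 h hh z hz hH)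
  have hU : (hH.eigenvectorUnitary : Matrix (Fin n) (Fin n) ℂ).conjTranspose *
      (hH.eigenvectorUnitary : Matrix (Fin n) (Fin n) ℂ) = 1 :=
    Unitary.coe_star_mul_self _
  refine ⟨f, (hH.eigenvectorUnitary : Matrix (Fin n) (Fin n) ℂ).conjTranspose, hf,
    by rw [Matrix.conjTranspose_conjTranspose, hU], fun l hl => ?_⟩
  rw [tendsto_nhds_unique hl (frame_laplacian_eq f _ hh hf.sum_eq_one z hH), hU]
  refine le_of_eq_of_le (Finset.sum_congr rfl fun i _ => ?_) hle
  rw [Finset.sum_eq_single i]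
  · simp
  · intro j _ hj
    simp [Matrix.one_apply_ne (Ne.symm hj)]
  · simp

theorem frameAverage_eq_sum_prod {n : ℕ} (f : Fin n → ℝ) (e : Matrix (Fin n) (Fin n) ℂ) (s : ℝ)
    (g : (Fin n → ℂ) → ℝ) (x : Fin n → ℂ) :
    frameAverage f e s g x =
      ∑ p : Fin n × Fin 4, f p.1 / 4 * g (x + s • (Complex.I ^ (p.2 : ℕ) • e p.1)) := by
  rw [frameAverage, Fintype.sum_prod_type]
  refine Finset.sum_congr rfl fun i _ => ?_
  rw [Fin.sum_univ_four]
  have h3 : Complex.I ^ 3 = -Complex.I := by rw [pow_succ, Complex.I_sq]; ring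
  simp only [Fin.val_zero, Fin.val_one, Fin.val_two, pow_zero, pow_one, one_smul, Complex.I_sq]
  rw [show ((3 : Fin 4) : ℕ) = 3 from rfl, h3]
  simp only [neg_smul, smul_neg, one_smul, ← sub_eq_add_neg]
  ring

theorem frameAverage_comm {n : ℕ} (f : Fin n → ℝ) (e : Matrix (Fin n) (Fin n) ℂ) (s t : ℝ)
    (g : (Fin n → ℂ) → ℝ) (x : Fin n → ℂ) :
    frameAverage f e s (frameAverage f e t g) x = frameAverage f e t (frameAverage f e s g) x := by
  simp only [frameAverage_eq_sum_prod, Finset.mul_sum]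
  rw [Finset.sum_comm]
  refine Finset.sum_congr rfl fun p _ => Finset.sum_congr rfl fun q _ => ?_
  rw [add_right_comm]
  ring

theorem frameAverage_add {n : ℕ} (f : Fin n → ℝ) (e : Matrix (Fin n) (Fin n) ℂ) (s : ℝ)
    (g h : (Fin n → ℂ) → ℝ) (x : Fin n → ℂ) :
    frameAverage f e s (fun y => g y + h y) x =
      frameAverage f e s g x + frameAverage f e s h x := by
  simp only [frameAverage_eq_sum_prod, ← Finset.sum_add_distrib, mul_add]

theorem frameAverage_const_mul {n : ℕ} (f : Fin n → ℝ) (e : Matrix (Fin n) (Fin n) ℂ) (s : ℝ)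
    (c : ℝ) (g : (Fin n → ℂ) → ℝ) (x : Fin n → ℂ) :
    frameAverage f e s (fun y => c * g y) x = c * frameAverage f e s g x := by
  simp only [frameAverage_eq_sum_prod, Finset.mul_sum]
  exact Finset.sum_congr rfl fun p _ => by ring

theorem frameAverage_const {n : ℕ} {f : Fin n → ℝ} (hf : ∑ i, f i = 1)
    (e : Matrix (Fin n) (Fin n) ℂ) (s c : ℝ) (x : Fin n → ℂ) :
    frameAverage f e s (fun _ => c) x = c := by
  have : ∀ i, f i / 4 * (c + c + c + c) = f i * c := fun i => by ring
  rw [frameAverage, Finset.sum_congr rfl fun i _ => this i, ← Finset.sum_mul, hf, one_mul]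

theorem frameAverage_mono {n : ℕ} {f : Fin n → ℝ} (hf : ∀ i, 0 ≤ f i)
    (e : Matrix (Fin n) (Fin n) ℂ) (s : ℝ)
    {g h : (Fin n → ℂ) → ℝ} (hgh : ∀ y, g y ≤ h y) (x : Fin n → ℂ) :
    frameAverage f e s g x ≤ frameAverage f e s h x := by
  simp only [frameAverage_eq_sum_prod]
  exact Finset.sum_le_sum fun p _ =>
    mul_le_mul_of_nonneg_left (hgh _) (div_nonneg (hf _) (by norm_num))

theorem frameAverage_translate {n : ℕ} (f : Fin n → ℝ) (e : Matrix (Fin n) (Fin n) ℂ) (s : ℝ)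
    (g : (Fin n → ℂ) → ℝ) (a x : Fin n → ℂ) :
    frameAverage f e s (fun y => g (y + a)) x = frameAverage f e s g (x + a) := by
  simp only [frameAverage_eq_sum_prod]
  exact Finset.sum_congr rfl fun p _ => by rw [add_right_comm]

theorem abs_frameAverage_le {n : ℕ} {f : Fin n → ℝ} (hf : ∀ i, 0 ≤ f i) (hf1 : ∑ i, f i = 1)
    (e : Matrix (Fin n) (Fin n) ℂ) (s : ℝ) {g : (Fin n → ℂ) → ℝ} {c : ℝ}
    (hg : ∀ y, |g y| ≤ c) (x : Fin n → ℂ) : |frameAverage f e s g x| ≤ c := by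
  rw [abs_le]
  have h1 := frameAverage_mono hf e s (fun y => (abs_le.mp (hg y)).1) x
  have h2 := frameAverage_mono hf e s (fun y => (abs_le.mp (hg y)).2) x
  rw [frameAverage_const hf1] at h1 h2
  exact ⟨h1, h2⟩

theorem contDiff_frameAverage {n : ℕ} (f : Fin n → ℝ) (e : Matrix (Fin n) (Fin n) ℂ) (s : ℝ)
    {g : (Fin n → ℂ) → ℝ} {k : WithTop ℕ∞} (hg : ContDiff ℝ k g) :
    ContDiff ℝ k (frameAverage f e s g) := by
  unfold frameAverage
  fun_prop

/-- A uniform second order expansion of `frameAverage f e s g` in `s`, with coefficient `G` for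
which a first order expansion holds. -/
structure HasUniformExpansion {n : ℕ} (f : Fin n → ℝ) (e : Matrix (Fin n) (Fin n) ℂ)
    (g G : (Fin n → ℂ) → ℝ) (M : ℝ) : Prop where
  second : ∀ x, ∀ s : ℝ, 0 < s → s ≤ 1 → |frameAverage f e s g x - g x - s ^ 2 * G x| ≤ M * s ^ 3
  first : ∀ x, ∀ s : ℝ, 0 < s → s ≤ 1 → |frameAverage f e s G x - G x| ≤ M * s ^ 2

theorem HasUniformExpansion.hasFrameLaplacian {n : ℕ} {f : Fin n → ℝ}
    {e : Matrix (Fin n) (Fin n) ℂ} {g G : (Fin n → ℂ) → ℝ} {M : ℝ}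
    (h : HasUniformExpansion f e g G M) (x : Fin n → ℂ) : HasFrameLaplacian f e g x (G x) := by
  rw [HasFrameLaplacian, tendsto_iff_norm_sub_tendsto_zero]
  have hlim : Tendsto (fun s : ℝ => M * s) (𝓝[>] 0) (𝓝 0) := by
    have : Tendsto (fun s : ℝ => M * s) (𝓝 0) (𝓝 (M * 0)) := (continuous_const_mul M).tendsto 0
    simpa using this.mono_left nhdsWithin_le_nhds
  refine squeeze_zero' (Eventually.of_forall fun _ => norm_nonneg _) ?_ hlim
  filter_upwards [Ioc_mem_nhdsGT (zero_lt_one' ℝ)] with s hs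
  have hs2 : 0 < s ^ 2 := pow_pos hs.1 2
  have h1 := h.second x s hs.1 hs.2
  have h2 : (frameAverage f e s g x - g x) / s ^ 2 - G x =
      (frameAverage f e s g x - g x - s ^ 2 * G x) / s ^ 2 := by
    rw [sub_div _ (s ^ 2 * G x), mul_div_cancel_left₀ _ hs2.ne']
  rw [h2, Real.norm_eq_abs, abs_div, abs_of_pos hs2, div_le_iff₀ hs2]
  linarith [h1, (by ring : M * s ^ 3 = M * s * s ^ 2)]

theorem HasUniformExpansion.frameAverage {n : ℕ} {f : Fin n → ℝ} (hf : ∀ i, 0 ≤ f i)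
    (hf1 : ∑ i, f i = 1) {e : Matrix (Fin n) (Fin n) ℂ} {g G : (Fin n → ℂ) → ℝ} {M : ℝ}
    (h : HasUniformExpansion f e g G M) (t : ℝ) :
    HasUniformExpansion f e (frameAverage f e t g) (frameAverage f e t G) M := by
  refine ⟨fun x s hs hs1 => ?_, fun x s hs hs1 => ?_⟩
  · have := abs_frameAverage_le hf hf1 e t (fun y => h.second y s hs hs1) x
    convert this using 2
    rw [frameAverage_comm]
    have e1 : (fun y => _root_.frameAverage f e s g y - g y - s ^ 2 * G y) =
        fun y => _root_.frameAverage f e s g y + ((-1) * g y + (-(s ^ 2)) * G y) := by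
      funext y; ring
    rw [e1, frameAverage_add f e t (fun y => _root_.frameAverage f e s g y),
      frameAverage_add, frameAverage_const_mul, frameAverage_const_mul]
    ring
  · have := abs_frameAverage_le hf hf1 e t (fun y => h.first y s hs hs1) x
    convert this using 2
    rw [frameAverage_comm]
    have e1 : (fun y => _root_.frameAverage f e s G y - G y) =
        fun y => _root_.frameAverage f e s G y + (-1) * G y := by
      funext y; ring
    rw [e1, frameAverage_add f e t (fun y => _root_.frameAverage f e s G y),
      frameAverage_const_mul]
    ring

/-- The squared Euclidean norm on `ℂⁿ`. -/
noncomputable def sqNorm {n : ℕ} (x : Fin n → ℂ) : ℝ := ∑ i, Complex.normSq (x i)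

theorem sqNorm_eq {n : ℕ} (x : Fin n → ℂ) : sqNorm x = ∑ i, ((x i).re ^ 2 + (x i).im ^ 2) :=
  Finset.sum_congr rfl fun i _ => by rw [Complex.normSq_apply]; ring

theorem contDiff_sqNorm {n : ℕ} {k : WithTop ℕ∞} :
    ContDiff ℝ k (sqNorm : (Fin n → ℂ) → ℝ) := by
  have h : (sqNorm : (Fin n → ℂ) → ℝ) = fun x =>
      ∑ i, (Complex.reCLM (x i) ^ 2 + Complex.imCLM (x i) ^ 2) := funext sqNorm_eq
  rw [h]
  fun_prop

theorem sqNorm_nonneg {n : ℕ} (x : Fin n → ℂ) : 0 ≤ sqNorm x :=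
  Finset.sum_nonneg fun _ _ => Complex.normSq_nonneg _

theorem sq_norm_le_sqNorm {n : ℕ} (x : Fin n → ℂ) : ‖x‖ ^ 2 ≤ sqNorm x := by
  have h : ∀ i, ‖x i‖ ≤ Real.sqrt (sqNorm x) := fun i => by
    apply Real.le_sqrt_of_sq_le
    rw [← Complex.normSq_eq_norm_sq]
    exact Finset.single_le_sum (f := fun j => Complex.normSq (x j))
      (fun j _ => Complex.normSq_nonneg _) (Finset.mem_univ i)
  have h2 := (pi_norm_le_iff_of_nonneg (Real.sqrt_nonneg _)).mpr h
  calc ‖x‖ ^ 2 ≤ Real.sqrt (sqNorm x) ^ 2 := by gcongr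
    _ = sqNorm x := Real.sq_sqrt (sqNorm_nonneg x)

theorem frameAverage_sqNorm {n : ℕ} {f : Fin n → ℝ} (hf1 : ∑ i, f i = 1)
    {e : Matrix (Fin n) (Fin n) ℂ} (he : e * e.conjTranspose = 1) (s : ℝ) (x : Fin n → ℂ) :
    frameAverage f e s sqNorm x = sqNorm x + s ^ 2 := by
  have hei : ∀ i, sqNorm (e i) = 1 := fun i => by
    have := congrArg Complex.re (congrFun (congrFun he i) i)
    rw [Matrix.mul_apply, Complex.re_sum] at this
    simpa [Complex.normSq_apply, sqNorm] using this
  have h4 : ∀ b : Fin n → ℂ, sqNorm (x + s • b) + sqNorm (x - s • b) +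
      sqNorm (x + s • (Complex.I • b)) + sqNorm (x - s • (Complex.I • b)) =
      4 * sqNorm x + 4 * s ^ 2 * sqNorm b := by
    intro b
    simp only [sqNorm_eq, Finset.mul_sum, ← Finset.sum_add_distrib]
    refine Finset.sum_congr rfl fun i _ => ?_
    simp
    ring
  rw [frameAverage]
  simp only [h4, hei]
  have : ∀ i, f i / 4 * (4 * sqNorm x + 4 * s ^ 2 * 1) = f i * (sqNorm x + s ^ 2) :=
    fun i => by ring
  rw [Finset.sum_congr rfl fun i _ => this i, ← Finset.sum_mul, hf1, one_mul]

theorem exists_max_sub_sqNorm {n : ℕ} {F : (Fin n → ℂ) → ℝ} (hF : Continuous F) {B : ℝ}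
    (hB : ∀ x, F x ≤ B) {ε : ℝ} (hε : 0 < ε) (a : Fin n → ℂ) :
    ∃ x₀, ∀ x, F x - ε * sqNorm (x - a) ≤ F x₀ - ε * sqNorm (x₀ - a) := by
  have hq : Continuous fun x : Fin n → ℂ => sqNorm (x - a) :=
    (contDiff_sqNorm (k := 0)).continuous.comp (continuous_id.sub continuous_const)
  have hc : Continuous fun x => F x - ε * sqNorm (x - a) := by fun_prop
  refine hc.exists_forall_ge' a ?_
  have hlarge : ∀ᶠ x : Fin n → ℂ in cocompact _, (B - F a) / ε < ‖x - a‖ ^ 2 := by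
    have h1 : Tendsto (fun x : Fin n → ℂ => ‖x - a‖) (cocompact _) atTop :=
      (tendsto_norm_cocompact_atTop).comp
        (Homeomorph.subRight a).isClosedEmbedding.tendsto_cocompact
    exact ((tendsto_pow_atTop two_ne_zero).comp h1).eventually_gt_atTop _
  filter_upwards [hlarge] with x hx
  have h2 := hx.trans_le (sq_norm_le_sqNorm (x - a))
  rw [div_lt_iff₀ hε] at h2
  have h3 : sqNorm (a - a) = 0 := by simp [sqNorm]
  rw [h3]
  linarith [hB x]

theorem HasUniformExpansion.nonneg {n : ℕ} {f : Fin n → ℝ} {e : Matrix (Fin n) (Fin n) ℂ}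
    {g G : (Fin n → ℂ) → ℝ} {M : ℝ} (h : HasUniformExpansion f e g G M) : 0 ≤ M := by
  simpa using (abs_nonneg _).trans (h.second 0 1 one_pos le_rfl)

theorem HasFrameLaplacian.add {n : ℕ} {f : Fin n → ℝ} {e : Matrix (Fin n) (Fin n) ℂ}
    {g h : (Fin n → ℂ) → ℝ} {z : Fin n → ℂ} {a b : ℝ} (hg : HasFrameLaplacian f e g z a)
    (hh : HasFrameLaplacian f e h z b) : HasFrameLaplacian f e (fun y => g y + h y) z (a + b) := by
  refine (Filter.Tendsto.add hg hh).congr fun s => ?_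
  rw [frameAverage_add]
  ring

theorem HasFrameLaplacian.const_mul {n : ℕ} {f : Fin n → ℝ} {e : Matrix (Fin n) (Fin n) ℂ}
    {g : (Fin n → ℂ) → ℝ} {z : Fin n → ℂ} {a : ℝ} (hg : HasFrameLaplacian f e g z a)
    (c : ℝ) : HasFrameLaplacian f e (fun y => c * g y) z (c * a) := by
  refine (Filter.Tendsto.const_mul c hg).congr fun s => ?_
  rw [frameAverage_const_mul]
  ring

theorem HasFrameLaplacian.translate {n : ℕ} {f : Fin n → ℝ} {e : Matrix (Fin n) (Fin n) ℂ}
    {g : (Fin n → ℂ) → ℝ} {z c : Fin n → ℂ} {a : ℝ} (hg : HasFrameLaplacian f e g (z + c) a) :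
    HasFrameLaplacian f e (fun y => g (y + c)) z a := by
  refine Filter.Tendsto.congr (fun s => ?_) hg
  rw [frameAverage_translate]

theorem hasFrameLaplacian_sqNorm {n : ℕ} {f : Fin n → ℝ} (hf1 : ∑ i, f i = 1)
    {e : Matrix (Fin n) (Fin n) ℂ} (he : e * e.conjTranspose = 1) (z : Fin n → ℂ) :
    HasFrameLaplacian f e sqNorm z 1 := by
  refine tendsto_const_nhds.congr' ?_
  filter_upwards [self_mem_nhdsWithin] with s hs
  have : s ^ 2 ≠ 0 := pow_ne_zero 2 (ne_of_gt hs)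
  rw [frameAverage_sqNorm hf1 he, add_sub_cancel_left, div_self this]

section MaximumPrinciple

variable {n : ℕ} {Γ : Set (Fin n → ℝ)} {u : (Fin n → ℂ) → ℝ}

/-- If a smooth function lies above a bounded subsolution, then so does its frame average, up to
an error of third order. -/
theorem IsGammaSubsolution.le_frameAverage (hu : IsGammaSubsolution n Γ u)
    (hperm : ∀ π : Equiv.Perm (Fin n), ∀ x ∈ Γ, (x ∘ π) ∈ Γ) (huc : Continuous u)
    {C : ℝ} (hC : ∀ x, |u x| ≤ C)
    {f : Fin n → ℝ} (hf : IsDualWeight Γ f) {e : Matrix (Fin n) (Fin n) ℂ}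
    (he : e * e.conjTranspose = 1) {g G : (Fin n → ℂ) → ℝ} (hg : ContDiff ℝ 2 g)
    {B : ℝ} (hB : ∀ x, |g x| ≤ B) {M : ℝ} (hM : HasUniformExpansion f e g G M)
    {s : ℝ} (hs : 0 < s) (hs1 : s ≤ 1) {c : ℝ} (hc : ∀ x, u x ≤ g x + c) (x : Fin n → ℂ) :
    u x ≤ frameAverage f e s g x + (c + 2 * M * s ^ 3) := by
  refine le_of_forall_pos_le_add fun ε hε => ?_
  have hM0 := hM.nonneg
  have hg1 : ContDiff ℝ 2 (frameAverage f e s g) := contDiff_frameAverage f e s hg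
  have hg1B := abs_frameAverage_le hf.nonneg hf.sum_eq_one e s hB
  obtain ⟨x₀, hx₀⟩ := exists_max_sub_sqNorm (F := fun y => u y - frameAverage f e s g y)
    (huc.sub hg1.continuous) (B := C + B)
    (fun y => by linarith [(abs_le.mp (hC y)).2, (abs_le.mp (hg1B y)).1]) hε x
  have hM1 := hM.frameAverage hf.nonneg hf.sum_eq_one s
  have hlap : HasFrameLaplacian f e (fun y => frameAverage f e s g y + ε * sqNorm (y + -x)) x₀
      (frameAverage f e s G x₀ + ε * 1) :=
    (hM1.hasFrameLaplacian x₀).add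
      ((hasFrameLaplacian_sqNorm hf.sum_eq_one he (x₀ + -x)).translate.const_mul ε)
  have hsq : ContDiff ℝ 2 fun y : Fin n → ℂ => sqNorm (y + -x) :=
    contDiff_sqNorm.comp (contDiff_id.add contDiff_const)
  have hpos := hu.frame_laplacian_nonneg hperm hf he
    (hg1.add (contDiff_const.mul hsq)) (z := x₀)
    (Eventually.of_forall fun y => by
      have := hx₀ y
      simp only [sub_eq_add_neg] at this ⊢
      linarith) hlap
  have h1 := (abs_le.mp (hM.first x₀ s hs hs1)).2
  have h2 := (abs_le.mp (hM.second x₀ s hs hs1)).1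
  have h3 := hx₀ x
  have h4 : sqNorm (x - x) = 0 := by simp [sqNorm]
  have h5 := mul_nonneg hε.le (sqNorm_nonneg (x₀ - x))
  have h6 := hc x₀
  rw [h4] at h3
  have hs2 : 0 < s ^ 2 := pow_pos hs 2
  have h7 : s ^ 2 * G x₀ ≥ s ^ 2 * (-ε - M * s ^ 2) :=
    mul_le_mul_of_nonneg_left (by linarith) hs2.le
  have h8 : s ^ 2 ≤ 1 := pow_le_one₀ hs.le hs1
  have h9 : s ^ 2 * ε ≤ ε := by nlinarith
  have h10 : M * s ^ 2 * s ^ 2 ≤ M * s ^ 3 := by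
    have : M * s ^ 3 - M * s ^ 2 * s ^ 2 = M * s ^ 3 * (1 - s) := by ring
    have : 0 ≤ M * s ^ 3 * (1 - s) := by
      have := sub_nonneg.mpr hs1
      positivity
    linarith
  linarith

theorem HasUniformExpansion.iterate {f : Fin n → ℝ} (hf : IsDualWeight Γ f)
    {e : Matrix (Fin n) (Fin n) ℂ} {g G : (Fin n → ℂ) → ℝ} {M : ℝ}
    (h : HasUniformExpansion f e g G M) (s : ℝ) (k : ℕ) :
    HasUniformExpansion f e ((_root_.frameAverage f e s)^[k] g)
      ((_root_.frameAverage f e s)^[k] G) M := by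
  induction k with
  | zero => exact h
  | succ k ih =>
    rw [Function.iterate_succ_apply', Function.iterate_succ_apply']
    exact ih.frameAverage hf.nonneg hf.sum_eq_one s

theorem contDiff_iterate_frameAverage (f : Fin n → ℝ) (e : Matrix (Fin n) (Fin n) ℂ) (s : ℝ)
    {g : (Fin n → ℂ) → ℝ} {m : WithTop ℕ∞} (hg : ContDiff ℝ m g) (k : ℕ) :
    ContDiff ℝ m ((frameAverage f e s)^[k] g) := by
  induction k with
  | zero => exact hg
  | succ k ih =>
    rw [Function.iterate_succ_apply']
    exact contDiff_frameAverage f e s ih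

theorem abs_iterate_frameAverage_le {f : Fin n → ℝ} (hf : IsDualWeight Γ f)
    (e : Matrix (Fin n) (Fin n) ℂ) (s : ℝ) {g : (Fin n → ℂ) → ℝ} {c : ℝ}
    (hg : ∀ y, |g y| ≤ c) (k : ℕ) (x : Fin n → ℂ) : |(frameAverage f e s)^[k] g x| ≤ c := by
  induction k generalizing x with
  | zero => exact hg x
  | succ k ih =>
    rw [Function.iterate_succ_apply']
    exact abs_frameAverage_le hf.nonneg hf.sum_eq_one e s ih x

theorem iterate_frameAverage_le_add {f : Fin n → ℝ} (hf : IsDualWeight Γ f)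
    (e : Matrix (Fin n) (Fin n) ℂ) (s : ℝ) {g h : (Fin n → ℂ) → ℝ} {c : ℝ}
    (hgh : ∀ y, g y ≤ h y + c) (k : ℕ) (x : Fin n → ℂ) :
    (frameAverage f e s)^[k] g x ≤ (frameAverage f e s)^[k] h x + c := by
  induction k generalizing x with
  | zero => exact hgh x
  | succ k ih =>
    rw [Function.iterate_succ_apply', Function.iterate_succ_apply']
    have := frameAverage_mono hf.nonneg e s ih x
    rwa [frameAverage_add f e s _ (fun _ => c), frameAverage_const hf.sum_eq_one] at this

theorem IsGammaSubsolution.le_iterate_frameAverage (hu : IsGammaSubsolution n Γ u)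
    (hperm : ∀ π : Equiv.Perm (Fin n), ∀ x ∈ Γ, (x ∘ π) ∈ Γ) (huc : Continuous u)
    {C : ℝ} (hC : ∀ x, |u x| ≤ C)
    {f : Fin n → ℝ} (hf : IsDualWeight Γ f) {e : Matrix (Fin n) (Fin n) ℂ}
    (he : e * e.conjTranspose = 1) {g G : (Fin n → ℂ) → ℝ} (hg : ContDiff ℝ 2 g)
    {B : ℝ} (hB : ∀ x, |g x| ≤ B) {M : ℝ} (hM : HasUniformExpansion f e g G M)
    {s : ℝ} (hs : 0 < s) (hs1 : s ≤ 1) {c : ℝ} (hc : ∀ x, u x ≤ g x + c) (k : ℕ)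
    (x : Fin n → ℂ) :
    u x ≤ (frameAverage f e s)^[k] g x + (c + k * (2 * M * s ^ 3)) := by
  induction k generalizing x with
  | zero => simpa using hc x
  | succ k ih =>
    rw [Function.iterate_succ_apply']
    have := hu.le_frameAverage hperm huc hC hf he (contDiff_iterate_frameAverage f e s hg k)
      (abs_iterate_frameAverage_le hf e s hB k) (hM.iterate hf s k) hs hs1 ih x
    refine this.trans_eq ?_
    push_cast
    ring

theorem HasUniformExpansion.iterate_le {f : Fin n → ℝ} (hf : IsDualWeight Γ f)
    {e : Matrix (Fin n) (Fin n) ℂ} {v V : (Fin n → ℂ) → ℝ} {M : ℝ}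
    (h : HasUniformExpansion f e v V M) {s : ℝ} (hs : 0 < s) (hs1 : s ≤ 1) (k : ℕ)
    (x : Fin n → ℂ) :
    (_root_.frameAverage f e s)^[k] v x ≤
      v x + k * s ^ 2 * V x + k * (M * s ^ 3) + k ^ 2 * (M * s ^ 4) := by
  have hV : ∀ k : ℕ, (_root_.frameAverage f e s)^[k] V x ≤ V x + k * (M * s ^ 2) := by
    intro k
    induction k with
    | zero => simp
    | succ k ih =>
      rw [Function.iterate_succ_apply']
      have := (abs_le.mp ((h.iterate hf s k).first x s hs hs1)).2
      push_cast
      linarith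
  induction k with
  | zero => simp
  | succ k ih =>
    rw [Function.iterate_succ_apply']
    have h1 := (abs_le.mp ((h.iterate hf s k).second x s hs hs1)).2
    have h2 := mul_le_mul_of_nonneg_left (hV k) (sq_nonneg s)
    have hM0 := h.nonneg
    have h3 : 0 ≤ (k + 1 : ℝ) * (M * s ^ 4) := by positivity
    push_cast
    nlinarith

/-- If a function with a uniform expansion lies below its iterated averages up to small errors,
then its frame Laplacian is nonnegative. -/
theorem HasUniformExpansion.coeff_nonneg {f : Fin n → ℝ} (hf : IsDualWeight Γ f)
    {e : Matrix (Fin n) (Fin n) ℂ} {v V : (Fin n → ℂ) → ℝ} {M : ℝ}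
    (h : HasUniformExpansion f e v V M)
    (hv : ∀ δ : ℝ, 0 < δ → ∃ K : ℝ, ∀ s : ℝ, 0 < s → s ≤ 1 → ∀ (k : ℕ) (x : Fin n → ℂ),
      v x ≤ (_root_.frameAverage f e s)^[k] v x + (δ + k * (K * s ^ 3))) (x : Fin n → ℂ) :
    0 ≤ V x := by
  have key : ∀ t : ℝ, 0 < t → t ≤ 1 → 0 ≤ t + V x + M * t := by
    intro t ht ht1
    obtain ⟨K, hK⟩ := hv (t ^ 2) (pow_pos ht 2)
    have hk : ∀ k : ℕ, 0 < k →
        0 ≤ t ^ 2 + t * V x + M * t ^ 2 + (K + M) * t * Real.sqrt (t / k) := by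
      intro k hk
      have hk' : (1 : ℝ) ≤ k := by exact_mod_cast hk
      have hk0 : (0 : ℝ) < k := by linarith
      have htk : 0 < t / k := div_pos ht hk0
      have htk1 : t / k ≤ 1 := by rw [div_le_one hk0]; linarith
      set s := Real.sqrt (t / k) with hs
      have hs0 : 0 < s := Real.sqrt_pos.mpr htk
      have hs1 : s ≤ 1 := Real.sqrt_le_one.mpr htk1
      have hs2 : s ^ 2 = t / k := Real.sq_sqrt htk.le
      have hks : k * s ^ 2 = t := by rw [hs2]; field_simp
      have h1 := hK s hs0 hs1 k x
      have h2 := h.iterate_le hf hs0 hs1 k x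
      have e1 : k * (K * s ^ 3) = K * t * s := by rw [← hks]; ring
      have e2 : k * (M * s ^ 3) = M * t * s := by rw [← hks]; ring
      have e3 : (k : ℝ) ^ 2 * (M * s ^ 4) = M * t ^ 2 := by rw [← hks]; ring
      rw [e1] at h1
      rw [e2, e3, hks] at h2
      linarith
    have hlim : Tendsto (fun k : ℕ => t ^ 2 + t * V x + M * t ^ 2 +
        (K + M) * t * Real.sqrt (t / k)) atTop
        (𝓝 (t ^ 2 + t * V x + M * t ^ 2 + (K + M) * t * 0)) := by
      refine (Tendsto.const_mul _ ?_).const_add _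
      have := (Real.continuous_sqrt.tendsto 0).comp (tendsto_const_div_atTop_nhds_zero_nat t)
      simpa [Function.comp_def] using this
    have h0 := ge_of_tendsto hlim ((eventually_gt_atTop 0).mono fun k h => hk k h)
    have : t * (t + V x + M * t) = t ^ 2 + t * V x + M * t ^ 2 + (K + M) * t * 0 := by ring
    rw [← this] at h0
    exact nonneg_of_mul_nonneg_right h0 ht
  have hlim : Tendsto (fun t : ℝ => t + V x + M * t) (𝓝[>] 0) (𝓝 (V x)) := by
    have : Tendsto (fun t : ℝ => t + V x + M * t) (𝓝 0) (𝓝 (0 + V x + M * 0)) :=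
      (by fun_prop : Continuous fun t : ℝ => t + V x + M * t).tendsto 0
    simpa using this.mono_left nhdsWithin_le_nhds
  refine ge_of_tendsto hlim ?_
  filter_upwards [Ioc_mem_nhdsGT (zero_lt_one' ℝ)] with t ht
  exact key t ht.1 ht.2

end MaximumPrinciple

open MeasureTheory Convolution
open scoped ContDiff

section Convolution

theorem integrable_mul_comp_sub {E : Type*} [NormedAddCommGroup E] [MeasureSpace E]
    [BorelSpace E] [(volume : Measure E).IsAddHaarMeasure] {u φ : E → ℝ}
    (hφ : HasCompactSupport φ) (hφc : Continuous φ)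
    (hu : Continuous u) (x : E) : Integrable (fun t => φ t * u (x - t)) volume :=
  (hφc.mul (hu.comp (continuous_const.sub continuous_id))).integrable_of_hasCompactSupport
    hφ.mul_right

variable {E : Type*} [NormedAddCommGroup E] [NormedSpace ℝ E]
  [MeasureSpace E]

/-- `w` is the convolution of `u` with a smooth compactly supported function. -/
def IsSmoothAverage (u w : E → ℝ) : Prop :=
  ∃ φ : E → ℝ, HasCompactSupport φ ∧ ContDiff ℝ ∞ φ ∧
    w = φ ⋆[ContinuousLinearMap.lsmul ℝ ℝ, volume] u

variable {u w : E → ℝ}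

theorem IsSmoothAverage.const_mul (hw : IsSmoothAverage u w) (c : ℝ) :
    IsSmoothAverage u (fun x => c * w x) := by
  obtain ⟨φ, hφ, hφs, rfl⟩ := hw
  refine ⟨fun x => c * φ x, hφ.mul_left, contDiff_const.mul hφs, ?_⟩
  funext x
  simp only [convolution_def, ContinuousLinearMap.lsmul_apply, smul_eq_mul, mul_assoc,
    integral_const_mul]

variable [BorelSpace E] [(volume : Measure E).IsAddHaarMeasure]

theorem IsSmoothAverage.contDiff [FiniteDimensional ℝ E] (hw : IsSmoothAverage u w)
    (hu : Continuous u) :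
    ContDiff ℝ ∞ w := by
  obtain ⟨φ, hφ, hφs, rfl⟩ := hw
  exact hφ.contDiff_convolution_left _ hφs hu.locallyIntegrable

theorem IsSmoothAverage.differentiable [FiniteDimensional ℝ E] (hw : IsSmoothAverage u w)
    (hu : Continuous u) :
    Differentiable ℝ w :=
  (hw.contDiff hu).differentiable (by simp)

theorem IsSmoothAverage.exists_lipschitz (hw : IsSmoothAverage u w) (hu : Continuous u) {L : ℝ}
    (hL : ∀ x y, |u x - u y| ≤ L * ‖x - y‖) : ∃ B, 0 ≤ B ∧ ∀ x y, |w x - w y| ≤ B * ‖x - y‖ := by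
  obtain ⟨φ, hφ, hφs, rfl⟩ := hw
  have hφi : Integrable (fun t => |φ t|) volume :=
    (hφs.continuous.integrable_of_hasCompactSupport hφ).abs
  have key : ∀ x y, |(φ ⋆[ContinuousLinearMap.lsmul ℝ ℝ, volume] u) x -
      (φ ⋆[ContinuousLinearMap.lsmul ℝ ℝ, volume] u) y| ≤ (∫ t, |φ t|) * L * ‖x - y‖ := by
    intro x y
    simp only [convolution_def, ContinuousLinearMap.lsmul_apply, smul_eq_mul]
    rw [← integral_sub (integrable_mul_comp_sub hφ hφs.continuous hu x)
      (integrable_mul_comp_sub hφ hφs.continuous hu y), mul_assoc, ← integral_mul_const,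
      ← Real.norm_eq_abs]
    refine norm_integral_le_of_norm_le (hφi.mul_const _) (Eventually.of_forall fun t => ?_)
    rw [Real.norm_eq_abs, ← mul_sub, abs_mul]
    have := hL (x - t) (y - t)
    rw [sub_sub_sub_cancel_right] at this
    exact mul_le_mul_of_nonneg_left this (abs_nonneg _)
  refine ⟨|(∫ t, |φ t|) * L|, abs_nonneg _, fun x y => (key x y).trans ?_⟩
  gcongr
  exact le_abs_self _

theorem IsSmoothAverage.exists_bound (hw : IsSmoothAverage u w) {C : ℝ}
    (hC : ∀ x, |u x| ≤ C) : ∃ B, 0 ≤ B ∧ ∀ x, |w x| ≤ B := by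
  obtain ⟨φ, hφ, hφs, rfl⟩ := hw
  have hφi : Integrable (fun t => |φ t|) volume :=
    (hφs.continuous.integrable_of_hasCompactSupport hφ).abs
  have key : ∀ x, |(φ ⋆[ContinuousLinearMap.lsmul ℝ ℝ, volume] u) x| ≤ (∫ t, |φ t|) * C := by
    intro x
    simp only [convolution_def, ContinuousLinearMap.lsmul_apply, smul_eq_mul]
    rw [← integral_mul_const, ← Real.norm_eq_abs]
    refine norm_integral_le_of_norm_le (hφi.mul_const _) (Eventually.of_forall fun t => ?_)
    rw [Real.norm_eq_abs, abs_mul]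
    exact mul_le_mul_of_nonneg_left (hC _) (abs_nonneg _)
  exact ⟨_, (abs_nonneg _).trans (key 0), key⟩

theorem IsSmoothAverage.lineDeriv [FiniteDimensional ℝ E] (hw : IsSmoothAverage u w)
    (hu : Continuous u) (b : E) :
    IsSmoothAverage u (fun x => fderiv ℝ w x b) := by
  obtain ⟨φ, hφ, hφs, rfl⟩ := hw
  refine ⟨fun x => fderiv ℝ φ x b, hφ.fderiv_apply ℝ b,
    (hφs.fderiv_right (m := ∞) (by simp)).clm_apply contDiff_const, ?_⟩
  funext x
  have h1 := (hφ.hasFDerivAt_convolution_right (ContinuousLinearMap.lsmul ℝ ℝ : ℝ →L[ℝ] ℝ →L[ℝ] ℝ).flip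
    (hu.locallyIntegrable (μ := volume)) (hφs.of_le (by simp)) x)
  rw [convolution_flip] at h1
  rw [h1.fderiv, convolution_precompR_apply _ (hu.locallyIntegrable (μ := volume)) (hφ.fderiv ℝ)
    (hφs.continuous_fderiv (by simp)), convolution_flip]

theorem IsSmoothAverage.exists_lipschitz_fderiv [FiniteDimensional ℝ E] (hw : IsSmoothAverage u w)
    (hu : Continuous u)
    {L : ℝ} (hL : ∀ x y, |u x - u y| ≤ L * ‖x - y‖) :
    ∃ B, 0 ≤ B ∧ ∀ x y, ‖fderiv ℝ w x - fderiv ℝ w y‖ ≤ B * ‖x - y‖ := by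
  have b := Module.finBasis ℝ E
  obtain ⟨c, hc, hcb⟩ := b.exists_opNorm_le (F := ℝ)
  choose B hB0 hB using fun i => (hw.lineDeriv hu (b i)).exists_lipschitz hu hL
  refine ⟨c * ∑ i, B i, mul_nonneg hc.le (Finset.sum_nonneg fun i _ => hB0 i), fun x y => ?_⟩
  rw [mul_assoc]
  refine hcb (mul_nonneg (Finset.sum_nonneg fun i _ => hB0 i) (norm_nonneg _)) fun i => ?_
  rw [sub_apply, Real.norm_eq_abs]
  refine (hB i x y).trans ?_
  gcongr
  exact Finset.single_le_sum (fun i _ => hB0 i) (Finset.mem_univ i)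

theorem IsSmoothAverage.add {w' : E → ℝ} (hw : IsSmoothAverage u w) (hw' : IsSmoothAverage u w')
    (hu : Continuous u) : IsSmoothAverage u (fun x => w x + w' x) := by
  obtain ⟨φ, hφ, hφs, rfl⟩ := hw
  obtain ⟨ψ, hψ, hψs, rfl⟩ := hw'
  refine ⟨φ + ψ, hφ.add hψ, hφs.add hψs, ?_⟩
  funext x
  simp only [convolution_def, ContinuousLinearMap.lsmul_apply, smul_eq_mul, Pi.add_apply, add_mul]
  rw [integral_add (integrable_mul_comp_sub hφ hφs.continuous hu x)
    (integrable_mul_comp_sub hψ hψs.continuous hu x)]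

theorem IsSmoothAverage.sum {ι : Type*} {w : ι → E → ℝ} (S : Finset ι)
    (hw : ∀ i, IsSmoothAverage u (w i)) (hu : Continuous u) :
    IsSmoothAverage u (fun x => ∑ i ∈ S, w i x) := by
  classical
  induction S using Finset.induction_on with
  | empty =>
    refine ⟨fun _ => 0, HasCompactSupport.zero, contDiff_const, ?_⟩
    funext x
    simp [convolution_def]
  | insert i S hi ih =>
    simp only [Finset.sum_insert hi]
    exact (hw i).add ih hu

end Convolution

theorem abs_le_mul_of_abs_deriv_le {q q' : ℝ → ℝ} (hq : ∀ t, HasDerivAt q (q' t) t)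
    (hq0 : q 0 = 0) {s K : ℝ} (hs : 0 ≤ s) (hK : ∀ t, 0 ≤ t → t ≤ s → |q' t| ≤ K) :
    |q s| ≤ K * s := by
  have := (convex_Icc 0 s).norm_image_sub_le_of_norm_hasDerivWithin_le
    (fun t _ => (hq t).hasDerivWithinAt) (fun t ht => hK t ht.1 ht.2)
    (Set.left_mem_Icc.mpr hs) (Set.right_mem_Icc.mpr hs)
  simpa [hq0, abs_of_nonneg hs] using this

theorem hasDerivAt_comp_neg {q q' : ℝ → ℝ} (hq : ∀ t, HasDerivAt q (q' t) t) (t : ℝ) :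
    HasDerivAt (fun t => q (-t)) (-q' (-t)) t := by
  simpa [Function.comp_def] using (hq (-t)).comp t (hasDerivAt_neg t)

theorem abs_second_difference_le {p p₁ p₂ : ℝ → ℝ} (h1 : ∀ t, HasDerivAt p (p₁ t) t)
    (h2 : ∀ t, HasDerivAt p₁ (p₂ t) t) {B : ℝ} (hB : ∀ t, |p₂ t| ≤ B) {s : ℝ} (hs : 0 ≤ s) :
    |p s + p (-s) - 2 * p 0| ≤ 2 * B * s ^ 2 := by
  have hB0 : 0 ≤ B := (abs_nonneg _).trans (hB 0)
  have hA : ∀ t, 0 ≤ t → |p₁ t - p₁ (-t)| ≤ 2 * B * t := fun t ht =>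
    abs_le_mul_of_abs_deriv_le (q := fun t => p₁ t - p₁ (-t)) (q' := fun t => p₂ t - -p₂ (-t))
      (fun t => (h2 t).sub (hasDerivAt_comp_neg h2 t)) (by simp) ht
      fun r _ _ => by
        rw [sub_neg_eq_add, two_mul]
        exact (abs_add_le _ _).trans (add_le_add (hB _) (hB _))
  have := abs_le_mul_of_abs_deriv_le (q := fun t => p t + p (-t) - 2 * p 0)
    (q' := fun t => p₁ t + -p₁ (-t)) (fun t => ((h1 t).add (hasDerivAt_comp_neg h1 t)).sub_const _)
    (by simp; ring) hs (K := 2 * B * s) fun t ht hts => by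
      rw [← sub_eq_add_neg]
      refine (hA t ht).trans ?_
      gcongr
  linarith [this, (by ring : 2 * B * s * s = 2 * B * s ^ 2)]

theorem abs_second_difference_sub_le {p p₁ p₂ p₃ : ℝ → ℝ} (h1 : ∀ t, HasDerivAt p (p₁ t) t)
    (h2 : ∀ t, HasDerivAt p₁ (p₂ t) t) (h3 : ∀ t, HasDerivAt p₂ (p₃ t) t) {B : ℝ}
    (hB : ∀ t, |p₃ t| ≤ B) {s : ℝ} (hs : 0 ≤ s) :
    |p s + p (-s) - 2 * p 0 - s ^ 2 * p₂ 0| ≤ 2 * B * s ^ 3 := by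
  have hB0 : 0 ≤ B := (abs_nonneg _).trans (hB 0)
  have hA : ∀ t, 0 ≤ t → |p₁ t - p₁ (-t) - 2 * t * p₂ 0| ≤ (2 * B * t) * t := fun t ht =>
    abs_le_mul_of_abs_deriv_le (q := fun t => p₁ t - p₁ (-t) - 2 * t * p₂ 0)
      (q' := fun t => p₂ t - -p₂ (-t) - 2 * 1 * p₂ 0)
      (fun t => ((h2 t).sub (hasDerivAt_comp_neg h2 t)).sub
        (((hasDerivAt_id t).const_mul 2).mul_const (p₂ 0))) (by simp) ht
      fun r hr hrt => by
        have ha : |p₂ r + p₂ (-r) - 2 * p₂ 0| ≤ 2 * B * r :=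
          abs_le_mul_of_abs_deriv_le (q := fun t => p₂ t + p₂ (-t) - 2 * p₂ 0)
            (q' := fun t => p₃ t + -p₃ (-t))
            (fun t => ((h3 t).add (hasDerivAt_comp_neg h3 t)).sub_const _) (by simp; ring) hr
            fun t _ _ => by
              rw [two_mul]
              refine (abs_add_le _ _).trans (add_le_add (hB _) ?_)
              rw [abs_neg]
              exact hB _
        rw [sub_neg_eq_add, mul_one]
        refine ha.trans ?_
        gcongr
  have := abs_le_mul_of_abs_deriv_le (q := fun t => p t + p (-t) - 2 * p 0 - t ^ 2 * p₂ 0)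
    (q' := fun t => p₁ t + -p₁ (-t) - 2 * t * p₂ 0)
    (fun t => (((h1 t).add (hasDerivAt_comp_neg h1 t)).sub_const _).sub
      (by simpa using (hasDerivAt_pow 2 t).mul_const (p₂ 0)))
    (by simp; ring) hs (K := (2 * B * s) * s) fun t ht hts => by
      rw [← sub_eq_add_neg]
      refine (hA t ht).trans ?_
      gcongr
  linarith [this, (by ring : 2 * B * s * s * s = 2 * B * s ^ 3)]

section Expansion

variable {n : ℕ} {u w : (Fin n → ℂ) → ℝ}

theorem IsSmoothAverage.exists_second_difference_le (hw : IsSmoothAverage u w) (hu : Continuous u)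
    {C : ℝ} (hC : ∀ x, |u x| ≤ C) (b : Fin n → ℂ) : ∃ M, 0 ≤ M ∧ ∀ x, ∀ s : ℝ, 0 ≤ s →
      |w (x + s • b) + w (x - s • b) - 2 * w x| ≤ M * s ^ 2 := by
  have hw1 := hw.lineDeriv hu b
  obtain ⟨B, hB0, hB⟩ := (hw1.lineDeriv hu b).exists_bound hC
  refine ⟨2 * B, by positivity, fun x s hs => ?_⟩
  have := abs_second_difference_le (hasDerivAt_comp_line (hw.differentiable hu) x b)
    (hasDerivAt_comp_line (hw1.differentiable hu) x b) (fun t => hB _) hs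
  simpa [sub_eq_add_neg] using this

theorem IsSmoothAverage.exists_second_difference_sub_le (hw : IsSmoothAverage u w)
    (hu : Continuous u) {C : ℝ} (hC : ∀ x, |u x| ≤ C) (b : Fin n → ℂ) :
    ∃ M, 0 ≤ M ∧ ∃ W, IsSmoothAverage u W ∧ ∀ x, ∀ s : ℝ, 0 ≤ s →
      |w (x + s • b) + w (x - s • b) - 2 * w x - s ^ 2 * W x| ≤ M * s ^ 3 := by
  have hw1 := hw.lineDeriv hu b
  have hw2 := hw1.lineDeriv hu b
  obtain ⟨B, hB0, hB⟩ := (hw2.lineDeriv hu b).exists_bound hC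
  refine ⟨2 * B, by positivity, _, hw2, fun x s hs => ?_⟩
  have := abs_second_difference_sub_le (hasDerivAt_comp_line (hw.differentiable hu) x b)
    (hasDerivAt_comp_line (hw1.differentiable hu) x b)
    (hasDerivAt_comp_line (hw2.differentiable hu) x b) (fun t => hB _) hs
  simpa [sub_eq_add_neg] using this

theorem frameAverage_sub_self {f : Fin n → ℝ} (hf1 : ∑ i, f i = 1)
    (e : Matrix (Fin n) (Fin n) ℂ) (s : ℝ) (g : (Fin n → ℂ) → ℝ) (x : Fin n → ℂ) :
    frameAverage f e s g x - g x = ∑ i, f i / 4 * ((g (x + s • e i) + g (x - s • e i) - 2 * g x) +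
      (g (x + s • (Complex.I • e i)) + g (x - s • (Complex.I • e i)) - 2 * g x)) := by
  have : g x = ∑ i, f i * g x := by rw [← Finset.sum_mul, hf1, one_mul]
  rw [frameAverage]
  conv_lhs => rw [this, ← Finset.sum_sub_distrib]
  exact Finset.sum_congr rfl fun i _ => by ring

theorem IsSmoothAverage.exists_hasUniformExpansion (hw : IsSmoothAverage u w)
    (hu : Continuous u) {C : ℝ} (hC : ∀ x, |u x| ≤ C) {f : Fin n → ℝ} (hf : ∀ i, 0 ≤ f i)
    (hf1 : ∑ i, f i = 1) (e : Matrix (Fin n) (Fin n) ℂ) :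
    ∃ W M, HasUniformExpansion f e w W M := by
  choose M hM0 W hW hWM using fun b => hw.exists_second_difference_sub_le hu hC b
  set V : (Fin n → ℂ) → ℝ := fun x => ∑ i, f i / 4 * (W (e i) x + W (Complex.I • e i) x) with hV
  have hVs : IsSmoothAverage u V :=
    IsSmoothAverage.sum _ (fun i => ((hW _).add (hW _) hu).const_mul _) hu
  choose N hN0 hN using fun b => hVs.exists_second_difference_le hu hC b
  have key : ∀ {K : (Fin n → ℂ) → ℝ} {D : (Fin n → ℂ) → ℝ} {r : ℝ}, (∀ b, |D b| ≤ K b * r) →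
      |∑ i, f i / 4 * (D (e i) + D (Complex.I • e i))| ≤
        (∑ i, f i / 4 * (K (e i) + K (Complex.I • e i))) * r := fun {K D r} h => by
    rw [Finset.sum_mul]
    refine (Finset.abs_sum_le_sum_abs _ _).trans (Finset.sum_le_sum fun i _ => ?_)
    have h4 : 0 ≤ f i / 4 := div_nonneg (hf i) (by norm_num)
    rw [abs_mul, abs_of_nonneg h4, mul_assoc, add_mul]
    exact mul_le_mul_of_nonneg_left ((abs_add_le _ _).trans (add_le_add (h _) (h _))) h4
  have hnn : ∀ {K : (Fin n → ℂ) → ℝ}, (∀ b, 0 ≤ K b) →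
      0 ≤ ∑ i, f i / 4 * (K (e i) + K (Complex.I • e i)) := fun h =>
    Finset.sum_nonneg fun i _ => mul_nonneg (div_nonneg (hf i) (by norm_num)) (add_nonneg (h _) (h _))
  refine ⟨V, (∑ i, f i / 4 * (M (e i) + M (Complex.I • e i))) +
    ∑ i, f i / 4 * (N (e i) + N (Complex.I • e i)), fun x s hs _ => ?_, fun x s hs _ => ?_⟩
  · have h1 := key (K := M) (fun b => hWM b x s hs.le)
    refine (le_of_eq ?_).trans (h1.trans ?_)
    · rw [frameAverage_sub_self hf1, hV]
      simp only [Finset.mul_sum]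
      rw [← Finset.sum_sub_distrib]
      congr 1
      exact Finset.sum_congr rfl fun i _ => by ring
    · have := hnn hN0
      gcongr
      linarith
  · have h1 := key (K := N) (fun b => hN b x s hs.le)
    rw [frameAverage_sub_self hf1]
    refine h1.trans ?_
    have := hnn hM0
    gcongr
    linarith

end Expansion

section Mollification

variable {n : ℕ} {Γ : Set (Fin n → ℝ)} {u : (Fin n → ℂ) → ℝ}

theorem continuous_frameAverage (f : Fin n → ℝ) (e : Matrix (Fin n) (Fin n) ℂ) (s : ℝ)
    (hu : Continuous u) : Continuous (frameAverage f e s u) := by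
  unfold frameAverage
  fun_prop

theorem continuous_iterate_frameAverage (f : Fin n → ℝ) (e : Matrix (Fin n) (Fin n) ℂ) (s : ℝ)
    (hu : Continuous u) (k : ℕ) : Continuous ((frameAverage f e s)^[k] u) := by
  induction k with
  | zero => exact hu
  | succ k ih =>
    rw [Function.iterate_succ_apply']
    exact continuous_frameAverage f e s ih

theorem frameAverage_convolution {φ : (Fin n → ℂ) → ℝ} (hφ : HasCompactSupport φ)
    (hφc : Continuous φ) (hu : Continuous u) (f : Fin n → ℝ) (e : Matrix (Fin n) (Fin n) ℂ)
    (s : ℝ) : frameAverage f e s (φ ⋆[ContinuousLinearMap.lsmul ℝ ℝ, volume] u) =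
      φ ⋆[ContinuousLinearMap.lsmul ℝ ℝ, volume] (frameAverage f e s u) := by
  funext x
  simp only [frameAverage_eq_sum_prod, convolution_def, ContinuousLinearMap.lsmul_apply,
    smul_eq_mul, Finset.mul_sum]
  rw [integral_finsetSum]
  · refine Finset.sum_congr rfl fun p _ => ?_
    rw [← integral_const_mul]
    congr 1
    funext t
    rw [sub_add_eq_add_sub]
    ring
  · intro p _
    have := (integrable_mul_comp_sub hφ hφc hu
      (x + s • (Complex.I ^ (p.2 : ℕ) • e p.1))).const_mul (f p.1 / 4)
    refine this.congr (Eventually.of_forall fun t => ?_)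
    dsimp only
    rw [sub_add_eq_add_sub]
    ring

theorem iterate_frameAverage_convolution {φ : (Fin n → ℂ) → ℝ} (hφ : HasCompactSupport φ)
    (hφc : Continuous φ) (hu : Continuous u) (f : Fin n → ℝ) (e : Matrix (Fin n) (Fin n) ℂ)
    (s : ℝ) (k : ℕ) :
    (frameAverage f e s)^[k] (φ ⋆[ContinuousLinearMap.lsmul ℝ ℝ, volume] u) =
      φ ⋆[ContinuousLinearMap.lsmul ℝ ℝ, volume] ((frameAverage f e s)^[k] u) := by
  induction k with
  | zero => rfl
  | succ k ih =>
    rw [Function.iterate_succ_apply', ih, Function.iterate_succ_apply',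
      frameAverage_convolution hφ hφc (continuous_iterate_frameAverage f e s hu k)]

theorem convolution_le_add {φ : (Fin n → ℂ) → ℝ} (hφ : HasCompactSupport φ)
    (hφc : Continuous φ) (hφ0 : ∀ x, 0 ≤ φ x) (hφ1 : ∫ x, φ x = 1) {g h : (Fin n → ℂ) → ℝ}
    (hg : Continuous g) (hh : Continuous h) {c : ℝ} (hgh : ∀ x, g x ≤ h x + c) (x : Fin n → ℂ) :
    (φ ⋆[ContinuousLinearMap.lsmul ℝ ℝ, volume] g) x ≤
      (φ ⋆[ContinuousLinearMap.lsmul ℝ ℝ, volume] h) x + c := by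
  simp only [convolution_def, ContinuousLinearMap.lsmul_apply, smul_eq_mul]
  have hφi := hφc.integrable_of_hasCompactSupport (μ := volume) hφ
  have hc : c = ∫ t, φ t * c := by rw [integral_mul_const, hφ1, one_mul]
  rw [hc, ← integral_add (integrable_mul_comp_sub hφ hφc hh x) (hφi.mul_const c)]
  refine integral_mono (integrable_mul_comp_sub hφ hφc hg x)
    ((integrable_mul_comp_sub hφ hφc hh x).add (hφi.mul_const c)) fun t => ?_
  dsimp only
  rw [← mul_add]
  exact mul_le_mul_of_nonneg_left (hgh _) (hφ0 t)

theorem exists_smoothAverage_close (hu : Continuous u) {L : ℝ}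
    (hL : ∀ x y, |u x - u y| ≤ L * ‖x - y‖) {δ : ℝ} (hδ : 0 < δ) :
    ∃ v, IsSmoothAverage u v ∧ (∀ x, |v x - u x| ≤ δ) ∧
      ∀ (f : Fin n → ℝ) (e : Matrix (Fin n) (Fin n) ℂ) (s : ℝ) (k : ℕ) (c : ℝ),
        (∀ x, u x ≤ (frameAverage f e s)^[k] u x + c) →
          ∀ x, v x ≤ (frameAverage f e s)^[k] v x + c := by
  have hr : 0 < δ / (|L| + 1) := by positivity
  let φ : ContDiffBump (0 : Fin n → ℂ) :=
    ⟨δ / (|L| + 1) / 2, δ / (|L| + 1), by positivity, by linarith⟩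
  have hφs : HasCompactSupport (φ.normed volume) := φ.hasCompactSupport_normed
  have hφc : ContDiff ℝ ∞ (φ.normed volume) := φ.contDiff_normed
  refine ⟨_, ⟨φ.normed volume, hφs, hφc, rfl⟩, fun x => ?_, fun f e s k c h x => ?_⟩
  · have := φ.dist_normed_convolution_le (μ := volume) (g := u) (x₀ := x) (ε := δ)
      hu.aestronglyMeasurable fun y hy => by
        rw [Real.dist_eq]
        rw [mem_ball_iff_norm] at hy
        have hy' : ‖y - x‖ ≤ δ / (|L| + 1) := hy.le
        calc |u y - u x| ≤ L * ‖y - x‖ := hL y x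
          _ ≤ (|L| + 1) * (δ / (|L| + 1)) := by
            have := le_abs_self L
            gcongr
            linarith
          _ = δ := by field_simp
    rwa [Real.dist_eq] at this
  · rw [iterate_frameAverage_convolution hφs hφc.continuous hu]
    exact convolution_le_add hφs hφc.continuous φ.nonneg_normed φ.integral_normed hu
      (continuous_iterate_frameAverage f e s hu k) h x

theorem IsGammaSubsolution.le_iterate_self (hu : IsGammaSubsolution n Γ u)
    (hperm : ∀ π : Equiv.Perm (Fin n), ∀ x ∈ Γ, (x ∘ π) ∈ Γ) (huc : Continuous u)
    {C : ℝ} (hC : ∀ x, |u x| ≤ C) {L : ℝ} (hL : ∀ x y, |u x - u y| ≤ L * ‖x - y‖)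
    {f : Fin n → ℝ} (hf : IsDualWeight Γ f) {e : Matrix (Fin n) (Fin n) ℂ}
    (he : e * e.conjTranspose = 1) {δ : ℝ} (hδ : 0 < δ) :
    ∃ K : ℝ, ∀ s : ℝ, 0 < s → s ≤ 1 → ∀ (k : ℕ) (x : Fin n → ℂ),
      u x ≤ (frameAverage f e s)^[k] u x + (δ + k * (K * s ^ 3)) := by
  obtain ⟨g, hg, hgu, -⟩ := exists_smoothAverage_close huc hL (half_pos hδ)
  obtain ⟨B, -, hB⟩ := hg.exists_bound hC
  obtain ⟨G, M, hM⟩ := hg.exists_hasUniformExpansion huc hC hf.nonneg hf.sum_eq_one e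
  refine ⟨2 * M, fun s hs hs1 k x => ?_⟩
  have h1 := hu.le_iterate_frameAverage hperm huc hC hf he (contDiff_infty.mp (hg.contDiff huc) 2)
    hB hM hs hs1 (c := δ / 2) (fun x => by linarith [(abs_le.mp (hgu x)).1]) k x
  have h2 := iterate_frameAverage_le_add hf e s (g := g) (h := u) (c := δ / 2)
    (fun y => by linarith [(abs_le.mp (hgu y)).2]) k x
  linarith

/-- A bounded Lipschitz subsolution is uniformly approximated by smooth functions all of whose
frame Laplacians are nonnegative. -/
theorem IsGammaSubsolution.exists_smooth_approx (hu : IsGammaSubsolution n Γ u)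
    (hperm : ∀ π : Equiv.Perm (Fin n), ∀ x ∈ Γ, (x ∘ π) ∈ Γ) (huc : Continuous u)
    {C : ℝ} (hC : ∀ x, |u x| ≤ C) {L : ℝ} (hL : ∀ x y, |u x - u y| ≤ L * ‖x - y‖)
    {δ : ℝ} (hδ : 0 < δ) :
    ∃ v, IsSmoothAverage u v ∧ (∀ x, |v x - u x| ≤ δ) ∧
      ∀ f, IsDualWeight Γ f → ∀ e : Matrix (Fin n) (Fin n) ℂ, e * e.conjTranspose = 1 →
        ∃ V M, HasUniformExpansion f e v V M ∧ ∀ x, 0 ≤ V x := by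
  obtain ⟨v, hv, hvu, hvA⟩ := exists_smoothAverage_close huc hL hδ
  refine ⟨v, hv, hvu, fun f hf e he => ?_⟩
  obtain ⟨V, M, hM⟩ := hv.exists_hasUniformExpansion huc hC hf.nonneg hf.sum_eq_one e
  refine ⟨V, M, hM, hM.coeff_nonneg hf fun δ' hδ' => ?_⟩
  obtain ⟨K, hK⟩ := hu.le_iterate_self hperm huc hC hL hf he hδ'
  exact ⟨K, fun s hs hs1 k x => hvA f e s k _ (hK s hs hs1 k) x⟩

end Mollification

section Touching

variable {n : ℕ} {Γ : Set (Fin n → ℝ)} {u : (Fin n → ℂ) → ℝ} {f : Fin n → ℝ}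
  {e : Matrix (Fin n) (Fin n) ℂ}

theorem hasFrameLaplacian_const (hf1 : ∑ i, f i = 1) (c : ℝ) (z : Fin n → ℂ) :
    HasFrameLaplacian f e (fun _ => c) z 0 := by
  simp [HasFrameLaplacian, frameAverage_const hf1]

theorem HasFrameLaplacian.sum {ι : Type*} (S : Finset ι) (hf1 : ∑ i, f i = 1)
    {g : ι → (Fin n → ℂ) → ℝ} {z : Fin n → ℂ} {l : ι → ℝ}
    (h : ∀ i, HasFrameLaplacian f e (g i) z (l i)) :
    HasFrameLaplacian f e (fun y => ∑ i ∈ S, g i y) z (∑ i ∈ S, l i) := by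
  classical
  induction S using Finset.induction_on with
  | empty => simpa using hasFrameLaplacian_const hf1 0 z
  | insert i S hi ih =>
    simp only [Finset.sum_insert hi]
    exact (h i).add ih

theorem tendsto_sq_difference_quotient {E : Type*} [NormedAddCommGroup E] [NormedSpace ℝ E]
    {g : E → ℝ} (hg : Differentiable ℝ g) (z b : E) :
    Tendsto (fun s : ℝ => (g (z + s • b) - g z) ^ 2 / s ^ 2) (𝓝[>] 0)
      (𝓝 ((fderiv ℝ g z b) ^ 2)) := by
  have h := (hasDerivAt_comp_line hg z b 0).tendsto_slope_zero_right
  simp only [zero_smul, add_zero, zero_add] at h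
  refine (h.pow 2).congr fun s => ?_
  rw [smul_eq_mul, mul_pow, inv_pow, div_eq_inv_mul]

theorem HasFrameLaplacian.sq (hf1 : ∑ i, f i = 1) {g : (Fin n → ℂ) → ℝ}
    (hg : Differentiable ℝ g) {z : Fin n → ℂ} {l : ℝ} (h : HasFrameLaplacian f e g z l) :
    HasFrameLaplacian f e (fun y => g y ^ 2) z (2 * g z * l +
      ∑ i, f i / 2 * (fderiv ℝ g z (e i) ^ 2 + fderiv ℝ g z (Complex.I • e i) ^ 2)) := by
  have hq : ∀ b : Fin n → ℂ, Tendsto (fun s : ℝ => ((g (z + s • b) - g z) ^ 2 +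
      (g (z - s • b) - g z) ^ 2) / s ^ 2) (𝓝[>] 0) (𝓝 (2 * fderiv ℝ g z b ^ 2)) := fun b => by
    have h2 := (tendsto_sq_difference_quotient hg z b).add
      (tendsto_sq_difference_quotient hg z (-b))
    rw [map_neg, neg_sq, ← two_mul] at h2
    refine h2.congr fun s => ?_
    rw [smul_neg, ← sub_eq_add_neg, add_div]
  have h1 := tendsto_finsetSum (Finset.univ : Finset (Fin n)) (fun i _ =>
    ((hq (e i)).add (hq (Complex.I • e i))).const_mul (f i / 4))
  have h3 := (Tendsto.const_mul (2 * g z) h).add h1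
  refine (h3.congr fun s => ?_).trans (le_of_eq ?_)
  · rw [frameAverage_sub_self hf1, frameAverage_sub_self hf1, Finset.sum_div, Finset.sum_div,
      Finset.mul_sum, ← Finset.sum_add_distrib]
    refine Finset.sum_congr rfl fun i _ => ?_
    ring
  · congr 2
    refine Finset.sum_congr rfl fun i _ => ?_
    ring

/-- At suitable points, the gradient of a smooth approximation of a solution `u` which is not
constant is almost degenerate at finitely many prescribed translates simultaneously. -/
theorem IsGammaSolution.exists_almost_degenerate (hu : IsGammaSolution n Γ u)
    (hopen : IsOpen Γ) (hconv : Convex ℝ Γ)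
    (hcone : ∀ x ∈ Γ, ∀ t : ℝ, 0 < t → t • x ∈ Γ)
    (hpos : {x : Fin n → ℝ | ∀ i, 0 < x i} ⊆ Γ)
    (huc : Continuous u) {C : ℝ} (hC : ∀ x, |u x| ≤ C)
    {v : (Fin n → ℂ) → ℝ} (hv : ContDiff ℝ 2 v) {B : ℝ} (hB : ∀ x, |v x| ≤ B)
    (hV : ∀ f, IsDualWeight Γ f → ∀ e : Matrix (Fin n) (Fin n) ℂ, e * e.conjTranspose = 1 →
        ∃ V M, HasUniformExpansion f e v V M ∧ ∀ x, 0 ≤ V x)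
    {m : ℝ} (hm : 0 < m) (hvu : ∀ x, |v x - u x| ≤ m / 8) {a y : Fin n → ℂ}
    (ha : m ≤ u (y + a) - u y) (Q : Finset (Fin n → ℂ)) {ε : ℝ} (hε : 0 < ε) :
    ∃ (f : Fin n → ℝ) (e : Matrix (Fin n) (Fin n) ℂ) (x : Fin n → ℂ),
      IsDualWeight Γ f ∧ e * e.conjTranspose = 1 ∧ m / 2 ≤ v (x + a) - v x ∧
      ∀ q ∈ Q, ∀ i, f i * fderiv ℝ v (x + q) (e i) ^ 2 ≤ ε ∧
        f i * fderiv ℝ v (x + q) (Complex.I • e i) ^ 2 ≤ ε := by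
  have hB0 : 0 ≤ B := (abs_nonneg _).trans (hB 0)
  set η : ℝ := m / (8 * (Q.card + 1) * (4 * B ^ 2 + 1)) with hη
  have hη0 : 0 < η := by positivity
  set g : (Fin n → ℂ) → ℝ := fun x => v x + B with hg
  have hg0 : ∀ x, 0 ≤ g x := fun x => by simp only [hg]; linarith [(abs_le.mp (hB x)).1]
  have hg2 : ∀ x, g x ^ 2 ≤ 4 * B ^ 2 := fun x => by
    have : g x ≤ 2 * B := by simp only [hg]; linarith [(abs_le.mp (hB x)).2]
    nlinarith [hg0 x]
  have hgc : ContDiff ℝ 2 g := hv.add contDiff_const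
  set P : (Fin n → ℂ) → ℝ := fun x => η * ∑ q ∈ Q, g (x + q) ^ 2 with hP
  have hPc : ContDiff ℝ 2 P := contDiff_const.mul (ContDiff.sum fun q _ =>
    (hgc.comp (contDiff_id.add contDiff_const)).pow 2)
  have hP0 : ∀ x, 0 ≤ P x := fun x =>
    mul_nonneg hη0.le (Finset.sum_nonneg fun q _ => sq_nonneg _)
  have hP1 : ∀ x, P x ≤ m / 8 := fun x => by
    calc P x ≤ η * ∑ q ∈ Q, 4 * B ^ 2 := by
          simp only [hP]
          gcongr
          exact hg2 _
      _ = η * (Q.card * (4 * B ^ 2)) := by rw [Finset.sum_const, nsmul_eq_mul]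
      _ ≤ η * ((Q.card + 1) * (4 * B ^ 2 + 1)) := by gcongr <;> linarith
      _ = m / 8 := by rw [hη]; field_simp
  have hva : ContDiff ℝ 2 fun x => v (x + a) := hv.comp (contDiff_id.add contDiff_const)
  set κ : ℝ := η * ε / 2 with hκ
  have hκ0 : 0 < κ := by positivity
  obtain ⟨x, hx⟩ := exists_max_sub_sqNorm (F := fun x => v (x + a) + P x - u x)
    ((hva.add hPc).continuous.sub huc) (B := B + m / 8 + C)
    (fun x => by linarith [(abs_le.mp (hB (x + a))).2, hP1 x, (abs_le.mp (hC x)).1]) hκ0 y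
  have hsq : ContDiff ℝ 2 fun x : Fin n → ℂ => sqNorm (x + -y) :=
    contDiff_sqNorm.comp (contDiff_id.add contDiff_const)
  obtain ⟨f, e, hf, he, hl⟩ := hu.exists_frame_laplacian_nonpos hopen hconv hcone hpos
    ((hva.add hPc).add (contDiff_const (c := -κ).mul hsq)) (z := x)
    (Eventually.of_forall fun w => by
      have := hx w
      simp only [← sub_eq_add_neg]
      linarith)
  obtain ⟨V, M, hM, hV0⟩ := hV f hf e he
  have hgd : Differentiable ℝ g := hgc.differentiable (by norm_num)
  have hgV : ∀ z, HasFrameLaplacian f e g z (V z) := fun z => by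
    simpa using (hM.hasFrameLaplacian z).add (hasFrameLaplacian_const hf.sum_eq_one B z)
  have hlap := hl _ (((hM.hasFrameLaplacian (x + a)).translate.add
    ((HasFrameLaplacian.sum Q hf.sum_eq_one fun q =>
      ((hgV (x + q)).sq hf.sum_eq_one hgd).translate).const_mul η)).add
    ((hasFrameLaplacian_sqNorm hf.sum_eq_one he (x + -y)).translate.const_mul (-κ)))
  refine ⟨f, e, x, hf, he, ?_, fun q hq i => ?_⟩
  · have h1 := hx y
    have h2 : sqNorm (y - y) = 0 := by simp [sqNorm]
    rw [h2] at h1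
    have h3 := mul_nonneg hκ0.le (sqNorm_nonneg (x - y))
    linarith [hP0 y, hP1 x, (abs_le.mp (hvu x)).2, (abs_le.mp (hvu (y + a))).1,
      (abs_le.mp (hvu x)).1, hP1 y]
  · have hfd : fderiv ℝ g = fderiv ℝ v := by
      funext z
      simp only [hg]
      exact fderiv_add_const _
    rw [hfd] at hlap
    have hterm : ∀ q i, 0 ≤ f i / 2 * (fderiv ℝ v (x + q) (e i) ^ 2 +
        fderiv ℝ v (x + q) (Complex.I • e i) ^ 2) := fun q i =>
      mul_nonneg (div_nonneg (hf.nonneg i) (by norm_num)) (by positivity)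
    have h1 := Finset.single_le_sum (fun i _ => hterm q i) (Finset.mem_univ i)
    have h2 := Finset.single_le_sum (f := fun q => 2 * g (x + q) * V (x + q) +
      ∑ i, f i / 2 * (fderiv ℝ v (x + q) (e i) ^ 2 +
        fderiv ℝ v (x + q) (Complex.I • e i) ^ 2)) (fun q _ => add_nonneg
      (mul_nonneg (mul_nonneg zero_le_two (hg0 _)) (hV0 _))
      (Finset.sum_nonneg fun i _ => hterm q i)) hq
    have h3 : 0 ≤ 2 * g (x + q) * V (x + q) :=
      mul_nonneg (mul_nonneg zero_le_two (hg0 _)) (hV0 _)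
    have h4 : η * (f i / 2 * (fderiv ℝ v (x + q) (e i) ^ 2 +
        fderiv ℝ v (x + q) (Complex.I • e i) ^ 2)) ≤ η * (ε / 2) := by
      refine (mul_le_mul_of_nonneg_left ((h1.trans (le_add_of_nonneg_left h3)).trans h2)
        hη0.le).trans ?_
      linarith [hV0 (x + a)]
    have h5 := le_of_mul_le_mul_left h4 hη0
    have h6 := mul_nonneg (hf.nonneg i) (sq_nonneg (fderiv ℝ v (x + q) (e i)))
    have h7 := mul_nonneg (hf.nonneg i) (sq_nonneg (fderiv ℝ v (x + q) (Complex.I • e i)))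
    constructor <;> linarith

end Touching

section Liouville

/-- The sum of the second differences of `g` in the directions `1` and `√−1`. -/
noncomputable def crossDifference (g : ℂ → ℝ) (s : ℝ) (z : ℂ) : ℝ :=
  g (z + s) + g (z - s) + g (z + s * Complex.I) + g (z - s * Complex.I) - 4 * g z

/-- A strictly superharmonic function on the punctured plane tending to infinity at infinity. -/
noncomputable def planeBarrier (z : ℂ) : ℝ :=
  Real.log (Complex.normSq z) - (Complex.normSq z)⁻¹

theorem four_point_log_le {R x y s : ℝ} (hR : R = x ^ 2 + y ^ 2) (hR0 : 0 < R)
    (h1 : 0 < R + 2 * x * s + s ^ 2) (h2 : 0 < R - 2 * x * s + s ^ 2)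
    (h3 : 0 < R + 2 * y * s + s ^ 2) (h4 : 0 < R - 2 * y * s + s ^ 2) :
    Real.log (R + 2 * x * s + s ^ 2) + Real.log (R - 2 * x * s + s ^ 2) +
      Real.log (R + 2 * y * s + s ^ 2) + Real.log (R - 2 * y * s + s ^ 2) - 4 * Real.log R ≤
        2 * (s ^ 4 / R ^ 2) := by
  have hR2 : 0 < R ^ 2 := by positivity
  rw [← Real.log_mul h1.ne' h2.ne', ← Real.log_mul (mul_pos h1 h2).ne' h3.ne',
    ← Real.log_mul (mul_pos (mul_pos h1 h2) h3).ne' h4.ne']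
  have hle : (R + 2 * x * s + s ^ 2) * (R - 2 * x * s + s ^ 2) * (R + 2 * y * s + s ^ 2) *
      (R - 2 * y * s + s ^ 2) ≤ (R ^ 2 * (1 + s ^ 4 / R ^ 2)) ^ 2 := by
    have : R ^ 2 * (1 + s ^ 4 / R ^ 2) = R ^ 2 + s ^ 4 := by field_simp
    rw [this]
    have h : (R ^ 2 + s ^ 4) ^ 2 - (R + 2 * x * s + s ^ 2) * (R - 2 * x * s + s ^ 2) *
        (R + 2 * y * s + s ^ 2) * (R - 2 * y * s + s ^ 2) = (2 * (x ^ 2 - y ^ 2) * s ^ 2) ^ 2 := by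
      rw [hR]; ring
    nlinarith [sq_nonneg (2 * (x ^ 2 - y ^ 2) * s ^ 2)]
  have h5 := Real.log_le_log (mul_pos (mul_pos (mul_pos h1 h2) h3) h4) hle
  have h6 : 0 < 1 + s ^ 4 / R ^ 2 := by positivity
  rw [Real.log_pow, Real.log_mul hR2.ne' h6.ne', Real.log_pow] at h5
  have h7 := Real.log_le_sub_one_of_pos h6
  push_cast at h5
  linarith

theorem four_point_inv_ge {R x y s : ℝ} (hR : R = x ^ 2 + y ^ 2) (hR0 : 0 < R)
    (h1 : 0 < R + 2 * x * s + s ^ 2) (h2 : 0 < R - 2 * x * s + s ^ 2)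
    (h3 : 0 < R + 2 * y * s + s ^ 2) (h4 : 0 < R - 2 * y * s + s ^ 2) (hs : 2 * s ^ 2 ≤ R) :
    s ^ 2 / R ^ 2 ≤ (R + 2 * x * s + s ^ 2)⁻¹ + (R - 2 * x * s + s ^ 2)⁻¹ +
      (R + 2 * y * s + s ^ 2)⁻¹ + (R - 2 * y * s + s ^ 2)⁻¹ - 4 * R⁻¹ := by
  set P := (R + 2 * x * s + s ^ 2) * (R - 2 * x * s + s ^ 2) with hP
  set Q := (R + 2 * y * s + s ^ 2) * (R - 2 * y * s + s ^ 2) with hQ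
  have hP0 : 0 < P := mul_pos h1 h2
  have hQ0 : 0 < Q := mul_pos h3 h4
  have hPQ : P + Q = 2 * (R ^ 2 + s ^ 4) := by
    have hx : x ^ 2 = R - y ^ 2 := by rw [hR]; ring
    rw [hP, hQ]
    linear_combination (-4 * s ^ 2) * hx
  have e1 : (R + 2 * x * s + s ^ 2)⁻¹ + (R - 2 * x * s + s ^ 2)⁻¹ = 2 * (R + s ^ 2) / P := by
    rw [hP]; field_simp; ring
  have e2 : (R + 2 * y * s + s ^ 2)⁻¹ + (R - 2 * y * s + s ^ 2)⁻¹ = 2 * (R + s ^ 2) / Q := by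
    rw [hQ]; field_simp; ring
  have e3 : 2 / (R ^ 2 + s ^ 4) ≤ P⁻¹ + Q⁻¹ := by
    rw [inv_add_inv hP0.ne' hQ0.ne', div_le_div_iff₀ (by positivity) (mul_pos hP0 hQ0)]
    nlinarith [sq_nonneg (P - Q)]
  have e4 : 2 * (R + s ^ 2) * (2 / (R ^ 2 + s ^ 4)) ≤ 2 * (R + s ^ 2) * (P⁻¹ + Q⁻¹) :=
    mul_le_mul_of_nonneg_left e3 (by positivity)
  have e5 : s ^ 2 / R ^ 2 ≤ 2 * (R + s ^ 2) * (2 / (R ^ 2 + s ^ 4)) - 4 * R⁻¹ := by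
    have : 2 * (R + s ^ 2) * (2 / (R ^ 2 + s ^ 4)) - 4 * R⁻¹ =
        4 * s ^ 2 * (R - s ^ 2) / (R * (R ^ 2 + s ^ 4)) := by
      field_simp; ring
    rw [this, div_le_div_iff₀ (by positivity) (by positivity)]
    have hs4 : 4 * s ^ 4 ≤ R ^ 2 := by nlinarith [sq_nonneg s]
    have : 0 ≤ s ^ 2 * R * (4 * R * (R - s ^ 2) - (R ^ 2 + s ^ 4)) := by
      apply mul_nonneg (by positivity)
      nlinarith
    nlinarith
  rw [mul_add (2 * (R + s ^ 2)) P⁻¹ Q⁻¹, ← div_eq_mul_inv, ← div_eq_mul_inv] at e4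
  linarith

theorem crossDifference_planeBarrier_le {z : ℂ} (hz : z ≠ 0) :
    ∃ c, 0 < c ∧ ∀ᶠ s : ℝ in 𝓝[>] 0, crossDifference planeBarrier s z ≤ -(c * s ^ 2) := by
  set R := Complex.normSq z with hRdef
  have hR0 : 0 < R := Complex.normSq_pos.mpr hz
  have hR : R = z.re ^ 2 + z.im ^ 2 := by rw [hRdef, Complex.normSq_apply]; ring
  refine ⟨1 / (2 * R ^ 2), by positivity, ?_⟩
  have hs1 : ∀ᶠ s : ℝ in 𝓝[>] 0, 2 * s ^ 2 < R ∧ 4 * s ^ 2 < 1 := by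
    refine eventually_nhdsWithin_of_eventually_nhds (Eventually.and ?_ ?_)
    · exact (by fun_prop : Continuous fun s : ℝ => 2 * s ^ 2).continuousAt.eventually_lt
        continuousAt_const (by simpa using hR0)
    · exact (by fun_prop : Continuous fun s : ℝ => 4 * s ^ 2).continuousAt.eventually_lt
        continuousAt_const (by simp)
  filter_upwards [hs1, self_mem_nhdsWithin] with s hs hs0
  have hs0 : 0 < s := hs0
  have n1 : Complex.normSq (z + s) = R + 2 * z.re * s + s ^ 2 := by
    rw [hR, Complex.normSq_apply]; simp; ring
  have n2 : Complex.normSq (z - s) = R - 2 * z.re * s + s ^ 2 := by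
    rw [hR, Complex.normSq_apply]; simp; ring
  have n3 : Complex.normSq (z + s * Complex.I) = R + 2 * z.im * s + s ^ 2 := by
    rw [hR, Complex.normSq_apply]; simp; ring
  have n4 : Complex.normSq (z - s * Complex.I) = R - 2 * z.im * s + s ^ 2 := by
    rw [hR, Complex.normSq_apply]; simp; ring
  have pos : ∀ t : ℝ, t ^ 2 ≤ R → 0 < R + 2 * t * s + s ^ 2 ∧ 0 < R - 2 * t * s + s ^ 2 :=
    fun t ht => by
      have hp := sq_nonneg (2 * t + 3 * s)
      have hm := sq_nonneg (2 * t - 3 * s)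
      constructor <;> nlinarith
  obtain ⟨h1, h2⟩ := pos z.re (by rw [hR]; nlinarith [sq_nonneg z.im])
  obtain ⟨h3, h4⟩ := pos z.im (by rw [hR]; nlinarith [sq_nonneg z.re])
  have hl := four_point_log_le hR hR0 h1 h2 h3 h4
  have hi := four_point_inv_ge hR hR0 h1 h2 h3 h4 hs.1.le
  simp only [crossDifference, planeBarrier, n1, n2, n3, n4, ← hRdef]
  have h5 : 2 * (s ^ 4 / R ^ 2) ≤ (1 / 2) * (s ^ 2 / R ^ 2) := by
    rw [← mul_div_assoc, ← mul_div_assoc]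
    refine div_le_div_of_nonneg_right ?_ (by positivity)
    nlinarith [sq_nonneg s]
  have h6 : 1 / (2 * R ^ 2) * s ^ 2 = (1 / 2) * (s ^ 2 / R ^ 2) := by field_simp
  rw [h6]
  linarith

theorem le_of_crossDifference_ge {F : ℂ → ℝ} (hF : Continuous F) {B : ℝ} (hB : ∀ z, |F z| ≤ B)
    {M : ℝ} (hM : ∀ z, ∀ s : ℝ, 0 < s → s ≤ 1 → -(M * s ^ 3) ≤ crossDifference F s z) (b : ℂ) :
    F b ≤ F 0 := by
  by_contra! hlt
  have hb : b ≠ 0 := by rintro rfl; exact lt_irrefl _ hlt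
  obtain ⟨ρ, hρ0, hρ⟩ : ∃ ρ > 0, ∀ z : ℂ, ‖z‖ < ρ → F z < (F 0 + F b) / 2 := by
    have := hF.continuousAt.eventually_lt (continuousAt_const (y := (F 0 + F b) / 2))
      (show F 0 < (F 0 + F b) / 2 by linarith)
    obtain ⟨ρ, hρ0, hρ⟩ := Metric.eventually_nhds_iff.mp this
    exact ⟨ρ, hρ0, fun z hz => hρ (by simpa using hz)⟩
  set r := ρ / 2 with hr
  have hr0 : 0 < r := by positivity
  have hrb : r < ‖b‖ := by
    by_contra! h
    have := hρ b (by linarith)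
    linarith
  set D := planeBarrier b - (Real.log (r ^ 2) - (r ^ 2)⁻¹) with hD
  set ε := (F b - F 0) / (4 * (|D| + 1)) with hε
  have hε0 : 0 < ε := div_pos (by linarith) (by positivity)
  have hεD : ε * D < (F b - F 0) / 2 := by
    have h1 : ε * (|D| + 1) = (F b - F 0) / 4 := by rw [hε]; field_simp
    have h2 : ε * D ≤ ε * (|D| + 1) :=
      mul_le_mul_of_nonneg_left (by linarith [le_abs_self D]) hε0.le
    linarith
  have hcont : ContinuousOn (fun z => F z - ε * planeBarrier z) {z | r ≤ ‖z‖} := by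
    intro z hz
    have hz0 : Complex.normSq z ≠ 0 :=
      (Complex.normSq_pos.mpr (norm_pos_iff.mp (hr0.trans_le hz))).ne'
    have h1 : ContinuousAt planeBarrier z :=
      (Complex.continuous_normSq.continuousAt.log hz0).sub
        (Complex.continuous_normSq.continuousAt.inv₀ hz0)
    exact (hF.continuousAt.sub (continuousAt_const.mul h1)).continuousWithinAt
  have hclosed : IsClosed {z : ℂ | r ≤ ‖z‖} := isClosed_le continuous_const continuous_norm
  obtain ⟨z, hz, hmax⟩ := hcont.exists_isMaxOn' hclosed (x₀ := b) hrb.le (by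
    rw [eventually_inf_principal]
    have hlog : Tendsto (fun z : ℂ => Real.log (‖z‖ ^ 2)) (cocompact ℂ) atTop :=
      Real.tendsto_log_atTop.comp ((tendsto_pow_atTop two_ne_zero).comp
        (tendsto_norm_cocompact_atTop))
    filter_upwards [hlog.eventually_ge_atTop ((B - (F b - ε * planeBarrier b)) / ε + (r ^ 2)⁻¹)]
      with z hz hzr
    have hzr : r ≤ ‖z‖ := hzr
    have h1 : (‖z‖ ^ 2)⁻¹ ≤ (r ^ 2)⁻¹ := by gcongr
    have h2 : (B - (F b - ε * planeBarrier b)) / ε ≤ planeBarrier z := by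
      have hp : planeBarrier z = Real.log (‖z‖ ^ 2) - (‖z‖ ^ 2)⁻¹ := by
        rw [planeBarrier, Complex.normSq_eq_norm_sq]
      rw [hp]
      linarith
    rw [div_le_iff₀ hε0] at h2
    linarith [(abs_le.mp (hB z)).2])
  have hmax' : ∀ w : ℂ, r ≤ ‖w‖ → F w - ε * planeBarrier w ≤ F z - ε * planeBarrier z :=
    fun w hw => hmax hw
  have hzr : r < ‖z‖ := by
    refine lt_of_le_of_ne hz fun h => ?_
    have h1 := hmax' b hrb.le
    have h2 := hρ z (by rw [← h]; linarith)
    have h3 : planeBarrier z = Real.log (r ^ 2) - (r ^ 2)⁻¹ := by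
      rw [planeBarrier, Complex.normSq_eq_norm_sq, ← h]
    rw [h3] at h1
    linarith [mul_sub ε (planeBarrier b) (Real.log (r ^ 2) - (r ^ 2)⁻¹)]
  have hz0 : z ≠ 0 := norm_pos_iff.mp (hr0.trans hzr)
  obtain ⟨c, hc, hcs⟩ := crossDifference_planeBarrier_le hz0
  have hnear : ∀ b : ℂ, ∀ᶠ s : ℝ in 𝓝[>] 0, r < ‖z + s * b‖ := fun b => by
    refine eventually_nhdsWithin_of_eventually_nhds ?_
    exact continuousAt_const.eventually_lt
      (by fun_prop : Continuous fun s : ℝ => ‖z + s * b‖).continuousAt (by simpa using hzr)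
  have hsmall : ∀ᶠ s : ℝ in 𝓝[>] 0, M * s < ε * c := by
    refine eventually_nhdsWithin_of_eventually_nhds ?_
    exact (by fun_prop : Continuous fun s : ℝ => M * s).continuousAt.eventually_lt
      continuousAt_const (by simpa using mul_pos hε0 hc)
  obtain ⟨s, hs1, hs2, hs3, hs4, hs5, hs6, hs7⟩ := (hcs.and ((hnear 1).and ((hnear (-1)).and
    ((hnear Complex.I).and ((hnear (-Complex.I)).and (hsmall.and
      (Ioc_mem_nhdsGT (zero_lt_one' ℝ) : ∀ᶠ s : ℝ in 𝓝[>] 0, s ∈ Set.Ioc 0 1))))))).exists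
  have h0 := hM z s hs7.1 hs7.2
  have g1 := hmax' _ hs2.le
  have g2 := hmax' _ hs3.le
  have g3 := hmax' _ hs4.le
  have g4 := hmax' _ hs5.le
  simp only [mul_one, mul_neg, ← sub_eq_add_neg] at g1 g2 g3 g4
  simp only [crossDifference] at h0 hs1
  have h5 : -(M * s ^ 3) ≤ -(ε * (c * s ^ 2)) := by nlinarith
  have h6 : M * s * s ^ 2 < ε * c * s ^ 2 := mul_lt_mul_of_pos_right hs6 (pow_pos hs7.1 2)
  linarith [(by ring : M * s * s ^ 2 = M * s ^ 3)]

theorem eq_of_crossDifference_ge {F : ℂ → ℝ} (hF : Continuous F) {B : ℝ} (hB : ∀ z, |F z| ≤ B)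
    {M : ℝ} (hM : ∀ z, ∀ s : ℝ, 0 < s → s ≤ 1 → -(M * s ^ 3) ≤ crossDifference F s z) (b : ℂ) :
    F b = F 0 := by
  refine le_antisymm (le_of_crossDifference_ge hF hB hM b) ?_
  have := le_of_crossDifference_ge (F := fun z => F (z + b)) (by fun_prop) (fun z => hB _) (M := M)
    (fun z s hs hs1 => by
      have h : crossDifference (fun z => F (z + b)) s z = crossDifference F s (z + b) := by
        simp only [crossDifference, add_right_comm, sub_add_eq_add_sub]
      exact h ▸ hM (z + b) s hs hs1) (-b)
  simpa using this

end Liouville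

section Limits

theorem Ultrafilter.exists_tendsto_of_norm_le {ι F : Type*} [NormedAddCommGroup F] [ProperSpace F]
    (U : Ultrafilter ι) {ψ : ι → F} {B : ℝ} (hB : ∀ j, ‖ψ j‖ ≤ B) :
    ∃ l, Tendsto ψ U (𝓝 l) := by
  obtain ⟨l, -, hl⟩ := (isCompact_closedBall (0 : F) B).ultrafilter_le_nhds (U.map ψ)
    (le_principal_iff.mpr (Filter.mem_map.mpr (univ_mem' fun j => by simpa using hB j)))
  exact ⟨l, hl⟩

theorem eq_of_abs_sub_le_sq {p : ℝ → ℝ} {K : ℝ} (hp : ∀ t s, |p (t + s) - p t| ≤ K * s ^ 2)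
    (t : ℝ) : p t = p 0 := by
  have hd : ∀ t, HasDerivAt p 0 t := fun t => by
    rw [hasDerivAt_iff_isLittleO_nhds_zero]
    have h1 : (fun h : ℝ => p (t + h) - p t - h • (0 : ℝ)) =O[𝓝 0] fun h : ℝ => h ^ 2 :=
      Asymptotics.IsBigO.of_bound K (Eventually.of_forall fun h => by
        simpa [Real.norm_eq_abs] using hp t h)
    exact h1.trans_isLittleO (Asymptotics.isLittleO_pow_id one_lt_two)
  exact is_const_of_deriv_eq_zero (fun t => (hd t).differentiableAt) (fun t => (hd t).deriv) t 0

theorem tendsto_zero_of_mul_sq_le {ι : Type*} {l : Filter ι} {f D ε : ι → ℝ} {c : ℝ} (hc : 0 < c)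
    (hf : Tendsto f l (𝓝 c)) (hε : Tendsto ε l (𝓝 0)) (h : ∀ᶠ j in l, f j * D j ^ 2 ≤ ε j) :
    Tendsto D l (𝓝 0) := by
  have h1 : Tendsto (fun j => ε j / f j) l (𝓝 0) := by
    simpa only [zero_div, Pi.div_def] using hε.div hf hc.ne'
  have h2 : Tendsto (fun j => D j ^ 2) l (𝓝 0) := by
    refine tendsto_of_tendsto_of_tendsto_of_le_of_le' tendsto_const_nhds h1
      (Eventually.of_forall fun j => sq_nonneg _) ?_
    filter_upwards [h, hf.eventually_const_lt hc] with j hj hfj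
    rwa [le_div_iff₀ hfj, mul_comm]
  rw [tendsto_zero_iff_abs_tendsto_zero]
  simpa [Function.comp_def, Real.sqrt_sq_eq_abs] using h2.sqrt

theorem abs_sub_sub_fderiv_le {E : Type*} [NormedAddCommGroup E] [NormedSpace ℝ E] {v : E → ℝ}
    (hv : Differentiable ℝ v) {K : ℝ} (hK0 : 0 ≤ K)
    (hK : ∀ x y, ‖fderiv ℝ v x - fderiv ℝ v y‖ ≤ K * ‖x - y‖) (x b : E) :
    |v (x + b) - v x - fderiv ℝ v x b| ≤ K * ‖b‖ ^ 2 := by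
  have := (convex_closedBall x ‖b‖).norm_image_sub_le_of_norm_fderiv_le' (f := v) (y := x + b)
    (x := x) (φ := fderiv ℝ v x) (C := K * ‖b‖) (fun y _ => hv y) (fun y hy => by
      refine (hK y x).trans ?_
      gcongr
      simpa [dist_eq_norm] using hy) (by simp) (by simp)
  simpa [Real.norm_eq_abs, sq, mul_assoc] using this

variable {n : ℕ} {ι : Type*} {l : Filter ι} [NeBot l] {v w : (Fin n → ℂ) → ℝ} {x : ι → Fin n → ℂ}

theorem frameAverage_sub_ge_of_tendsto {f : Fin n → ℝ} {e : Matrix (Fin n) (Fin n) ℂ}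
    {V : (Fin n → ℂ) → ℝ} {M : ℝ} (hM : HasUniformExpansion f e v V M) (hV : ∀ x, 0 ≤ V x)
    (hw : ∀ z, Tendsto (fun j => v (x j + z)) l (𝓝 (w z))) (z : Fin n → ℂ) {s : ℝ} (hs : 0 < s)
    (hs1 : s ≤ 1) : -(M * s ^ 3) ≤ frameAverage f e s w z - w z := by
  have h1 : Tendsto (fun j => frameAverage f e s v (x j + z) - v (x j + z)) l
      (𝓝 (frameAverage f e s w z - w z)) := by
    refine Tendsto.sub ?_ (hw z)
    simp only [frameAverage, add_assoc, add_sub_assoc]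
    refine tendsto_finsetSum _ fun i _ => Tendsto.const_mul _ ?_
    exact (hw _).add ((hw _).add ((hw _).add (hw _)))
  refine ge_of_tendsto' h1 fun j => ?_
  have h2 := (abs_le.mp (hM.second (x j + z) s hs hs1)).1
  have h3 : 0 ≤ s ^ 2 * V (x j + z) := mul_nonneg (sq_nonneg s) (hV _)
  linarith

theorem eq_of_tendsto_fderiv_zero (hv : Differentiable ℝ v) {K : ℝ} (hK0 : 0 ≤ K)
    (hK : ∀ x y, ‖fderiv ℝ v x - fderiv ℝ v y‖ ≤ K * ‖x - y‖)
    {B : ℝ} (hB0 : 0 ≤ B) (hB : ∀ x y, |v x - v y| ≤ B * ‖x - y‖)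
    (hw : ∀ z, Tendsto (fun j => v (x j + z)) l (𝓝 (w z)))
    {b : ι → Fin n → ℂ} {b' : Fin n → ℂ} (hb : Tendsto b l (𝓝 b'))
    (hD : ∀ q, Tendsto (fun j => fderiv ℝ v (x j + q) (b j)) l (𝓝 0)) (z : Fin n → ℂ) (t : ℝ) :
    w (z + t • b') = w z := by
  have hDB : ∀ y, ‖fderiv ℝ v y‖ ≤ B := fun y =>
    norm_fderiv_le_of_lip' ℝ hB0 (Eventually.of_forall fun y' => hB y' y)
  have hD' : ∀ q, Tendsto (fun j => fderiv ℝ v (x j + q) b') l (𝓝 0) := fun q => by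
    have h1 : Tendsto (fun j => fderiv ℝ v (x j + q) (b' - b j)) l (𝓝 0) := by
      refine squeeze_zero_norm (fun j => (fderiv ℝ v (x j + q)).le_of_opNorm_le (hDB _) _) ?_
      have : Tendsto (fun j => B * ‖b' - b j‖) l (𝓝 (B * ‖b' - b'‖)) :=
        (hb.const_sub b').norm.const_mul B
      simpa using this
    simpa using h1.add (hD q)
  have h := eq_of_abs_sub_le_sq (p := fun t => w (z + t • b')) (K := K * ‖b'‖ ^ 2) (fun t s => by
    have h1 : Tendsto (fun j => |v (x j + (z + (t + s) • b')) - v (x j + (z + t • b')) -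
        s * fderiv ℝ v (x j + (z + t • b')) b'|) l
        (𝓝 |w (z + (t + s) • b') - w (z + t • b') - s * 0|) :=
      (((hw _).sub (hw _)).sub ((hD' _).const_mul s)).abs
    rw [mul_zero, sub_zero] at h1
    refine le_of_tendsto' h1 fun j => ?_
    have h2 := abs_sub_sub_fderiv_le hv hK0 hK (x j + (z + t • b')) (s • b')
    rw [map_smul, smul_eq_mul, norm_smul, mul_pow, Real.norm_eq_abs, sq_abs] at h2
    rw [add_smul, ← add_assoc z, ← add_assoc (x j)]
    linarith) t
  simpa using h

end Limits

section Conclusion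

variable {n : ℕ}

/-- If averages over every dual frame with a fixed weight are bounded below, and a function is
invariant in the directions of positive weight, then it is invariant in all directions. -/
theorem eq_of_frameAverage_ge {w : (Fin n → ℂ) → ℝ} (hw : Continuous w) {B : ℝ}
    (hB : ∀ z, |w z| ≤ B) {f : Fin n → ℝ} (hf0 : ∀ i, 0 ≤ f i) (hf1 : ∑ i, f i = 1)
    {e : Matrix (Fin n) (Fin n) ℂ} (he : e * e.conjTranspose = 1)
    (hM : ∀ e : Matrix (Fin n) (Fin n) ℂ, e * e.conjTranspose = 1 →
      ∃ M, ∀ z, ∀ s : ℝ, 0 < s → s ≤ 1 → -(M * s ^ 3) ≤ frameAverage f e s w z - w z)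
    (hinv : ∀ i, 0 < f i → ∀ z, ∀ c : ℂ, w (z + c • e i) = w z) (a : Fin n → ℂ) :
    w a = w 0 := by
  obtain ⟨i₀, hi₀⟩ : ∃ i, 0 < f i := by
    by_contra! h
    have := Finset.sum_nonpos fun i (_ : i ∈ Finset.univ) => h i
    linarith
  have hall : ∀ k, ∀ z, ∀ c : ℂ, w (z + c • e k) = w z := by
    intro k z c
    rcases (hf0 k).lt_or_eq with hk | hk
    · exact hinv k hk z c
    set σ := Equiv.swap i₀ k
    have he' : e.submatrix σ id * (e.submatrix σ id).conjTranspose = 1 := by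
      rw [Matrix.conjTranspose_submatrix]
      exact (Matrix.submatrix_mul_equiv e e.conjTranspose σ (Equiv.refl _) σ).trans (by simp [he])
    obtain ⟨M, hM⟩ := hM _ he'
    have hσ : ∀ i, 0 < f i → i ≠ i₀ → σ i = i := fun i hi hii =>
      Equiv.swap_apply_of_ne_of_ne hii (by rintro rfl; exact hi.ne hk)
    have key : ∀ z s, frameAverage f (e.submatrix σ id) s w z - w z =
        f i₀ / 4 * ((w (z + s • e k) + w (z - s • e k) - 2 * w z) +
          (w (z + s • (Complex.I • e k)) + w (z - s • (Complex.I • e k)) - 2 * w z)) := by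
      intro z s
      rw [frameAverage_sub_self hf1, Finset.sum_eq_single i₀]
      · have : e.submatrix σ id i₀ = e k := by
          ext j; simp [σ]
        rw [this]
      · intro i _ hii
        rcases (hf0 i).lt_or_eq with hi | hi
        · have h1 : e.submatrix σ id i = e i := by
            ext j; simp [hσ i hi hii]
          have h2 : ∀ r : ℝ, ∀ z, w (z + r • e i) = w z := fun r z => by
            simpa using hinv i hi z (r : ℂ)
          have h3 : ∀ r : ℝ, ∀ z, w (z + r • (Complex.I • e i)) = w z := fun r z => by
            simpa [mul_smul] using hinv i hi z (r * Complex.I)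
          have h4 : w (z - s • e i) = w z := by
            simpa [sub_eq_add_neg] using h2 (-s) z
          have h5 : w (z - s • (Complex.I • e i)) = w z := by
            simpa [sub_eq_add_neg] using h3 (-s) z
          rw [h1, h2, h3, h4, h5]
          ring
        · rw [← hi]; ring
      · simp
    have := eq_of_crossDifference_ge (F := fun ζ : ℂ => w (z + ζ • e k)) (by fun_prop)
      (fun ζ => hB _) (M := M * (4 / f i₀)) (fun ζ s hs hs1 => by
        have h1 := hM (z + ζ • e k) s hs hs1
        rw [key] at h1
        have h2 : crossDifference (fun ζ : ℂ => w (z + ζ • e k)) s ζ =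
            (w (z + ζ • e k + s • e k) + w (z + ζ • e k - s • e k) - 2 * w (z + ζ • e k)) +
            (w (z + ζ • e k + s • (Complex.I • e k)) + w (z + ζ • e k - s • (Complex.I • e k)) -
              2 * w (z + ζ • e k)) := by
          simp only [crossDifference, add_smul, sub_smul, mul_smul, Complex.coe_smul, add_assoc,
            add_sub_assoc]
          ring
        rw [h2]
        have h3 : 0 < 4 / f i₀ := by positivity
        have h4 := mul_le_mul_of_nonneg_left h1 h3.le
        rw [← mul_assoc, show 4 / f i₀ * (f i₀ / 4) = 1 by field_simp, one_mul] at h4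
        linarith) c
    simpa using this
  have hsum : ∀ c : Fin n → ℂ, ∀ S : Finset (Fin n), w (∑ i ∈ S, c i • e i) = w 0 := by
    intro c S
    induction S using Finset.induction_on with
    | empty => simp
    | insert i S hi ih => rw [Finset.sum_insert hi, add_comm, hall, ih]
  have ha : a = ∑ i, (Matrix.vecMul a e.conjTranspose) i • e i := by
    rw [← Matrix.vecMul_eq_sum, Matrix.vecMul_vecMul, mul_eq_one_comm.mp he, Matrix.vecMul_one]
  rw [ha, hsum]

theorem IsGammaSolution.eq_const {Γ : Set (Fin n → ℝ)} {u : (Fin n → ℂ) → ℝ}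
    (hu : IsGammaSolution n Γ u) (hopen : IsOpen Γ) (hconv : Convex ℝ Γ)
    (hcone : ∀ x ∈ Γ, ∀ t : ℝ, 0 < t → t • x ∈ Γ)
    (hperm : ∀ π : Equiv.Perm (Fin n), ∀ x ∈ Γ, (x ∘ π) ∈ Γ)
    (hpos : {x : Fin n → ℝ | ∀ i, 0 < x i} ⊆ Γ) {C : ℝ} (hC : ∀ x, |u x| ≤ C)
    {L : ℝ} (hL : ∀ x y, |u x - u y| ≤ L * ‖x - y‖) (huc : Continuous u) (y a : Fin n → ℂ) :
    u (y + a) ≤ u y := by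
  by_contra! hlt
  set m := u (y + a) - u y with hm
  have hm0 : 0 < m := sub_pos.mpr hlt
  obtain ⟨v, hv, hvu, hvV⟩ := hu.1.exists_smooth_approx hperm huc hC hL (show 0 < m / 8 by positivity)
  obtain ⟨B, hB0, hB⟩ := hv.exists_bound hC
  obtain ⟨L', hL'0, hL'⟩ := hv.exists_lipschitz huc hL
  obtain ⟨K, hK0, hK⟩ := hv.exists_lipschitz_fderiv huc hL
  let J := Finset (Fin n → ℂ) × ℕ
  have hex := fun j : J => hu.exists_almost_degenerate hopen hconv hcone hpos huc hC
    (contDiff_infty.mp (hv.contDiff huc) 2) hB hvV hm0 hvu (a := a) (y := y) hm.le j.1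
    (show 0 < 1 / ((j.2 : ℝ) + 1) by positivity)
  choose f e x hf he hx hfx using hex
  let U : Ultrafilter J := Ultrafilter.of atTop
  have hU : (U : Filter J) ≤ atTop := Ultrafilter.of_le _
  have hlim : ∀ z, ∃ l, Tendsto (fun j => v (x j + z)) U (𝓝 l) := fun z =>
    U.exists_tendsto_of_norm_le fun j => hB _
  choose w hw using hlim
  have hflim : ∀ i, ∃ l, Tendsto (fun j => f j i) U (𝓝 l) := fun i =>
    U.exists_tendsto_of_norm_le (B := 1) fun j => by
      rw [Real.norm_of_nonneg ((hf j).nonneg i), ← (hf j).sum_eq_one]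
      exact Finset.single_le_sum (fun i _ => (hf j).nonneg i) (Finset.mem_univ i)
  choose f' hf' using hflim
  have helim : ∀ i k, ∃ l, Tendsto (fun j => e j i k) U (𝓝 l) := fun i k =>
    U.exists_tendsto_of_norm_le (B := 1) fun j =>
      entry_norm_bound_of_unitary (Matrix.mem_unitaryGroup_iff.mpr (he j)) i k
  choose e' he' using helim
  have hetend : Tendsto e U (𝓝 (Matrix.of e')) :=
    tendsto_pi_nhds.mpr fun i => tendsto_pi_nhds.mpr fun k => he' i k
  have hframe : Matrix.of e' * (Matrix.of e').conjTranspose = 1 := by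
    have h1 : Continuous fun A : Matrix (Fin n) (Fin n) ℂ => A * A.conjTranspose := by fun_prop
    refine tendsto_nhds_unique ((h1.tendsto _).comp hetend) ?_
    simp only [Function.comp_def, he]
    exact tendsto_const_nhds
  have hweight : IsDualWeight Γ f' :=
    { nonneg := fun i => ge_of_tendsto' (hf' i) fun j => (hf j).nonneg i
      sum_eq_one := tendsto_nhds_unique (tendsto_finsetSum _ fun i _ => hf' i) (by
        simp only [(hf _).sum_eq_one]
        exact tendsto_const_nhds)
      dual := fun x hx => ge_of_tendsto'
        (tendsto_finsetSum _ fun i _ => (hf' i).mul_const (x i)) fun j => (hf j).dual x hx }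
  have hwB : ∀ z, |w z| ≤ B := fun z => le_of_tendsto' (hw z).abs fun j => hB _
  have hwL : ∀ z z', |w z - w z'| ≤ L' * ‖z - z'‖ := fun z z' =>
    le_of_tendsto' ((hw z).sub (hw z')).abs fun j => by simpa using hL' (x j + z) (x j + z')
  have hwc : Continuous w :=
    (LipschitzWith.of_dist_le_mul (K := ⟨L', hL'0⟩) fun z z' => by
      rw [Real.dist_eq, dist_eq_norm]; exact hwL z z').continuous
  have hεlim : Tendsto (fun j : J => 1 / ((j.2 : ℝ) + 1)) U (𝓝 0) := by
    have h1 : Tendsto (fun j : J => j.2) atTop atTop := by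
      rw [← prod_atTop_atTop_eq]; exact tendsto_snd
    exact (tendsto_one_div_add_atTop_nhds_zero_nat.comp h1).mono_left hU
  have hmem : ∀ q, ∀ᶠ j : J in U, q ∈ j.1 := fun q => hU (by
    filter_upwards [eventually_ge_atTop (({q}, 0) : J)] with j hj
    exact hj.1 (Finset.mem_singleton_self q))
  have hrow : ∀ i, Tendsto (fun j => e j i) U (𝓝 (Matrix.of e' i)) := fun i =>
    tendsto_pi_nhds.mpr fun k => he' i k
  have hinv : ∀ i, 0 < f' i → ∀ z, ∀ c : ℂ, w (z + c • Matrix.of e' i) = w z := by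
    intro i hi z c
    have h1 := eq_of_tendsto_fderiv_zero (hv.differentiable huc) hK0 hK hL'0 hL' hw (hrow i)
      (fun q => tendsto_zero_of_mul_sq_le hi (hf' i) hεlim
        ((hmem q).mono fun j hj => (hfx j q hj i).1))
    have h2 := eq_of_tendsto_fderiv_zero (hv.differentiable huc) hK0 hK hL'0 hL' hw
      ((hrow i).const_smul Complex.I)
      (fun q => tendsto_zero_of_mul_sq_le hi (hf' i) hεlim
        ((hmem q).mono fun j hj => (hfx j q hj i).2))
    have h3 : c • Matrix.of e' i =
        c.re • Matrix.of e' i + c.im • (Complex.I • Matrix.of e' i) := by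
      conv_lhs => rw [← Complex.re_add_im c]
      simp only [add_smul, mul_smul, Complex.coe_smul]
    rw [h3, ← add_assoc, h2, h1]
  have hconst := eq_of_frameAverage_ge hwc hwB hweight.nonneg hweight.sum_eq_one hframe
    (fun e'' he'' => by
      obtain ⟨V, M, hM, hV⟩ := hvV f' hweight e'' he''
      exact ⟨M, fun z s hs hs1 => frameAverage_sub_ge_of_tendsto hM hV hw z hs hs1⟩) hinv a
  have hgap : m / 2 ≤ w a - w 0 := ge_of_tendsto' ((hw a).sub (hw 0)) fun j => by
    simpa using hx j
  linarith

end Conclusion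

/-- Theorem 20 of Székelyhidi. Let `n ≥ 2` and let `Γ ⊊ ℝⁿ` be an open
convex cone with vertex at the origin, symmetric under permutations of coordinates, with
`Γₙ ⊆ Γ`.  If `u : ℂⁿ → ℝ` is a Lipschitz `Γ`-solution with `|u| ≤ C` and Lipschitz constant
bounded by `C`, then `u` is constant. -/
theorem stmt_10 (n : ℕ) (hn : 2 ≤ n) (Γ : Set (Fin n → ℝ))
    (hopen : IsOpen Γ) (hconv : Convex ℝ Γ)
    (hcone : ∀ x ∈ Γ, ∀ t : ℝ, 0 < t → t • x ∈ Γ)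
    (hperm : ∀ π : Equiv.Perm (Fin n), ∀ x ∈ Γ, (x ∘ π) ∈ Γ)
    (hpos : {x : Fin n → ℝ | ∀ i, 0 < x i} ⊆ Γ)
    (hproper : Γ ≠ Set.univ)
    (u : (Fin n → ℂ) → ℝ) (C : ℝ)
    (hbd : ∀ z, |u z| ≤ C)
    (hLip : LipschitzWith (Real.toNNReal C) u)
    (hsol : IsGammaSolution n Γ u) :
    ∃ c : ℝ, ∀ z, u z = c := by
  have hL : ∀ x y, |u x - u y| ≤ (Real.toNNReal C : ℝ) * ‖x - y‖ := fun x y => by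
    simpa [Real.dist_eq, dist_eq_norm] using hLip.dist_le_mul x y
  have hle := hsol.eq_const hopen hconv hcone hperm hpos hbd hL hLip.continuous
  refine ⟨u 0, fun z => le_antisymm ?_ ?_⟩
  · simpa using hle 0 z
  · simpa using hle z (-z)
end

section
/- Let m ≥ 1 and let v be a smooth real-valued function on a neighborhood of the closed unit ball B̄₁(0) ⊂ ℝᵐ such that v attains its minimum over B̄₁(0) at the origin, and v(y) ≥ v(0) + ε for every y ∈ ∂B₁(0), where ε > 0. Define P := {x ∈ B₁(0) : |Dv(x)| ≤ ε/2 and v(y) ≥ v(x) + Dv(x)·(y − x) for all y ∈ B₁(0)}. Then there exists a constant c₀ > 0 depending only on m such that c₀ εᵐ ≤ ∫_P det(D²v(x)) dx, where the integral is with respect to Lebesgue measure. -/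
open MeasureTheory

/-- The determinant of the (real) Hessian matrix `D²v(x)` of `v : ℝᵐ → ℝ`. -/
noncomputable def hessianDet (m : ℕ) (v : EuclideanSpace ℝ (Fin m) → ℝ)
    (x : EuclideanSpace ℝ (Fin m)) : ℝ :=
  (Matrix.of fun i j : Fin m =>
    fderiv ℝ (fun w => fderiv ℝ v w (EuclideanSpace.single i 1)) x
      (EuclideanSpace.single j 1)).det

open Topology

/-- The necessary second-order condition for a local minimum on the real line. -/
theorem IsLocalMin.deriv_deriv_nonneg {g : ℝ → ℝ} {a : ℝ} (hg : IsLocalMin g a)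
    (hc : ContinuousAt g a) : 0 ≤ deriv (deriv g) a := by
  by_contra! hneg
  have hmax := isLocalMax_of_deriv_deriv_neg hneg hg.deriv_eq_zero hc
  have hconst : g =ᶠ[𝓝 a] fun _ => g a := by
    filter_upwards [hg, hmax] with t h₁ h₂ using le_antisymm h₂ h₁
  have hzero : deriv (deriv g) a = 0 := by
    rw [hconst.deriv.deriv_eq]
    simp
  exact hneg.ne hzero

/-- A function lying locally above its tangent hyperplane has a nonnegative second derivative. -/
theorem fderiv_fderiv_apply_self_nonneg {E : Type*} [NormedAddCommGroup E] [NormedSpace ℝ E]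
    {f : E → ℝ} {x : E} (hf : ContDiffAt ℝ 2 f x)
    (hx : ∀ᶠ y in 𝓝 x, f x + fderiv ℝ f x (y - x) ≤ f y) (h : E) :
    0 ≤ fderiv ℝ (fderiv ℝ f) x h h := by
  set l : ℝ → E := fun t => x + t • h with hl
  have hl' : ∀ t, HasDerivAt l h t := fun t => by
    simpa [hl] using ((hasDerivAt_id t).smul_const h).const_add x
  have hl0 : l 0 = x := by simp [hl]
  have hlim : Filter.Tendsto l (𝓝 0) (𝓝 x) := by
    simpa only [hl0] using (hl' 0).continuousAt.tendsto
  set g : ℝ → ℝ := fun t => f (l t) - t * fderiv ℝ f x h with hg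
  have hdiff : ∀ᶠ y in 𝓝 x, DifferentiableAt ℝ f y :=
    (hf.eventually (by simp)).mono fun y hy => hy.differentiableAt (by simp)
  have hderiv : ∀ t, DifferentiableAt ℝ f (l t) →
      HasDerivAt g (fderiv ℝ f (l t) h - fderiv ℝ f x h) t := fun t ht => by
    have := (ht.hasFDerivAt.comp_hasDerivAt t (hl' t)).sub
      ((hasDerivAt_id t).mul_const (fderiv ℝ f x h))
    rw [one_mul] at this
    exact this
  have hmin : IsLocalMin g 0 := by
    filter_upwards [hlim.eventually hx] with t ht
    have : l t - x = t • h := by simp [hl]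
    rw [this, map_smul, smul_eq_mul] at ht
    simp only [hg, hl0]
    linarith
  have hcont : ContinuousAt g 0 :=
    (hderiv 0 (hl0 ▸ hf.differentiableAt (by simp))).continuousAt
  have hg' : deriv g =ᶠ[𝓝 0] fun t => fderiv ℝ f (l t) h - fderiv ℝ f x h :=
    (hlim.eventually hdiff).mono fun t ht => (hderiv t ht).deriv
  have hff : HasFDerivAt (fderiv ℝ f) (fderiv ℝ (fderiv ℝ f) x) (l 0) :=
    hl0 ▸ ((hf.fderiv_right (m := 1) (by norm_num)).differentiableAt (by simp)).hasFDerivAt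
  have hg'' : HasDerivAt (fun t => fderiv ℝ f (l t) h - fderiv ℝ f x h)
      (fderiv ℝ (fderiv ℝ f) x h h) 0 := by
    have := (hff.comp_hasDerivAt (0 : ℝ) (hl' 0)).clm_apply (hasDerivAt_const (0 : ℝ) h)
    simpa using this.sub_const (fderiv ℝ f x h)
  have := hmin.deriv_deriv_nonneg hcont
  rwa [hg'.deriv_eq, hg''.deriv] at this

section Hessian

variable {m : ℕ} {v : EuclideanSpace ℝ (Fin m) → ℝ} {x : EuclideanSpace ℝ (Fin m)}

/-- The Hessian matrix `D²v(x)`, whose determinant is `hessianDet m v x`. -/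
noncomputable def hessianMatrix (m : ℕ) (v : EuclideanSpace ℝ (Fin m) → ℝ)
    (x : EuclideanSpace ℝ (Fin m)) : Matrix (Fin m) (Fin m) ℝ :=
  Matrix.of fun i j : Fin m =>
    fderiv ℝ (fun w => fderiv ℝ v w (EuclideanSpace.single i 1)) x (EuclideanSpace.single j 1)

/-- The vector of partial derivatives of `v` at `x`. -/
noncomputable def partials (m : ℕ) (v : EuclideanSpace ℝ (Fin m) → ℝ)
    (x : EuclideanSpace ℝ (Fin m)) : EuclideanSpace ℝ (Fin m) :=
  WithLp.toLp 2 fun i => fderiv ℝ v x (EuclideanSpace.single i 1)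

theorem hessianMatrix_apply (hv : ContDiffAt ℝ 2 v x) (i j : Fin m) :
    hessianMatrix m v x i j =
      fderiv ℝ (fderiv ℝ v) x (EuclideanSpace.single j 1) (EuclideanSpace.single i 1) := by
  have hd : DifferentiableAt ℝ (fderiv ℝ v) x :=
    (hv.fderiv_right (m := 1) (by norm_num)).differentiableAt (by simp)
  rw [hessianMatrix, Matrix.of_apply, fderiv_clm_apply hd (differentiableAt_const _)]
  simp

theorem hasFDerivAt_partials (hv : ContDiffAt ℝ 2 v x) :
    HasFDerivAt (partials m v)
      (LinearMap.toContinuousLinearMap (Matrix.toLpLin 2 2 (hessianMatrix m v x))) x := by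
  have hd : DifferentiableAt ℝ (fderiv ℝ v) x :=
    (hv.fderiv_right (m := 1) (by norm_num)).differentiableAt (by simp)
  rw [← hasFDerivWithinAt_univ, hasFDerivWithinAt_euclidean]
  intro i
  rw [hasFDerivWithinAt_univ]
  have hi : DifferentiableAt ℝ (fun w => fderiv ℝ v w (EuclideanSpace.single i 1)) x :=
    hd.clm_apply (differentiableAt_const _)
  have hproj : PiLp.proj 2 (fun _ : Fin m => ℝ) i ∘L
      LinearMap.toContinuousLinearMap (Matrix.toLpLin 2 2 (hessianMatrix m v x)) =
      fderiv ℝ (fun w => fderiv ℝ v w (EuclideanSpace.single i 1)) x := by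
    rw [← ContinuousLinearMap.coe_inj]
    refine Module.Basis.ext (EuclideanSpace.basisFun (Fin m) ℝ).toBasis fun j => ?_
    simp [Matrix.toLpLin_apply, hessianMatrix]
  exact hproj ▸ hi.hasFDerivAt

theorem det_toLpLin_hessianMatrix :
    (LinearMap.toContinuousLinearMap (Matrix.toLpLin 2 2 (hessianMatrix m v x))).det =
      hessianDet m v x := by
  rw [LinearMap.det_toContinuousLinearMap, LinearMap.det_toLpLin]
  rfl

theorem hessianDet_nonneg (hv : ContDiffAt ℝ 2 v x)
    (hx : ∀ᶠ y in 𝓝 x, v x + fderiv ℝ v x (y - x) ≤ v y) : 0 ≤ hessianDet m v x := by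
  have hsymm : IsSymmSndFDerivAt ℝ v x := hv.isSymmSndFDerivAt (by simp)
  refine Matrix.PosSemidef.det_nonneg (A := hessianMatrix m v x)
    (.of_dotProduct_mulVec_nonneg ?_ fun c => ?_)
  · ext i j
    rw [Matrix.conjTranspose_apply, star_trivial, hessianMatrix_apply hv, hessianMatrix_apply hv]
    exact hsymm _ _
  · have hsum : ∑ i, c i • EuclideanSpace.single i (1 : ℝ) = WithLp.toLp 2 c := by
      ext j
      simp [Pi.single_apply]
    have hform : ∀ L : EuclideanSpace ℝ (Fin m) →L[ℝ] ℝ,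
        L (WithLp.toLp 2 c) = ∑ i, c i * L (EuclideanSpace.single i 1) := fun L => by
      simp [← hsum]
    have hquad : star c ⬝ᵥ (hessianMatrix m v x).mulVec c =
        fderiv ℝ (fderiv ℝ v) x (WithLp.toLp 2 c) (WithLp.toLp 2 c) := by
      rw [hform]
      refine Finset.sum_congr rfl fun i _ => congrArg (c i * ·) ?_
      rw [Matrix.mulVec, dotProduct, ← ContinuousLinearMap.flip_apply, hform]
      refine Finset.sum_congr rfl fun j _ => ?_
      rw [hessianMatrix_apply hv, ContinuousLinearMap.flip_apply, mul_comm]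
    rw [hquad]
    exact fderiv_fderiv_apply_self_nonneg hv hx (WithLp.toLp 2 c)

theorem continuousAt_hessianDet (hv : ContDiffAt ℝ 2 v x) : ContinuousAt (hessianDet m v) x := by
  have hd : ContDiffAt ℝ 1 (fderiv ℝ v) x := hv.fderiv_right (by norm_num)
  have hM : ContinuousAt (hessianMatrix m v) x := by
    refine continuousAt_pi.2 fun i => continuousAt_pi.2 fun j => ?_
    have hi : ContDiffAt ℝ 1 (fun w => fderiv ℝ v w (EuclideanSpace.single i 1)) x :=
      hd.clm_apply contDiffAt_const
    exact (hi.fderiv_right (m := 0) (by norm_num)).continuousAt.clm_apply continuousAt_const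
  exact (continuous_id.matrix_det).continuousAt.comp hM

/-- The points of the unit ball where `v` has slope at most `r` and lies above its tangent
hyperplane. -/
def lowerContactSet (m : ℕ) (v : EuclideanSpace ℝ (Fin m) → ℝ) (r : ℝ) :
    Set (EuclideanSpace ℝ (Fin m)) :=
  {x | x ∈ Metric.ball (0 : EuclideanSpace ℝ (Fin m)) 1 ∧ ‖fderiv ℝ v x‖ ≤ r ∧
    ∀ y ∈ Metric.ball (0 : EuclideanSpace ℝ (Fin m)) 1, v x + fderiv ℝ v x (y - x) ≤ v y}

theorem measurableSet_lowerContactSet (r : ℝ)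
    (hv : ∀ x ∈ Metric.ball (0 : EuclideanSpace ℝ (Fin m)) 1, ContDiffAt ℝ 1 v x) :
    MeasurableSet (lowerContactSet m v r) := by
  set B := Metric.ball (0 : EuclideanSpace ℝ (Fin m)) 1
  have hcv : Continuous fun x : B => v x := continuousOn_iff_continuous_domRestrict.1
    fun x hx => (hv x hx).continuousAt.continuousWithinAt
  have hcd : Continuous fun x : B => fderiv ℝ v x := continuousOn_iff_continuous_domRestrict.1
    fun x hx => ((hv x hx).fderiv_right (m := 0) (by norm_num)).continuousAt.continuousWithinAt
  have hclosed : IsClosed {x : B | ‖fderiv ℝ v x‖ ≤ r ∧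
      ∀ y ∈ B, v x + fderiv ℝ v x (y - x) ≤ v y} := by
    have hsupp : IsClosed (⋂ y ∈ B, {x : B | v x + fderiv ℝ v x (y - x) ≤ v y}) :=
      isClosed_biInter fun y _ => isClosed_le
        (hcv.add (hcd.clm_apply (continuous_const.sub continuous_subtype_val))) continuous_const
    convert (isClosed_le hcd.norm (continuous_const (y := r))).inter hsupp using 1
    ext x
    simp
  convert measurableSet_ball.subtype_image hclosed.measurableSet using 1
  ext x
  exact ⟨fun hx => ⟨⟨x, hx.1⟩, hx.2, rfl⟩, by rintro ⟨y, hy, rfl⟩; exact ⟨y.2, hy⟩⟩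

/-- Every covector of norm less than `r` is the derivative of `v` at a point of the lower contact
set, if `v` exceeds `v 0` by at least `r` on the unit sphere. -/
theorem ball_subset_image_partials {r : ℝ}
    (hv : ∀ x ∈ Metric.closedBall (0 : EuclideanSpace ℝ (Fin m)) 1, DifferentiableAt ℝ v x)
    (hb : ∀ y ∈ Metric.sphere (0 : EuclideanSpace ℝ (Fin m)) 1, v 0 + r ≤ v y) :
    Metric.ball 0 r ⊆ partials m v '' lowerContactSet m v r := by
  intro p hp
  have hpr : ‖p‖ < r := by simpa using hp
  have hcont : ContinuousOn (fun y => v y - inner ℝ p y)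
      (Metric.closedBall (0 : EuclideanSpace ℝ (Fin m)) 1) := fun y hy =>
    ((hv y hy).continuousAt.sub (by fun_prop)).continuousWithinAt
  obtain ⟨x, hx, hmin⟩ := (isCompact_closedBall _ _).exists_isMinOn
    ⟨0, Metric.mem_closedBall_self zero_le_one⟩ hcont
  have hle : ∀ y ∈ Metric.closedBall (0 : EuclideanSpace ℝ (Fin m)) 1,
      v x - inner ℝ p x ≤ v y - inner ℝ p y := hmin
  have hxball : x ∈ Metric.ball (0 : EuclideanSpace ℝ (Fin m)) 1 := by
    by_contra hnot
    have hxn : ‖x‖ = 1 :=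
      le_antisymm (by simpa using hx) (by simpa using hnot)
    have h₁ := hle 0 (Metric.mem_closedBall_self zero_le_one)
    have h₂ := hb x (by simpa using hxn)
    have h₃ := real_inner_le_norm p x
    rw [inner_zero_right] at h₁
    rw [hxn] at h₃
    linarith
  have hloc : IsLocalMin (fun y => v y - inner ℝ p y) x := by
    filter_upwards [Metric.isOpen_ball.mem_nhds hxball] with y hy
      using hle y (Metric.ball_subset_closedBall hy)
  have hfd : fderiv ℝ v x = innerSL ℝ p := by
    have h := hloc.hasFDerivAt_eq_zero ((hv x hx).hasFDerivAt.sub (innerSL ℝ p).hasFDerivAt)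
    exact sub_eq_zero.1 h
  refine ⟨x, ⟨hxball, ?_, fun y hy => ?_⟩, ?_⟩
  · rw [hfd, innerSL_apply_norm]
    exact hpr.le
  · have := hle y (Metric.ball_subset_closedBall hy)
    rw [hfd, innerSL_apply_apply, inner_sub_right]
    linarith
  · ext i
    simp [partials, hfd, EuclideanSpace.inner_single_right]

/-- The area formula applied to the gradient map on the lower contact set. -/
theorem volume_ball_le_integral_hessianDet {r : ℝ}
    (hv : ∀ x ∈ Metric.closedBall (0 : EuclideanSpace ℝ (Fin m)) 1, ContDiffAt ℝ 2 v x)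
    (hb : ∀ y ∈ Metric.sphere (0 : EuclideanSpace ℝ (Fin m)) 1, v 0 + r ≤ v y) :
    volume.real (Metric.ball (0 : EuclideanSpace ℝ (Fin m)) r) ≤
      ∫ x in lowerContactSet m v r, hessianDet m v x := by
  have hsub : lowerContactSet m v r ⊆ Metric.closedBall 0 1 := fun x hx =>
    Metric.ball_subset_closedBall hx.1
  have hmeas : MeasurableSet (lowerContactSet m v r) :=
    measurableSet_lowerContactSet r fun x hx =>
      (hv x (Metric.ball_subset_closedBall hx)).of_le (by norm_num)
  have hnonneg : ∀ x ∈ lowerContactSet m v r, 0 ≤ hessianDet m v x := fun x hx =>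
    hessianDet_nonneg (hv x (hsub hx)) <| by
      filter_upwards [Metric.isOpen_ball.mem_nhds hx.1] with y hy using hx.2.2 y hy
  have hint : IntegrableOn (hessianDet m v) (lowerContactSet m v r) :=
    (ContinuousOn.integrableOn_compact (isCompact_closedBall 0 1) fun x hx =>
      (continuousAt_hessianDet (hv x hx)).continuousWithinAt).mono_set hsub
  have hae : 0 ≤ᵐ[volume.restrict (lowerContactSet m v r)] hessianDet m v :=
    (ae_restrict_mem hmeas).mono hnonneg
  refine ENNReal.toReal_le_of_le_ofReal (integral_nonneg_of_ae hae) ?_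
  calc volume (Metric.ball (0 : EuclideanSpace ℝ (Fin m)) r)
      ≤ volume (partials m v '' lowerContactSet m v r) :=
        measure_mono (ball_subset_image_partials
          (fun x hx => (hv x hx).differentiableAt (by simp)) hb)
    _ ≤ ∫⁻ x in lowerContactSet m v r, ENNReal.ofReal
          |(LinearMap.toContinuousLinearMap (Matrix.toLpLin 2 2 (hessianMatrix m v x))).det| :=
        addHaar_image_le_lintegral_abs_det_fderiv volume hmeas fun x hx =>
          (hasFDerivAt_partials (hv x (hsub hx))).hasFDerivWithinAt
    _ = ∫⁻ x in lowerContactSet m v r, ENNReal.ofReal (hessianDet m v x) :=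
        setLIntegral_congr_fun hmeas fun x hx => by
          simp only [det_toLpLin_hessianMatrix, abs_of_nonneg (hnonneg x hx)]
    _ = ENNReal.ofReal (∫ x in lowerContactSet m v r, hessianDet m v x) :=
        (ofReal_integral_eq_lintegral_ofReal hint hae).symm

end Hessian

/-- Alexandroff–Bakelman–Pucci-type estimate, Proposition 11 of
Székelyhidi. Let `m ≥ 1`.  There exists `c₀ > 0` depending only on `m` such that: for every
`v` smooth on a neighborhood of the closed unit ball of `ℝᵐ`, attaining its minimum over the
closed unit ball at the origin and with `v ≥ v(0) + ε` on the unit sphere (`ε > 0`), one has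
`c₀ εᵐ ≤ ∫_P det(D²v)`, where
`P = {x ∈ B₁(0) : |Dv(x)| ≤ ε/2, v(y) ≥ v(x) + Dv(x)·(y−x) ∀ y ∈ B₁(0)}`. -/
theorem stmt_11 (m : ℕ) (hm : 1 ≤ m) :
    ∃ c₀ : ℝ, 0 < c₀ ∧
      ∀ (v : EuclideanSpace ℝ (Fin m) → ℝ) (ε : ℝ), 0 < ε →
        (∃ U : Set (EuclideanSpace ℝ (Fin m)), IsOpen U ∧
          Metric.closedBall 0 1 ⊆ U ∧ ContDiffOn ℝ (⊤ : ℕ∞) v U) →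
        (∀ y ∈ Metric.closedBall (0 : EuclideanSpace ℝ (Fin m)) 1, v 0 ≤ v y) →
        (∀ y ∈ Metric.sphere (0 : EuclideanSpace ℝ (Fin m)) 1, v 0 + ε ≤ v y) →
        c₀ * ε ^ m ≤
          ∫ x in {x : EuclideanSpace ℝ (Fin m) |
              x ∈ Metric.ball (0 : EuclideanSpace ℝ (Fin m)) 1 ∧
              ‖fderiv ℝ v x‖ ≤ ε / 2 ∧
              ∀ y ∈ Metric.ball (0 : EuclideanSpace ℝ (Fin m)) 1,
                v x + fderiv ℝ v x (y - x) ≤ v y},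
            hessianDet m v x := by
  refine ⟨volume.real (Metric.ball (0 : EuclideanSpace ℝ (Fin m)) (1 / 2)),
    ENNReal.toReal_pos (Metric.measure_ball_pos volume _ (by norm_num)).ne'
      measure_ball_lt_top.ne, ?_⟩
  rintro v ε hε ⟨U, hU, hBU, hv⟩ - hb
  have hball : volume.real (Metric.ball (0 : EuclideanSpace ℝ (Fin m)) (1 / 2)) * ε ^ m =
      volume.real (Metric.ball (0 : EuclideanSpace ℝ (Fin m)) (ε / 2)) := by
    have := Measure.addHaar_ball_mul_of_pos volume (0 : EuclideanSpace ℝ (Fin m)) hε (1 / 2)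
    rw [finrank_euclideanSpace_fin] at this
    rw [div_eq_mul_one_div ε, measureReal_def, measureReal_def, this, ENNReal.toReal_mul,
      ENNReal.toReal_ofReal (by positivity), mul_comm]
  rw [hball]
  refine volume_ball_le_integral_hessianDet (fun x hx => ?_) fun y hy => ?_
  · exact (hv.contDiffAt (hU.mem_nhds (hBU hx))).of_le (by exact WithTop.coe_le_coe.2 le_top)
  · linarith [hb y hy]
end
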